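/- Let f be a strictly non-real meromorphic function in the complex plane such that, for every m = 0, 1, …, 10, all zeros of f^{(m)} are real, and assume that for every m ≥ 0 the derivative f^{(m)} has infinite order or infinitely many poles. With g = f̃ and K_m the meromorphic function satisfying F_m' = K_m G_m' (so each K_m has no zeros and no poles), there do not exist integers m, m' with 2 ≤ m < m' ≤ 7 such that K_m and K_{m'} are both constant. -/

import Mathlib

open Complex Filter Topology MeasureTheory
open scoped Classical

noncomputable section

/-- `mtilde f` is the function `z ↦ conj (f (conj z))`, denoted `f̃` in the paper. -/
def mtilde (f : ℂ → ℂ) : ℂ → ℂ := fun z => (starRingEnd ℂ) (f ((starRingEnd ℂ) z))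

/-- Equality of meromorphic functions: near every point of `ℂ`, the two functions agree on a
punctured neighbourhood (so the set where they disagree is closed and discrete). -/
def MeroEq (h₁ h₂ : ℂ → ℂ) : Prop := ∀ z : ℂ, ∀ᶠ w in 𝓝[≠] z, h₁ w = h₂ w

/-- `f` is strictly non-real: `f̃` is not a constant multiple of `f`. -/
def StrictlyNonReal (f : ℂ → ℂ) : Prop := ¬ ∃ c : ℂ, MeroEq (mtilde f) (fun z => c * f z)

/-- A rational function, as a meromorphic function on `ℂ`. -/
def IsRatFn (h : ℂ → ℂ) : Prop :=
  ∃ p q : Polynomial ℂ, q ≠ 0 ∧ MeroEq h (fun z => p.eval z / q.eval z)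

/-- The order of vanishing (negative at a pole) of a function at a point, when the function is
meromorphic there; junk value `0` otherwise. -/
def meroOrder (h : ℂ → ℂ) (z : ℂ) : WithTop ℤ :=
  if hh : MeromorphicAt h z then meromorphicOrderAt h z else 0

/-- The positive part of the logarithm. -/
def logPlus (x : ℝ) : ℝ := max (Real.log x) 0

/-- The Nevanlinna proximity function `m(r, h)`. -/
def proximity (h : ℂ → ℂ) (r : ℝ) : ℝ :=
  (2 * Real.pi)⁻¹ * ∫ θ in (0:ℝ)..(2 * Real.pi),
    logPlus ‖h ((r : ℂ) * Complex.exp (θ * Complex.I))‖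

/-- The multiplicity of a pole of `h` at `z` (0 if not a pole). -/
def poleMult (h : ℂ → ℂ) (z : ℂ) : ℕ := (-((meroOrder h z).untopD 0)).toNat

/-- The number of poles, counted with multiplicity, in the closed disc of radius `t`. -/
def poleCount (h : ℂ → ℂ) (t : ℝ) : ℝ := ∑ᶠ z ∈ Metric.closedBall (0:ℂ) t, (poleMult h z : ℝ)

/-- The integrated counting function `N(r, h)` of the poles of `h` (with multiplicity). -/
def NCount (h : ℂ → ℂ) (r : ℝ) : ℝ := ∫ t in (1:ℝ)..r, poleCount h t / t

/-- The Nevanlinna characteristic `T(r, h) = m(r, h) + N(r, h)`. -/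
def TChar (h : ℂ → ℂ) (r : ℝ) : ℝ := proximity h r + NCount h r

/-- The number of points of `S` in the closed disc of radius `t`. -/
def distinctCount (S : Set ℂ) (t : ℝ) : ℝ := (S ∩ Metric.closedBall (0:ℂ) t).ncard

/-- The integrated counting function `N̄(r, h)` of the distinct poles of `h`. -/
def NbarPoles (h : ℂ → ℂ) (r : ℝ) : ℝ :=
  ∫ t in (1:ℝ)..r, distinctCount {z | meroOrder h z < 0} t / t

/-- The integrated counting function `N̄(r, 1/h)` of the distinct zeros of `h`. -/
def NbarZeros (h : ℂ → ℂ) (r : ℝ) : ℝ :=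
  ∫ t in (1:ℝ)..r, distinctCount {z | 0 < meroOrder h z} t / t

/-- `h` has finite (Nevanlinna) order: `T(r, h) ≤ r ^ C` for all large `r`. -/
def FiniteOrder (h : ℂ → ℂ) : Prop := ∃ C : ℝ, ∀ᶠ r in atTop, TChar h r ≤ r ^ C

/-- `h` has finite lower order: `T(r, h) ≤ r ^ C` for arbitrarily large `r`. -/
def FiniteLowerOrder (h : ℂ → ℂ) : Prop := ∃ C : ℝ, ∃ᶠ r in atTop, TChar h r ≤ r ^ C

/-- The Setup of Section 3 of the paper: `M ≥ 4` and `f` is a strictly non-real meromorphic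
function in the plane such that `f, f', …, f^(M+3)` all have finitely many non-real zeros. -/
def Setup (M : ℕ) (f : ℂ → ℂ) : Prop :=
  4 ≤ M ∧ (∀ z, MeromorphicAt f z) ∧ StrictlyNonReal f ∧
    ∀ m, m ≤ M + 3 → {z : ℂ | 0 < meroOrder (iteratedDeriv m f) z ∧ z.im ≠ 0}.Finite

/-- The function `F_m(z) = z - f^(m)(z) / f^(m+1)(z)`. -/
def Fm (f : ℂ → ℂ) (m : ℕ) : ℂ → ℂ :=
  fun z => z - iteratedDeriv m f z / iteratedDeriv (m + 1) f z

/-- `Km` is the meromorphic function with finitely many zeros and poles satisfying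
`F_m' = K_m G_m'`, where `G_m` is the analogue of `F_m` for `g = f̃`. -/
def IsKm (f : ℂ → ℂ) (m : ℕ) (Km : ℂ → ℂ) : Prop :=
  (∀ z, MeromorphicAt Km z) ∧ {z | 0 < meroOrder Km z}.Finite ∧
    {z | meroOrder Km z < 0}.Finite ∧
    MeroEq (deriv (Fm f m)) (fun z => Km z * deriv (Fm (mtilde f) m) z)

end

/-- Normal (continuous) convergence near a point along an ultrafilter. -/
def NC (U : Ultrafilter ℕ) (F : ℕ → ℂ → ℂ) (f : ℂ → ℂ) (z : ℂ) : Prop :=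
  (∀ᶠ p in (U : Filter ℕ) ×ˢ 𝓝 z, DifferentiableAt ℂ (F p.1) p.2) ∧
  ∀ᶠ y in 𝓝 z, Tendsto (fun p : ℕ × ℂ => F p.1 p.2) ((U : Filter ℕ) ×ˢ 𝓝 y) (𝓝 (f y))

lemma prod_nhds_iff {U : Ultrafilter ℕ} {z : ℂ} {P : ℕ × ℂ → Prop} :
    (∀ᶠ p in (U : Filter ℕ) ×ˢ 𝓝 z, P p) ↔
      ∃ r > 0, ∀ᶠ n in (U : Filter ℕ), ∀ y ∈ Metric.ball z r, P (n, y) := by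
  constructor
  · intro h
    obtain ⟨a, ha, b, hb, hab⟩ := Filter.eventually_prod_iff.1 h
    obtain ⟨r, hr, hr'⟩ := Metric.eventually_nhds_iff_ball.1 hb
    exact ⟨r, hr, ha.mono fun n hn y hy => hab hn (hr' y hy)⟩
  · rintro ⟨r, hr, h⟩
    have := h.prod_mk (Metric.ball_mem_nhds z hr)
    exact this.mono fun p hp => hp.1 _ hp.2

lemma NC.tendsto {U F f z} (h : NC U F f z) :
    Tendsto (fun p : ℕ × ℂ => F p.1 p.2) ((U : Filter ℕ) ×ˢ 𝓝 z) (𝓝 (f z)) := h.2.self_of_nhds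

lemma NC.eventually {U F f z} (h : NC U F f z) : ∀ᶠ y in 𝓝 z, NC U F f y := by
  obtain ⟨r, hr, hd⟩ := prod_nhds_iff.1 h.1
  filter_upwards [h.2.eventually_nhds, Metric.ball_mem_nhds z hr] with y hy hyr
  refine ⟨prod_nhds_iff.2 ?_, hy⟩
  obtain ⟨s, hs, hs'⟩ := Metric.isOpen_iff.1 Metric.isOpen_ball y hyr
  exact ⟨s, hs, hd.mono fun n hn w hw => hn w (hs' hw)⟩

lemma NC.tendsto_pt {U F f z} (h : NC U F f z) :
    Tendsto (fun n => F n z) (U : Filter ℕ) (𝓝 (f z)) := by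
  have : Tendsto (fun n => ((n, z) : ℕ × ℂ)) (U : Filter ℕ) ((U : Filter ℕ) ×ˢ 𝓝 z) :=
    tendsto_id.prodMk tendsto_const_nhds
  exact h.tendsto.comp this

lemma NC.tendsto_seq {U F f z} (h : NC U F f z) {w : ℕ → ℂ} (hw : Tendsto w (U : Filter ℕ) (𝓝 z)) :
    Tendsto (fun n => F n (w n)) (U : Filter ℕ) (𝓝 (f z)) := by
  have : Tendsto (fun n => ((n, w n) : ℕ × ℂ)) (U : Filter ℕ) ((U : Filter ℕ) ×ˢ 𝓝 z) :=
    tendsto_id.prodMk hw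
  exact h.tendsto.comp this

lemma contAt_of_cconv {U : Ultrafilter ℕ} {F : ℕ → ℂ → ℂ} {f : ℂ → ℂ} {z : ℂ}
    (h : ∀ᶠ y in 𝓝 z, Tendsto (fun p : ℕ × ℂ => F p.1 p.2) ((U : Filter ℕ) ×ˢ 𝓝 y) (𝓝 (f y))) :
    ContinuousAt f z := by
  rw [Metric.continuousAt_iff']
  intro ε hε
  have h1 := h.self_of_nhds
  rw [Metric.tendsto_nhds] at h1
  obtain ⟨r, hr, hd⟩ := prod_nhds_iff.1 (h1 (ε/2) (by positivity))
  filter_upwards [h, Metric.ball_mem_nhds z hr] with y hy hyr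
  have h2 : Tendsto (fun n => F n y) (U : Filter ℕ) (𝓝 (f y)) :=
    hy.comp (tendsto_id.prodMk tendsto_const_nhds)
  have h3 : dist (f y) (f z) ≤ ε/2 := by
    refine le_of_tendsto (h2.dist tendsto_const_nhds) (hd.mono fun n hn => (hn y hyr).le)
  linarith

lemma NC.locUnif {U F f z} (h : NC U F f z) : ∃ r > 0,
    (∀ᶠ n in (U : Filter ℕ), DifferentiableOn ℂ (F n) (Metric.ball z r)) ∧
    TendstoLocallyUniformlyOn F f (U : Filter ℕ) (Metric.ball z r) ∧
    (∀ y ∈ Metric.ball z r, NC U F f y) := by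
  obtain ⟨r1, hr1, hd⟩ := prod_nhds_iff.1 h.1
  obtain ⟨r2, hr2, h2⟩ := Metric.eventually_nhds_iff_ball.1 h.eventually
  refine ⟨min r1 r2, lt_min hr1 hr2, hd.mono fun n hn y hy => (hn y ?_).differentiableWithinAt,
    ?_, fun y hy => h2 y (Metric.ball_subset_ball (min_le_right _ _) hy)⟩
  · exact Metric.ball_subset_ball (min_le_left _ _) hy
  · rw [tendstoLocallyUniformlyOn_iff_forall_tendsto]
    intro y hy
    have hy' := h2 y (Metric.ball_subset_ball (min_le_right _ _) hy)
    have hc := contAt_of_cconv hy'.2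
    have h3 : Tendsto (fun p : ℕ × ℂ => (f p.2, F p.1 p.2)) ((U : Filter ℕ) ×ˢ 𝓝 y)
        (𝓝 (f y, f y)) := by
      rw [nhds_prod_eq]
      exact ((hc.tendsto).comp tendsto_snd).prodMk hy'.tendsto
    refine (h3.mono_right (nhds_le_uniformity _)).mono_left ?_
    exact Filter.prod_mono le_rfl nhdsWithin_le_nhds

lemma NC.differentiableAt {U F f z} (h : NC U F f z) : DifferentiableAt ℂ f z := by
  obtain ⟨r, hr, h1, h2, -⟩ := h.locUnif
  exact (h2.differentiableOn h1 Metric.isOpen_ball).differentiableAt (Metric.ball_mem_nhds z hr)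

lemma NC.analyticAt {U F f z} (h : NC U F f z) : AnalyticAt ℂ f z := by
  rw [Complex.analyticAt_iff_eventually_differentiableAt]
  exact h.eventually.mono fun y hy => hy.differentiableAt

lemma NC.deriv {U F f z} (h : NC U F f z) : NC U (fun n => deriv (F n)) (deriv f) z := by
  obtain ⟨r, hr, h1, h2, h3⟩ := h.locUnif
  have h4 := h2.deriv h1 Metric.isOpen_ball
  refine ⟨prod_nhds_iff.2 ⟨r, hr, h1.mono fun n hn y hy => ?_⟩, ?_⟩
  · exact (hn.deriv Metric.isOpen_ball).differentiableAt (Metric.isOpen_ball.mem_nhds hy)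
  · filter_upwards [Metric.ball_mem_nhds z hr] with y hy
    have hc : ContinuousAt (_root_.deriv f) y := (h3 y hy).analyticAt.deriv.continuousAt
    rw [tendstoLocallyUniformlyOn_iff_forall_tendsto] at h4
    have h5 := h4 y hy
    rw [Metric.isOpen_ball.nhdsWithin_eq hy] at h5
    rw [Metric.tendsto_nhds]
    intro ε hε
    have h6 := h5 (Metric.dist_mem_uniformity (half_pos hε))
    have h7 := (hc.tendsto.comp (tendsto_snd (f := (U : Filter ℕ)) (g := 𝓝 y)))
    rw [Metric.tendsto_nhds] at h7
    filter_upwards [h6, h7 (ε/2) (half_pos hε)] with p hp hq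
    simp only [Set.mem_preimage, Set.mem_setOf_eq, Function.comp] at hp hq
    calc dist _ _ ≤ dist (_root_.deriv (F p.1) p.2) (_root_.deriv f p.2) +
          dist (_root_.deriv f p.2) (_root_.deriv f y) := dist_triangle _ _ _
      _ < ε := by rw [dist_comm] at hp; linarith

lemma NC.add {U F f G g z} (h : NC U F f z) (h' : NC U G g z) :
    NC U (fun n w => F n w + G n w) (fun w => f w + g w) z := by
  refine ⟨?_, ?_⟩
  · filter_upwards [h.1, h'.1] with p hp hq using hp.add hq
  · filter_upwards [h.2, h'.2] with p hp hq using hp.add hq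

lemma NC.sub {U F f G g z} (h : NC U F f z) (h' : NC U G g z) :
    NC U (fun n w => F n w - G n w) (fun w => f w - g w) z := by
  refine ⟨?_, ?_⟩
  · filter_upwards [h.1, h'.1] with p hp hq using hp.sub hq
  · filter_upwards [h.2, h'.2] with p hp hq using hp.sub hq

lemma NC.mul {U F f G g z} (h : NC U F f z) (h' : NC U G g z) :
    NC U (fun n w => F n w * G n w) (fun w => f w * g w) z := by
  refine ⟨?_, ?_⟩
  · filter_upwards [h.1, h'.1] with p hp hq using hp.mul hq
  · filter_upwards [h.2, h'.2] with p hp hq using hp.mul hq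

lemma NC.inv {U F f z} (h : NC U F f z) (h0 : f z ≠ 0) :
    NC U (fun n w => (F n w)⁻¹) (fun w => (f w)⁻¹) z := by
  refine ⟨?_, ?_⟩
  · filter_upwards [h.1, h.tendsto.eventually_ne h0] with p hp hq using hp.inv hq
  · filter_upwards [h.2, h.differentiableAt.continuousAt.eventually_ne h0] with p hp hq
      using hp.inv₀ hq

lemma NC.div {U F f G g z} (h : NC U F f z) (h' : NC U G g z) (h0 : g z ≠ 0) :
    NC U (fun n w => F n w / G n w) (fun w => f w / g w) z := by
  simp only [div_eq_mul_inv]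
  exact h.mul (h'.inv h0)

lemma NC.const {U : Ultrafilter ℕ} {c : ℕ → ℂ} {d : ℂ} (h : Tendsto c (U : Filter ℕ) (𝓝 d)) (z : ℂ) :
    NC U (fun n _ => c n) (fun _ => d) z :=
  ⟨Eventually.of_forall fun _ => differentiableAt_const _,
    Eventually.of_forall fun _ => h.comp tendsto_fst⟩

lemma NC.exp {U F f z} (h : NC U F f z) :
    NC U (fun n w => Complex.exp (F n w)) (fun w => Complex.exp (f w)) z := by
  refine ⟨?_, ?_⟩
  · filter_upwards [h.1] with p hp using hp.cexp
  · filter_upwards [h.2] with p hp using (Complex.continuous_exp.tendsto _).comp hp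

lemma NC.congr {U F f G z} (h : NC U F f z)
    (he : ∀ᶠ p in (U : Filter ℕ) ×ˢ 𝓝 z, F p.1 p.2 = G p.1 p.2) : NC U G f z := by
  obtain ⟨r, hr, hd⟩ := prod_nhds_iff.1 he
  have key : ∀ y ∈ Metric.ball z r, ∀ᶠ p in (U : Filter ℕ) ×ˢ 𝓝 y, F p.1 =ᶠ[𝓝 p.2] G p.1 := by
    intro y hy
    obtain ⟨s, hs, hs'⟩ := Metric.isOpen_iff.1 Metric.isOpen_ball y hy
    refine (prod_nhds_iff (P := fun p => F p.1 =ᶠ[𝓝 p.2] G p.1)).2 ⟨s, hs, hd.mono fun n hn w hw => ?_⟩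
    filter_upwards [Metric.isOpen_ball.mem_nhds hw] with x hx using hn x (hs' hx)
  refine ⟨?_, ?_⟩
  · filter_upwards [h.1, key z (Metric.mem_ball_self hr)] with p hp hq
    exact hp.congr_of_eventuallyEq hq.symm
  · filter_upwards [h.2, Metric.ball_mem_nhds z hr] with y hy hyr
    refine hy.congr' ?_
    filter_upwards [key y hyr] with p hp using hp.self_of_nhds

lemma NC.congr_lim {U F f g z} (h : NC U F f z) (he : f =ᶠ[𝓝 z] g) : NC U F g z := by
  refine ⟨h.1, ?_⟩
  filter_upwards [h.2, he] with y hy hq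
  rw [← hq]; exact hy

lemma tendsto_of_bdd_ultra {U : Ultrafilter ℕ} {a : ℕ → ℂ} {M : ℝ}
    (h : ∀ᶠ n in (U : Filter ℕ), ‖a n‖ ≤ M) : ∃ l, ‖l‖ ≤ M ∧ Tendsto a (U : Filter ℕ) (𝓝 l) := by
  have hc : IsCompact (Metric.closedBall (0:ℂ) M) := isCompact_closedBall _ _
  obtain ⟨x, hx, hx'⟩ := hc.ultrafilter_le_nhds (U.map a) (by
    rw [le_principal_iff]
    exact h.mono fun n hn => by simpa using hn)
  exact ⟨x, by simpa using hx, hx'⟩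

/-- Locally bounded sequences converge normally along an ultrafilter (Montel). -/
lemma montel {U : Ultrafilter ℕ} {F : ℕ → ℂ → ℂ} {Ω : Set ℂ}
    (h : ∀ z ∈ Ω, ∃ r > 0, ∃ M : ℝ, ∀ᶠ n in (U : Filter ℕ), ∀ y ∈ Metric.ball z r,
      DifferentiableAt ℂ (F n) y ∧ ‖F n y‖ ≤ M) :
    ∃ f : ℂ → ℂ, ∀ z ∈ interior Ω, NC U F f z := by
  have hpt : ∀ z : ℂ, ∃ l : ℂ, z ∈ Ω → Tendsto (fun n => F n z) (U : Filter ℕ) (𝓝 l) := by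
    intro z
    by_cases hz : z ∈ Ω
    · obtain ⟨r, hr, M, hM⟩ := h z hz
      obtain ⟨l, -, hl⟩ := tendsto_of_bdd_ultra (U := U) (a := fun n => F n z) (M := M)
        (hM.mono fun n hn => (hn z (Metric.mem_ball_self hr)).2)
      exact ⟨l, fun _ => hl⟩
    · exact ⟨0, fun h => absurd h hz⟩
  choose f hf using hpt
  refine ⟨f, fun z hz => ?_⟩
  have key : ∀ y ∈ Ω, Tendsto (fun p : ℕ × ℂ => F p.1 p.2) ((U : Filter ℕ) ×ˢ 𝓝 y) (𝓝 (f y)) := by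
    intro y hy
    obtain ⟨r, hr, M, hM⟩ := h y hy
    rw [Metric.tendsto_nhds]
    intro ε hε
    have hM0 : 0 < |M| + 1 := by positivity
    -- Lipschitz
    have hlip : ∀ᶠ n in (U : Filter ℕ), ∀ w ∈ Metric.ball y (r/2),
        ‖F n w - F n y‖ ≤ ((|M| + 1) / (r/4)) * ‖w - y‖ := by
      filter_upwards [hM] with n hn w hw
      refine Convex.norm_image_sub_le_of_norm_deriv_le (𝕜 := ℂ) (s := Metric.ball y (r/2)) ?_ ?_
        (convex_ball _ _) (Metric.mem_ball_self (by positivity)) hw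
      · intro x hx
        exact (hn x (Metric.ball_subset_ball (by linarith) hx)).1
      · intro x hx
        have hsub : Metric.closedBall x (r/4) ⊆ Metric.ball y r := by
          intro t ht
          simp only [Metric.mem_closedBall, Metric.mem_ball] at *
          have := dist_triangle t x y
          linarith
        refine norm_deriv_le_of_forall_mem_sphere_norm_le (by positivity) ?_ ?_
        · apply DifferentiableOn.diffContOnCl
          intro t ht
          exact (hn t (hsub (Metric.closure_ball_subset_closedBall ht))).1.differentiableWithinAt
        · intro t ht
          exact (hn t (hsub (Metric.sphere_subset_closedBall ht))).2.trans
            ((le_abs_self M).trans (by linarith))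
    have h2 := (Metric.tendsto_nhds.1 (hf y hy)) (ε/2) (half_pos hε)
    set K := (|M| + 1) / (r/4) with hK
    have hK0 : 0 < K := by positivity
    refine (prod_nhds_iff (P := fun p => dist (F p.1 p.2) (f y) < ε)).2
      ⟨min (r/2) (ε / (2*K)), lt_min (by positivity) (by positivity), ?_⟩
    filter_upwards [hlip, h2] with n hn1 hn2 w hw
    have hw1 : w ∈ Metric.ball y (r/2) := Metric.ball_subset_ball (min_le_left _ _) hw
    have hw2 : ‖w - y‖ < ε / (2*K) := by
      have := Metric.ball_subset_ball (min_le_right _ _) hw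
      simpa [dist_eq_norm] using this
    have h3 := hn1 w hw1
    have h4 : K * ‖w - y‖ < ε/2 := by
      calc K * ‖w - y‖ < K * (ε / (2*K)) := by gcongr
        _ = ε/2 := by field_simp
    calc dist (F n w) (f y) ≤ dist (F n w) (F n y) + dist (F n y) (f y) := dist_triangle _ _ _
      _ < ε := by rw [dist_eq_norm]; linarith
  obtain ⟨r, hr, M, hM⟩ := h z (interior_subset hz)
  refine ⟨prod_nhds_iff.2 ⟨r, hr, hM.mono fun n hn y hy => (hn y hy).1⟩, ?_⟩
  filter_upwards [isOpen_interior.mem_nhds hz] with y hy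
  exact key y (interior_subset hy)

/-- Hurwitz: zeros of limits come from zeros. -/
lemma hurwitz {U : Ultrafilter ℕ} {F : ℕ → ℂ → ℂ} {f : ℂ → ℂ} {z : ℂ} (h : NC U F f z)
    (h0 : f z = 0) (hne : ¬ ∀ᶠ w in 𝓝 z, f w = 0) :
    ∀ ε > 0, ∀ᶠ n in (U : Filter ℕ), ∃ w ∈ Metric.ball z ε, F n w = 0 := by
    intro ε hε
    obtain ⟨r0, hr0, hd, hlu, hnc⟩ := h.locUnif
    have hiso : ∀ᶠ w in 𝓝[≠] z, f w ≠ 0 :=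
      (h.analyticAt.eventually_eq_zero_or_eventually_ne_zero).resolve_left hne
    rw [eventually_nhdsWithin_iff] at hiso
    obtain ⟨r1, hr1, hr1'⟩ := Metric.eventually_nhds_iff_ball.1 hiso
    set r := min (min r0 r1) ε / 2 with hrdef
    have hr : 0 < r := by positivity
    have hrr0 : r < r0 := by
      have : min (min r0 r1) ε ≤ r0 := (min_le_left _ _).trans (min_le_left _ _)
      have : 0 < min (min r0 r1) ε := by positivity
      linarith
    have hrr1 : r < r1 := by
      have : min (min r0 r1) ε ≤ r1 := (min_le_left _ _).trans (min_le_right _ _)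
      have : 0 < min (min r0 r1) ε := by positivity
      linarith
    have hrε : r < ε := by
      have : min (min r0 r1) ε ≤ ε := (min_le_right _ _)
      have : 0 < min (min r0 r1) ε := by positivity
      linarith
    have hcomp : IsCompact (Metric.closedBall z r) := isCompact_closedBall _ _
    have hsub : Metric.closedBall z r ⊆ Metric.ball z r0 := Metric.closedBall_subset_ball hrr0
    have hfc : ContinuousOn f (Metric.closedBall z r) := fun y hy =>
      ((hnc y (hsub hy)).differentiableAt.continuousAt).continuousWithinAt
    obtain ⟨y0, hy0, hmin⟩ := (isCompact_sphere z r).exists_isMinOn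
      (NormedSpace.sphere_nonempty.2 hr.le)
      ((hfc.mono Metric.sphere_subset_closedBall).norm)
    have hδ : 0 < ‖f y0‖ := by
      rw [norm_pos_iff]
      refine hr1' y0 (Metric.closedBall_subset_ball hrr1 (Metric.sphere_subset_closedBall hy0)) ?_
      rintro rfl
      simp at hy0
      linarith
    set δ := ‖f y0‖ with hδd
    have hu := (tendstoLocallyUniformlyOn_iff_forall_isCompact Metric.isOpen_ball).1 hlu _ hsub hcomp
    rw [Metric.tendstoUniformlyOn_iff] at hu
    filter_upwards [hd, hu (δ/8) (by positivity)] with n hn1 hn2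
    have hz' : ‖F n z‖ < δ/8 := by
      have := hn2 z (Metric.mem_closedBall_self hr.le)
      rw [h0, dist_eq_norm] at this
      simpa using this
    have hsph : ∀ w ∈ Metric.sphere z r, δ/2 ≤ ‖F n w - F n z‖ := by
      intro w hw
      have a1 := hn2 w (Metric.sphere_subset_closedBall hw)
      have a2 : δ ≤ ‖f w‖ := hmin hw
      rw [dist_eq_norm] at a1
      have a3 : ‖f w‖ ≤ ‖f w - F n w‖ + ‖F n w - F n z‖ + ‖F n z‖ := by
        calc ‖f w‖ = ‖(f w - F n w) + (F n w - F n z) + F n z‖ := by congr 1; ring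
          _ ≤ _ := norm_add₃_le
      linarith
    have hdc : DiffContOnCl ℂ (F n) (Metric.ball z r) := by
      apply DifferentiableOn.diffContOnCl
      exact hn1.mono (Metric.closure_ball_subset_closedBall.trans hsub)
    have hfreq : ∃ᶠ w in 𝓝 z, F n w ≠ F n z := by
      by_contra hcon
      rw [not_frequently] at hcon
      simp only [not_not] at hcon
      -- then F n constant on ball
      have han : AnalyticOnNhd ℂ (F n) (Metric.ball z r0) := hn1.analyticOnNhd Metric.isOpen_ball
      have heq := han.eqOn_of_preconnected_of_eventuallyEq (g := fun _ => F n z)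
        analyticOnNhd_const (convex_ball z r0).isPreconnected (Metric.mem_ball_self hr0) hcon
      have := hsph y0 hy0
      rw [heq (hsub (Metric.sphere_subset_closedBall hy0))] at this
      simp at this
      linarith
    have hb := hdc.ball_subset_image_closedBall hr hsph hfreq
    obtain ⟨w, hw, hw0⟩ := hb (show (0:ℂ) ∈ _ by
      rw [Metric.mem_ball, dist_eq_norm, zero_sub, norm_neg]; linarith)
    exact ⟨w, Metric.closedBall_subset_ball hrε hw, hw0⟩


lemma fence {u : ℂ → ℂ} {p q : ℂ} {M M' D : ℝ}
    (hd : ∀ t ∈ Set.Icc (0:ℝ) 1, DifferentiableAt ℂ u (p + t * (q - p)))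
    (hb : ∀ t ∈ Set.Ico (0:ℝ) 1, ‖u (p + t * (q - p))‖ ≤ M' → ‖deriv u (p + t * (q - p))‖ ≤ D)
    (hD : 0 ≤ D) (hp : ‖u p‖ ≤ M) (hM : D * ‖q - p‖ < M' - M) : ‖u q‖ ≤ M' := by
  have hline : ∀ t : ℝ, HasDerivAt (fun s : ℝ => p + (s:ℂ) * (q - p)) (q - p) t := by
    intro t
    have := ((hasDerivAt_id (t:ℂ)).comp_ofReal.mul_const (q-p)).const_add p
    simpa using this
  have hder : ∀ t ∈ Set.Icc (0:ℝ) 1, HasDerivAt (fun s : ℝ => u (p + (s:ℂ) * (q - p)))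
      (deriv u (p + t * (q - p)) * (q - p)) t := by
    intro t ht
    exact (hd t ht).hasDerivAt.comp t (hline t)
  have hMM : M ≤ M' := by nlinarith [norm_nonneg (q-p), mul_nonneg hD (norm_nonneg (q-p))]
  have := image_norm_le_of_norm_deriv_right_lt_deriv_boundary'
    (f := fun s : ℝ => u (p + (s:ℂ) * (q - p))) (a := 0) (b := 1)
    (f' := fun t : ℝ => deriv u (p + t * (q - p)) * (q - p))
    (fun t ht => (hder t ht).continuousAt.continuousWithinAt)
    (fun t ht => (hder t ⟨ht.1, ht.2.le⟩).hasDerivWithinAt)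
    (B := fun t => M + (M' - M) * t) (B' := fun _ => M' - M)
    (by simpa using hp) (by fun_prop)
    (fun t _ => by
      have := ((hasDerivAt_id t).const_mul (M' - M)).const_add M
      simpa using this.hasDerivWithinAt)
    (fun t ht heq => by
      have h1 : ‖u (p + t * (q - p))‖ ≤ M' := by
        rw [heq]; nlinarith [ht.1, ht.2]
      have h2 := hb t ht h1
      rw [norm_mul]
      calc _ ≤ D * ‖q - p‖ := by gcongr
        _ < _ := hM)
    (Set.right_mem_Icc.2 zero_le_one)
  simpa using this

lemma exists_log_of_exact {f : ℂ → ℂ} {s : Set ℂ} (hs : IsOpen s) (hc : Convex ℝ s) {c : ℂ}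
    (hcs : c ∈ s) (hf : DifferentiableOn ℂ f s) (h0 : ∀ z ∈ s, f z ≠ 0)
    (hex : Complex.IsExactOn (fun z => deriv f z / f z) s) :
    ∃ g : ℂ → ℂ, DifferentiableOn ℂ g s ∧ (∀ z ∈ s, exp (g z) = f z) ∧
      ∀ z ∈ s, deriv g z = deriv f z / f z := by
  obtain ⟨g, hg⟩ := hex
  have hconst : ∀ z ∈ s, f z * exp (-g z) = f c * exp (-g c) := by
    have hd : ∀ z ∈ s, HasDerivAt (fun z => f z * exp (-g z)) 0 z := by
      intro z hz
      have h1 := (hf.differentiableAt (hs.mem_nhds hz)).hasDerivAt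
      have h2 := h1.mul ((hg z hz).neg.cexp)
      refine h2.congr_deriv ?_
      have h3 : f z * (deriv f z / f z) = deriv f z := mul_div_cancel₀ _ (h0 z hz)
      linear_combination -exp (-g z) * h3
    intro z hz
    have := hc.is_const_of_fderivWithin_eq_zero (𝕜 := ℂ) (f := fun z => f z * exp (-g z))
      (fun x hx => (hd x hx).differentiableAt.differentiableWithinAt) (fun x hx => by
        have h3 := (hd x hx).hasFDerivAt.hasFDerivWithinAt (s := s)
        rw [h3.fderivWithin (hs.uniqueDiffWithinAt hx)]
        ext; simp) hz hcs
    exact this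
  have hne : f c * exp (-g c) ≠ 0 := mul_ne_zero (h0 c hcs) (exp_ne_zero _)
  refine ⟨fun z => g z + Complex.log (f c * exp (-g c)), ?_, ?_, ?_⟩
  · intro z hz
    exact ((hg z hz).differentiableAt.add_const _).differentiableWithinAt
  · intro z hz
    rw [exp_add, exp_log hne, ← hconst z hz, mul_comm, mul_assoc, ← exp_add]
    simp
  · intro z hz
    exact ((hg z hz).add_const _).deriv

lemma exists_log_ball {f : ℂ → ℂ} {c : ℂ} {r : ℝ} (hf : DifferentiableOn ℂ f (Metric.ball c r))
    (h0 : ∀ z ∈ Metric.ball c r, f z ≠ 0) (hr : 0 < r) :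
    ∃ g : ℂ → ℂ, DifferentiableOn ℂ g (Metric.ball c r) ∧
      (∀ z ∈ Metric.ball c r, exp (g z) = f z) ∧
      ∀ z ∈ Metric.ball c r, deriv g z = deriv f z / f z :=
  exists_log_of_exact Metric.isOpen_ball (convex_ball c r) (Metric.mem_ball_self hr) hf h0
    (DifferentiableOn.isExactOn_ball ((hf.deriv Metric.isOpen_ball).div hf h0))

lemma exists_log_entire {f : ℂ → ℂ} (hf : Differentiable ℂ f) (h0 : ∀ z, f z ≠ 0) :
    ∃ g : ℂ → ℂ, Differentiable ℂ g ∧ (∀ z, exp (g z) = f z) ∧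
      ∀ z, deriv g z = deriv f z / f z := by
  obtain ⟨g, h1, h2, h3⟩ := exists_log_of_exact (s := Set.univ) (c := 0) isOpen_univ convex_univ
    (Set.mem_univ _) hf.differentiableOn (fun z _ => h0 z)
    (Differentiable.isExactOn_univ (by
      intro z
      exact ((hf.differentiableOn.deriv isOpen_univ).differentiableAt Filter.univ_mem).div (hf z) (h0 z)))
  exact ⟨g, fun z => h1.differentiableAt Filter.univ_mem, fun z => h2 z trivial,
    fun z => h3 z trivial⟩

lemma harnack_pos {g : ℂ → ℂ} {c : ℂ} {r : ℝ} (hg : DifferentiableOn ℂ g (Metric.ball c r))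
    (h0 : ∀ z ∈ Metric.ball c r, 0 < (g z).re) {z : ℂ} (hz : z ∈ Metric.ball c r) :
    |(g z).re - (g c).re| * r ≤ ‖z - c‖ * ((g z).re + (g c).re) := by
  have hr : 0 < r := by
    rw [Metric.mem_ball] at hz; exact lt_of_le_of_lt dist_nonneg hz
  have hc : 0 < (g c).re := h0 c (Metric.mem_ball_self hr)
  set w : ℂ → ℂ := fun z => (g z - g c) / (g z + (starRingEnd ℂ) (g c)) with hw
  have hden : ∀ z ∈ Metric.ball c r, g z + (starRingEnd ℂ) (g c) ≠ 0 := by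
    intro z hz h
    have := congrArg Complex.re h
    simp at this
    linarith [h0 z hz]
  have hns : ∀ z : ℂ, ‖g z - g c‖^2 = ((g z).re - (g c).re)^2 + ((g z).im - (g c).im)^2 := by
    intro z; rw [← Complex.normSq_eq_norm_sq, normSq_apply]; simp; ring
  have hns' : ∀ z : ℂ, ‖g z + (starRingEnd ℂ) (g c)‖^2
      = ((g z).re + (g c).re)^2 + ((g z).im - (g c).im)^2 := by
    intro z; rw [← Complex.normSq_eq_norm_sq, normSq_apply]; simp; ring
  have hwd : DifferentiableOn ℂ w (Metric.ball c r) :=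
    (hg.sub_const _).div (hg.add_const _) hden
  have hmap : Set.MapsTo w (Metric.ball c r) (Metric.closedBall (w c) 1) := by
    intro z hz
    have : w c = 0 := by simp [hw]
    rw [this]
    simp only [Metric.mem_closedBall, dist_zero_right, hw, norm_div]
    rw [div_le_one (norm_pos_iff.2 (hden z hz))]
    apply le_of_sq_le_sq _ (norm_nonneg _)
    rw [hns, hns']
    nlinarith [h0 z hz]
  have h1 := Complex.dist_le_div_mul_dist_of_mapsTo_ball hwd hmap hz
  have hwc : w c = 0 := by simp [hw]
  rw [hwc, dist_zero_right, dist_eq_norm] at h1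
  simp only [hw, norm_div] at h1
  rw [div_le_iff₀ (norm_pos_iff.2 (hden z hz))] at h1
  have hd : ‖z - c‖ < r := by simpa [dist_eq_norm] using hz
  set t := 1 / r * ‖z - c‖ with ht
  have ht0 : 0 ≤ t := by positivity
  have ht1 : t < 1 := by rw [ht, one_div, inv_mul_lt_iff₀ hr]; linarith
  have h2 : ‖g z - g c‖^2 ≤ t^2 * ‖g z + (starRingEnd ℂ) (g c)‖^2 := by
    rw [← mul_pow]; exact pow_le_pow_left₀ (norm_nonneg _) h1 2
  rw [hns, hns'] at h2
  have h3 : ((g z).re - (g c).re)^2 ≤ (t * ((g z).re + (g c).re))^2 := by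
    have : t^2 ≤ 1 := by nlinarith
    nlinarith [sq_nonneg ((g z).im - (g c).im)]
  have h4 := abs_le_of_sq_le_sq' h3 (mul_nonneg ht0 (by linarith [h0 z hz]))
  have h5 : |(g z).re - (g c).re| ≤ t * ((g z).re + (g c).re) := abs_le.2 h4
  calc _ ≤ (t * ((g z).re + (g c).re)) * r := by gcongr
    _ = _ := by rw [ht]; field_simp

lemma harnack_nonneg {g : ℂ → ℂ} {c : ℂ} {r : ℝ} (hg : DifferentiableOn ℂ g (Metric.ball c r))
    (h0 : ∀ z ∈ Metric.ball c r, 0 ≤ (g z).re) {z : ℂ} (hz : z ∈ Metric.ball c r) :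
    |(g z).re - (g c).re| * r ≤ ‖z - c‖ * ((g z).re + (g c).re) := by
  apply le_of_forall_pos_le_add
  intro ε hε
  have hr : 0 < r := by
    rw [Metric.mem_ball] at hz; exact lt_of_le_of_lt dist_nonneg hz
  have := harnack_pos (g := fun z => g z + ((ε / (2*r) : ℝ):ℂ)) (hg.add_const _) (fun z hz => by
    have := h0 z hz
    have h2 : 0 < ε / (2*r) := by positivity
    simp only [add_re, ofReal_re]; linarith) hz
  simp only [add_re, ofReal_re] at this
  have hd : ‖z - c‖ < r := by simpa [dist_eq_norm] using hz
  have e1 : (g z).re + ε / (2*r) - ((g c).re + ε / (2*r)) = (g z).re - (g c).re := by ring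
  rw [e1] at this
  have e2 : ‖z - c‖ * (2 * (ε / (2*r))) ≤ ε := by
    have : ‖z - c‖ * (2 * (ε / (2*r))) = ε * (‖z-c‖ / r) := by field_simp
    rw [this]
    have : ‖z-c‖ / r ≤ 1 := by rw [div_le_one hr]; exact hd.le
    nlinarith
  nlinarith

/-- Harnack inequality for zero-free bounded functions. -/
lemma harnack_le {f : ℂ → ℂ} {c : ℂ} {r B : ℝ} (hr : 0 < r)
    (hf : DifferentiableOn ℂ f (Metric.ball c r))
    (h0 : ∀ z ∈ Metric.ball c r, f z ≠ 0) (hB : ∀ z ∈ Metric.ball c r, Real.log ‖f z‖ ≤ B)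
    {z : ℂ} (hz : ‖z - c‖ ≤ r / 2) :
    B - Real.log ‖f z‖ ≤ 3 * (B - Real.log ‖f c‖) ∧ B - Real.log ‖f c‖ ≤ 3 * (B - Real.log ‖f z‖) := by
  obtain ⟨g, hg, hge, -⟩ := exists_log_ball hf h0 hr
  have hre : ∀ z ∈ Metric.ball c r, Real.log ‖f z‖ = (g z).re := by
    intro z hz; rw [← hge z hz, Complex.norm_exp, Real.log_exp]
  have hz' : z ∈ Metric.ball c r := by rw [Metric.mem_ball, dist_eq_norm]; linarith
  have h1 := harnack_nonneg (g := fun z => (B:ℂ) - g z) (hg.const_sub _) (fun z hz => by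
    simp only [sub_re, ofReal_re]
    rw [← hre z hz]; linarith [hB z hz]) hz'
  have hc' := Metric.mem_ball_self (x := c) hr
  simp only [sub_re, ofReal_re] at h1
  rw [hre z hz', hre c hc']
  have a1 : 0 ≤ B - (g z).re := by rw [← hre z hz']; linarith [hB z hz']
  have a2 : 0 ≤ B - (g c).re := by rw [← hre c hc']; linarith [hB c hc']
  have h2 : |B - (g z).re - (B - (g c).re)| * r ≤ (r/2) * (B - (g z).re + (B - (g c).re)) :=
    h1.trans (by gcongr)
  have h3 : |B - (g z).re - (B - (g c).re)| ≤ (1/2) * (B - (g z).re + (B - (g c).re)) := by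
    by_contra hcon
    push Not at hcon
    nlinarith
  have := abs_le.1 h3
  constructor <;> linarith

/-- If `‖u'‖ ≤ C (1 + ‖u‖²)` and `u` is large at the centre, it is large nearby. -/
lemma large_nearby {u : ℂ → ℂ} {q : ℂ} {r C : ℝ} (hC : 0 < C)
    (h : ∀ z ∈ Metric.ball q r, DifferentiableAt ℂ u z ∧ ‖deriv u z‖ ≤ C * (1 + ‖u z‖^2))
    (hq : 3 < ‖u q‖) {z : ℂ} (hz : z ∈ Metric.ball q r) (hz2 : ‖z - q‖ < 1 / (10 * C)) :
    1 < ‖u z‖ := by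
  by_contra hcon
  push Not at hcon
  have hseg : ∀ t ∈ Set.Icc (0:ℝ) 1, z + t * (q - z) ∈ Metric.ball q r := by
    intro t ht
    have hq' : q ∈ Metric.ball q r := Metric.mem_ball_self (by
      rw [Metric.mem_ball] at hz; exact lt_of_le_of_lt dist_nonneg hz)
    have := (convex_ball q r).add_smul_sub_mem hz hq' ht
    simpa using this
  have := fence (u := u) (p := z) (q := q) (M := 1) (M' := 3) (D := 10 * C)
    (fun t ht => (h _ (hseg t ht)).1) (fun t ht hu => by
      have := (h _ (hseg t ⟨ht.1, ht.2.le⟩)).2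
      refine this.trans ?_
      have h9 : ‖u (z + t * (q - z))‖^2 ≤ 9 := by nlinarith [norm_nonneg (u (z + t * (q - z)))]
      nlinarith) (by positivity) hcon (by
      rw [norm_sub_rev]
      calc 10 * C * ‖z - q‖ < 10 * C * (1 / (10*C)) := by gcongr
        _ = 1 := by field_simp
        _ < _ := by norm_num)
  linarith

/-- bounded at the centre implies bounded nearby -/
lemma bdd_nearby {u : ℂ → ℂ} {q : ℂ} {r C M : ℝ} (hC : 0 < C) (hM : 0 ≤ M)
    (h : ∀ z ∈ Metric.ball q r, DifferentiableAt ℂ u z ∧ ‖deriv u z‖ ≤ C * (1 + ‖u z‖^2))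
    (hq : ‖u q‖ ≤ M) {z : ℂ} (hz : z ∈ Metric.ball q r)
    (hz2 : ‖z - q‖ < 1 / (C * (1 + (M+1)^2))) :
    ‖u z‖ ≤ M + 1 := by
  have hseg : ∀ t ∈ Set.Icc (0:ℝ) 1, q + t * (z - q) ∈ Metric.ball q r := by
    intro t ht
    have hq' : q ∈ Metric.ball q r := Metric.mem_ball_self (by
      rw [Metric.mem_ball] at hz; exact lt_of_le_of_lt dist_nonneg hz)
    have := (convex_ball q r).add_smul_sub_mem hq' hz ht
    simpa using this
  refine fence (u := u) (p := q) (q := z) (M := M) (M' := M + 1) (D := C * (1 + (M+1)^2))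
    (fun t ht => (h _ (hseg t ht)).1) (fun t ht hu => by
      have := (h _ (hseg t ⟨ht.1, ht.2.le⟩)).2
      refine this.trans ?_
      gcongr) (by positivity) hq (by
      calc C * (1 + (M+1)^2) * ‖z - q‖ < C * (1 + (M+1)^2) * (1 / (C * (1 + (M+1)^2))) := by gcongr
        _ = 1 := by field_simp
        _ = _ := by ring)

/-- Dichotomy: locally bounded or locally uniformly to infinity. -/
lemma dichotomy {U : Ultrafilter ℕ} {u : ℕ → ℂ → ℂ} {Ω : Set ℂ} 
    (hΩc : IsPreconnected Ω)
    (h : ∀ q ∈ Ω, ∃ r > 0, ∃ C > 0, ∀ᶠ n in (U : Filter ℕ), ∀ z ∈ Metric.ball q r,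
      DifferentiableAt ℂ (u n) z ∧ ‖deriv (u n) z‖ ≤ C * (1 + ‖u n z‖^2)) :
    (∀ q ∈ Ω, ∃ r > 0, ∃ M : ℝ, ∀ᶠ n in (U : Filter ℕ), ∀ z ∈ Metric.ball q r,
      DifferentiableAt ℂ (u n) z ∧ ‖u n z‖ ≤ M) ∨
    (∀ q ∈ Ω, ∃ r > 0, ∀ M : ℝ, ∀ᶠ n in (U : Filter ℕ), ∀ z ∈ Metric.ball q r,
      DifferentiableAt ℂ (u n) z ∧ M ≤ ‖u n z‖) := by
  set A : Set ℂ := {q | ∃ r > 0, ∃ M : ℝ, ∀ᶠ n in (U : Filter ℕ), ∀ z ∈ Metric.ball q r,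
      DifferentiableAt ℂ (u n) z ∧ ‖u n z‖ ≤ M} with hA
  set B : Set ℂ := {q | ∃ r > 0, ∀ M : ℝ, ∀ᶠ n in (U : Filter ℕ), ∀ z ∈ Metric.ball q r,
      DifferentiableAt ℂ (u n) z ∧ M ≤ ‖u n z‖} with hB
  have hAo : IsOpen A := by
    rw [Metric.isOpen_iff]
    rintro q ⟨r, hr, M, hM⟩
    refine ⟨r, hr, fun y hy => ?_⟩
    obtain ⟨s, hs, hs'⟩ := Metric.isOpen_iff.1 Metric.isOpen_ball y hy
    exact ⟨s, hs, M, hM.mono fun n hn z hz => hn z (hs' hz)⟩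
  have hBo : IsOpen B := by
    rw [Metric.isOpen_iff]
    rintro q ⟨r, hr, hM⟩
    refine ⟨r, hr, fun y hy => ?_⟩
    obtain ⟨s, hs, hs'⟩ := Metric.isOpen_iff.1 Metric.isOpen_ball y hy
    exact ⟨s, hs, fun M => (hM M).mono fun n hn z hz => hn z (hs' hz)⟩
  have hdis : Disjoint A B := by
    rw [Set.disjoint_left]
    rintro q ⟨r, hr, M, hM⟩ ⟨s, hs, hS⟩
    obtain ⟨n, h1, h2⟩ := (hM.and (hS (M+1))).exists
    have a := (h1 q (Metric.mem_ball_self hr)).2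
    have b := (h2 q (Metric.mem_ball_self hs)).2
    linarith
  have hcov : Ω ⊆ A ∪ B := by
    intro q hq
    obtain ⟨r, hr, C, hC, hn⟩ := h q hq
    by_cases hb : ∃ M : ℝ, ∀ᶠ n in (U : Filter ℕ), ‖u n q‖ ≤ M
    · left
      obtain ⟨M, hM⟩ := hb
      refine ⟨min r (1 / (C * (1 + (|M|+1)^2))), lt_min hr (by positivity), |M| + 1, ?_⟩
      filter_upwards [hn, hM] with n h1 h2 z hz
      have hz1 : z ∈ Metric.ball q r := Metric.ball_subset_ball (min_le_left _ _) hz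
      refine ⟨(h1 z hz1).1, bdd_nearby hC (abs_nonneg M) h1 (h2.trans (le_abs_self M)) hz1 ?_⟩
      have := Metric.ball_subset_ball (min_le_right _ _) hz
      simpa [dist_eq_norm] using this
    · right
      push Not at hb
      have hinf : ∀ M : ℝ, ∀ᶠ n in (U : Filter ℕ), M < ‖u n q‖ := hb
      set δ := min r (1 / (10 * C)) with hδ
      have hδ0 : 0 < δ := lt_min hr (by positivity)
      refine ⟨δ/2, by positivity, fun M => ?_⟩
      filter_upwards [hn, hinf 3, hinf (Real.exp (3 * Real.log (|M| + 1)))] with n h1 h2 h3 z hz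
      have hsub : Metric.ball q δ ⊆ Metric.ball q r := Metric.ball_subset_ball (min_le_left _ _)
      have hlarge : ∀ w ∈ Metric.ball q δ, 1 < ‖u n w‖ := by
        intro w hw
        refine large_nearby hC h1 h2 (hsub hw) ?_
        have := Metric.ball_subset_ball (min_le_right _ _) hw
        simpa [dist_eq_norm] using this
      have hz1 : z ∈ Metric.ball q δ := Metric.ball_subset_ball (by linarith) hz
      refine ⟨(h1 z (hsub hz1)).1, ?_⟩
      have hH := (harnack_le (f := fun w => (u n w)⁻¹) (c := q) (r := δ) (B := 0) hδ0
        (fun w hw => ((h1 w (hsub hw)).1.inv (by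
          intro h0; have := hlarge w hw; rw [h0] at this; simp at this; linarith)).differentiableWithinAt)
        (fun w hw => inv_ne_zero (by
          intro h0; have := hlarge w hw; rw [h0] at this; simp at this; linarith))
        (fun w hw => by
          rw [norm_inv, Real.log_inv]
          have := Real.log_pos (hlarge w hw); linarith)
        (z := z) (by rw [Metric.mem_ball, dist_eq_norm] at hz; exact hz.le)).2
      simp only [norm_inv, Real.log_inv, zero_sub, neg_neg] at hH
      have h4 : 3 * Real.log (|M| + 1) < Real.log ‖u n q‖ := by
        rw [Real.lt_log_iff_exp_lt (by linarith)]; exact h3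
      have h5 : Real.log (|M| + 1) < Real.log ‖u n z‖ := by linarith
      have h6 := (Real.log_lt_log_iff (by positivity) (by linarith [hlarge z hz1])).1 h5
      linarith [le_abs_self M]
  rcases hΩc.subset_or_subset hAo hBo hdis hcov with h1 | h1
  · left; exact fun q hq => h1 hq
  · right; exact fun q hq => h1 hq


/-- Entire functions of polynomial growth along a sequence of radii are polynomials. -/
lemma poly_of_growth {g : ℂ → ℂ} (hg : Differentiable ℂ g) {C : ℝ} {N : ℕ}
    (h : ∃ᶠ r : ℝ in atTop, ∀ z, ‖z‖ ≤ r → ‖g z‖ ≤ C * r ^ N) :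
    ∃ p : Polynomial ℂ, p.natDegree ≤ N ∧ ∀ z, g z = p.eval z := by
  have hz : ∀ k, N < k → iteratedDeriv k g 0 = 0 := by
    intro k hk
    by_contra hne
    have hpos : 0 < ‖iteratedDeriv k g 0‖ := norm_pos_iff.2 hne
    have hlim : Tendsto (fun r : ℝ => (k.factorial * |C|) / r) atTop (𝓝 0) :=
      tendsto_const_nhds.div_atTop tendsto_id
    obtain ⟨r, h1, h2, h3⟩ := (h.and_eventually
      ((hlim.eventually (gt_mem_nhds hpos)).and (eventually_ge_atTop 1))).exists
    have h4 := Complex.norm_iteratedDeriv_le_of_forall_mem_sphere_norm_le (c := 0) (f := g)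
      (R := r) (C := |C| * r ^ N) k (by linarith) hg.diffContOnCl (fun z hz => by
        have := h1 z (by simpa using (le_of_eq (mem_sphere_zero_iff_norm.1 hz)))
        refine this.trans ?_
        gcongr
        exact le_abs_self C)
    have h5 : k.factorial * (|C| * r ^ N) / r ^ k ≤ (k.factorial * |C|) / r := by
      rw [div_le_div_iff₀ (by positivity) (by linarith)]
      have : r ^ N * r ≤ r ^ k := by
        rw [← pow_succ]; exact pow_le_pow_right₀ h3 hk
      calc _ = (k.factorial * |C|) * (r ^ N * r) := by ring
        _ ≤ _ := by gcongr
    linarith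
  refine ⟨∑ n ∈ Finset.range (N+1), Polynomial.C ((n.factorial : ℂ)⁻¹ * iteratedDeriv n g 0) * Polynomial.X ^ n, ?_, ?_⟩
  · refine Polynomial.natDegree_sum_le_of_forall_le _ _ (fun n hn => ?_)
    refine (Polynomial.natDegree_C_mul_X_pow_le _ _).trans ?_
    have := Finset.mem_range.1 hn; omega
  · intro z
    have h1 := Complex.taylorSeries_eq_of_entire' (c := 0) (z := z) hg
    rw [← h1, tsum_eq_sum (s := Finset.range (N+1)) (fun n hn => by
      rw [hz n (by simpa using hn)]; simp)]
    simp [Polynomial.eval_finsetSum]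

lemma borel_deriv {q : ℂ → ℂ} {c : ℂ} {r B : ℝ} (hr : 0 < r)
    (hq : DifferentiableOn ℂ q (Metric.ball c r))
    (hB : ∀ z ∈ Metric.ball c r, |(q z).re| ≤ B) (hB0 : 0 < B) : ‖deriv q c‖ ≤ 16 * B / r := by
  set f : ℂ → ℂ := fun ζ => q (c + ζ) - q c with hf
  have hmem : ∀ ζ ∈ Metric.ball (0:ℂ) r, c + ζ ∈ Metric.ball c r := by
    intro ζ hζ; simpa using hζ
  have hfd : DifferentiableOn ℂ f (Metric.ball 0 r) := by
    intro ζ hζ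
    have h1 : DifferentiableAt ℂ q (c + ζ) := hq.differentiableAt (Metric.isOpen_ball.mem_nhds (hmem ζ hζ))
    exact ((h1.comp ζ (by fun_prop)).sub_const _).differentiableWithinAt
  have hb := fun z (hz : z ∈ Metric.ball (0:ℂ) r) => Complex.borelCaratheodory_zero (M := 2 * B) (by positivity) hfd
    (fun ζ hζ => by
      simp only [hf, Set.mem_ofPred_eq, sub_re]
      have a := abs_le.1 (hB _ (hmem ζ hζ))
      have b := abs_le.1 (hB _ (Metric.mem_ball_self hr))
      linarith) hr hz (by simp [hf])
  have hd : deriv f 0 = deriv q c := by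
    simp only [hf]
    rw [deriv_sub_const, deriv_comp_const_add]; simp
  rw [← hd]
  have := Complex.norm_deriv_le_of_forall_mem_sphere_norm_le (c := 0) (f := f) (R := r/2) (C := 4*B)
    (by positivity) ((hfd.mono (Metric.closedBall_subset_ball (by linarith))).diffContOnCl_ball (subset_refl _)) (fun z hz => by
      have hz' : ‖z‖ = r/2 := by simpa using hz
      have := hb z (by simp [hz']; linarith)
      rw [hz'] at this
      have e : 2 * (2 * B) * (r/2) / (r - r/2) = 4 * B := by field_simp; ring
      linarith)
  refine this.trans ?_
  rw [div_le_div_iff₀ (by positivity) hr]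
  nlinarith [mul_pos hB0 hr]

/-- Clunie--Hayman type growth bound. -/
lemma clunie_hayman {u : ℂ → ℂ} (hu : Differentiable ℂ u) {C : ℝ} (hC : 0 < C)
    (hb : ∀ z, ‖deriv u z‖ ≤ C * (1 + ‖u z‖^2)) :
    ∃ A > 0, ∀ z, Real.log (1 + ‖u z‖) ≤ A * (1 + ‖z‖) := by
  by_cases hS : ∃ s, ‖u s‖ ≤ 1
  swap
  · push Not at hS
    have hd : Differentiable ℂ (fun z => (u z)⁻¹) := fun z => (hu z).inv (by
      intro h0; have := hS z; rw [h0] at this; simp at this; linarith)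
    obtain ⟨c, hc⟩ := hd.exists_const_forall_eq_of_bounded (by
      rw [isBounded_iff_forall_norm_le]
      refine ⟨1, ?_⟩
      rintro _ ⟨z, rfl⟩
      simp only [norm_inv]
      exact inv_le_one_of_one_le₀ (hS z).le)
    have hl := Real.log_nonneg (show (1:ℝ) ≤ 1 + ‖u 0‖ by linarith [norm_nonneg (u 0)])
    refine ⟨Real.log (1 + ‖u 0‖) + 1, by positivity, fun z => ?_⟩
    have : u z = u 0 := inv_injective ((hc z).trans (hc 0).symm)
    rw [this]; nlinarith [norm_nonneg z]
  obtain ⟨s, hs⟩ := hS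
  set S : Set ℂ := {z | ‖u z‖ ≤ 1} with hSd
  have hScl : IsClosed S := isClosed_le hu.continuous.norm continuous_const
  have hSne : S.Nonempty := ⟨s, hs⟩
  have key : ∀ z, 1 < ‖u z‖ → Real.log ‖u z‖ ≤ 4 * C * (‖z‖ + ‖s‖) := by
    intro z hz
    obtain ⟨z1, hz1, hdist⟩ := hScl.exists_infDist_eq_dist hSne z
    have hzz : z ≠ z1 := by rintro rfl; exact absurd hz1 (by simpa [hSd] using hz)
    set R := dist z z1 with hR
    have hRpos : 0 < R := dist_pos.2 hzz
    have hbig : ∀ w ∈ Metric.ball z R, 1 < ‖u w‖ := by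
      intro w hw
      by_contra hcon
      have : w ∈ S := by simpa [hSd] using hcon
      have h1 := Metric.infDist_le_dist_of_mem (x := z) this
      rw [Metric.mem_ball, dist_comm] at hw
      linarith
    have hne : ∀ w ∈ Metric.ball z R, u w ≠ 0 := by
      intro w hw h0; have := hbig w hw; rw [h0] at this; simp at this; linarith
    obtain ⟨g, hg, hge, -⟩ := exists_log_ball hu.differentiableOn hne hRpos
    have hre : ∀ w ∈ Metric.ball z R, (g w).re = Real.log ‖u w‖ := by
      intro w hw; rw [← hge w hw, Complex.norm_exp, Real.log_exp]
    have hz1n : ‖u z1‖ ≤ 1 := hz1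
    have hline : HasDerivAt (fun t : ℝ => u (z + (t:ℂ) * (z1 - z))) (deriv u z1 * (z1 - z)) 1 := by
      have h1 : HasDerivAt (fun s : ℝ => z + (s:ℂ) * (z1 - z)) (z1 - z) 1 := by
        have := ((hasDerivAt_id ((1:ℝ):ℂ)).comp_ofReal.mul_const (z1-z)).const_add z
        simpa using this
      have h2 : HasDerivAt u (deriv u z1) (z + ((1:ℝ):ℂ) * (z1 - z)) := by
        have e : z + ((1:ℝ):ℂ) * (z1 - z) = z1 := by simp
        rw [e]; exact (hu z1).hasDerivAt
      exact h2.comp (1:ℝ) h1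
    have hslope := hline.tendsto_slope
    have hdz1 : ‖deriv u z1 * (z1 - z)‖ ≤ 2 * C * R := by
      rw [norm_mul, hR, dist_eq_norm, norm_sub_rev]
      have := hb z1
      have h2 : ‖u z1‖^2 ≤ 1 := by nlinarith [norm_nonneg (u z1)]
      have : ‖deriv u z1‖ ≤ 2 * C := by nlinarith
      gcongr
    have hlim : Tendsto (fun t : ℝ => 2 * ‖slope (fun t : ℝ => u (z + (t:ℂ) * (z1 - z))) 1 t‖) (𝓝[<] 1)
        (𝓝 (2 * ‖deriv u z1 * (z1 - z)‖)) :=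
      ((hslope.mono_left (nhdsWithin_mono _ (fun x hx => ne_of_lt hx))).norm).const_mul 2
    have hle : Real.log ‖u z‖ ≤ 2 * ‖deriv u z1 * (z1 - z)‖ := by
      refine ge_of_tendsto hlim ?_
      filter_upwards [Ioo_mem_nhdsLT (show (0:ℝ) < 1 by norm_num)] with t ht
      set w := z + (t:ℂ) * (z1 - z) with hw
      have hwz : ‖w - z‖ = t * R := by
        rw [hw, add_sub_cancel_left, norm_mul, Complex.norm_real, Real.norm_of_nonneg ht.1.le, hR, dist_eq_norm, norm_sub_rev z z1]
      have hwb : w ∈ Metric.ball z R := by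
        rw [Metric.mem_ball, dist_eq_norm, hwz]; nlinarith [ht.2]
      have hH := harnack_nonneg hg (fun w hw => by rw [hre w hw]; exact (Real.log_pos (hbig w hw)).le) hwb
      rw [hre w hwb, hre z (Metric.mem_ball_self hRpos), hwz] at hH
      have h1 : |Real.log ‖u w‖ - Real.log ‖u z‖| ≤ t * (Real.log ‖u w‖ + Real.log ‖u z‖) := by
        by_contra hcon
        push Not at hcon
        nlinarith
      have h2 := (abs_le.1 h1).1
      have h3 : Real.log ‖u w‖ ≤ ‖u w - u z1‖ := by
        have a := Real.log_le_sub_one_of_pos (show 0 < ‖u w‖ by linarith [hbig w hwb])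
        have b : ‖u w‖ ≤ ‖u w - u z1‖ + ‖u z1‖ := by
          simpa using norm_add_le (u w - u z1) (u z1)
        linarith
      have h4 : ‖slope (fun t : ℝ => u (z + (t:ℂ) * (z1 - z))) 1 t‖ * (1 - t) = ‖u w - u z1‖ := by
        rw [slope_def_module, norm_smul, norm_inv, Real.norm_eq_abs, abs_of_neg (by linarith [ht.2])]
        have : z + ((1:ℝ):ℂ) * (z1 - z) = z1 := by simp
        rw [this]
        have : (1 - t) ≠ 0 := by linarith [ht.2]
        have e : -(t - 1) = 1 - t := by ring
        rw [e, ← hw]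
        field_simp
      have h5 : Real.log ‖u z‖ * (1 - t) ≤ 2 * ‖u w - u z1‖ := by
        have := (Real.log_pos (hbig w hwb))
        nlinarith [ht.1, ht.2]
      rw [← h4] at h5
      have : 0 < 1 - t := by linarith [ht.2]
      by_contra hcon
      push Not at hcon
      nlinarith
    have hRle : R ≤ ‖z‖ + ‖s‖ := by
      have := Metric.infDist_le_dist_of_mem (x := z) (show s ∈ S from hs)
      rw [hdist] at this
      exact this.trans (by rw [dist_eq_norm]; exact norm_sub_le _ _)
    nlinarith
  refine ⟨4 * C * (1 + ‖s‖) + 1, by positivity, fun z => ?_⟩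
  have hl2 : Real.log 2 ≤ 1 := by
    have := Real.log_le_sub_one_of_pos (show (0:ℝ) < 2 by norm_num); linarith
  by_cases hz : 1 < ‖u z‖
  · have h1 : Real.log (1 + ‖u z‖) ≤ Real.log (2 * ‖u z‖) :=
      Real.log_le_log (by positivity) (by linarith)
    rw [Real.log_mul (by norm_num) (by linarith)] at h1
    have := key z hz
    nlinarith [norm_nonneg z, norm_nonneg s, mul_nonneg hC.le (norm_nonneg z), mul_nonneg (mul_nonneg hC.le (norm_nonneg z)) (norm_nonneg s)]
  · have h1 : Real.log (1 + ‖u z‖) ≤ Real.log 2 :=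
      Real.log_le_log (by positivity) (by linarith)
    nlinarith [norm_nonneg z, norm_nonneg s, mul_nonneg hC.le (norm_nonneg z), mul_nonneg (mul_nonneg hC.le (norm_nonneg z)) (norm_nonneg s), mul_nonneg hC.le (norm_nonneg s)]

/-- An entire zero-free function of exponential type is `exp (a z + b)`. -/
lemma exp_linear {f : ℂ → ℂ} (hf : Differentiable ℂ f) (h0 : ∀ z, f z ≠ 0) {B : ℝ} (hB : 0 < B)
    (hb : ∀ z, Real.log ‖f z‖ ≤ B * (1 + ‖z‖)) : ∃ a b : ℂ, ∀ z, f z = exp (a * z + b) := by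
  obtain ⟨V, hV, hVe, -⟩ := exists_log_entire hf h0
  obtain ⟨p, hp, hpe⟩ := poly_of_growth (N := 1) (C := 6 * B + 3 * ‖V 0‖) hV (by
    refine Eventually.frequently ?_
    filter_upwards [eventually_ge_atTop 1] with r hr z hz
    have h := Complex.borelCaratheodory (f := V) (M := B * (1 + 2 * r)) (R := 2 * r) (z := z)
      (by positivity) hV.differentiableOn (fun w hw => by
        simp only [Set.mem_ofPred_eq]
        have h1 : (V w).re = Real.log ‖f w‖ := by rw [← hVe w, Complex.norm_exp, Real.log_exp]
        rw [h1]
        refine (hb w).trans ?_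
        have : ‖w‖ < 2 * r := by simpa using hw
        gcongr) (by linarith) (by simp; linarith)
    have hd : 0 < 2 * r - ‖z‖ := by linarith
    have e1 : 2 * (B * (1 + 2 * r)) * ‖z‖ / (2 * r - ‖z‖) ≤ 2 * (B * (1 + 2 * r)) := by
      rw [div_le_iff₀ hd]
      have : 0 ≤ 2 * (B * (1 + 2 * r)) := by positivity
      nlinarith
    have e2 : ‖V 0‖ * (2 * r + ‖z‖) / (2 * r - ‖z‖) ≤ 3 * ‖V 0‖ := by
      rw [div_le_iff₀ hd]
      nlinarith [norm_nonneg (V 0)]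
    have : 0 ≤ ‖V 0‖ := norm_nonneg _
    nlinarith)
  obtain ⟨a, b, hab⟩ := Polynomial.exists_eq_X_add_C_of_natDegree_le_one hp
  refine ⟨a, b, fun z => ?_⟩
  rw [← hVe z, hpe z, hab]; simp

lemma lemE {u : ℂ → ℂ} (hu : Differentiable ℂ u) (hb : ∀ z, ‖deriv u z‖ ≤ 2 + 32 * ‖u z‖^2)
    (h1 : ∀ z, deriv u z ≠ 1) (h0 : ∀ z, u z = 0 → ‖deriv u z‖ ≤ 1) (hbig : 2 ≤ ‖deriv u 0‖) :
    False := by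
  obtain ⟨A, hA, hgr⟩ := clunie_hayman hu (C := 32) (by norm_num) (fun z => by
    nlinarith [hb z])
  have hud : Differentiable ℂ (deriv u) := fun z => (hu.differentiableOn.deriv isOpen_univ).differentiableAt Filter.univ_mem
  obtain ⟨a, b, hab⟩ := exp_linear (f := fun z => 1 - deriv u z) (hud.const_sub 1)
    (fun z hz => h1 z (sub_eq_zero.1 hz).symm) (B := 5 + 2 * A) (by positivity) (fun z => by
      have e1 : ‖1 - deriv u z‖ ≤ 35 * (1 + ‖u z‖)^2 := by
        have := norm_sub_le (1:ℂ) (deriv u z)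
        rw [norm_one] at this
        nlinarith [hb z, norm_nonneg (u z)]
      have e2 : 0 < ‖1 - deriv u z‖ := norm_pos_iff.2 (fun hz => h1 z (sub_eq_zero.1 hz).symm)
      have e3 := Real.log_le_log e2 e1
      rw [Real.log_mul (by norm_num) (by positivity), Real.log_pow] at e3
      have e4 : Real.log 35 ≤ 5 := by
        rw [Real.log_le_iff_le_exp (by norm_num)]
        have := Real.add_one_le_exp (1:ℝ)
        have h2 : Real.exp 5 = Real.exp 1 ^ 5 := by rw [← Real.exp_nat_mul]; norm_num
        rw [h2]
        have h27 := Real.exp_one_gt_d9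
        calc (35:ℝ) ≤ 2.7 ^ 5 := by norm_num
          _ ≤ _ := by gcongr; linarith
      have := hgr z
      push_cast at e3
      nlinarith [norm_nonneg z])
  have hder : ∀ z, deriv u z = 1 - exp (a * z + b) := by
    intro z; rw [← hab z]; ring
  by_cases ha : a = 0
  · set μ := 1 - exp b with hμ
    have hdu : ∀ z, deriv u z = μ := by intro z; rw [hder z, ha]; simp [hμ]
    have hμ2 : 2 ≤ ‖μ‖ := by rw [← hdu 0]; exact hbig
    have hμ0 : μ ≠ 0 := by intro h; rw [h] at hμ2; simp at hμ2; linarith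
    have hc : ∀ z, u z - μ * z = u 0 - μ * 0 := fun z => is_const_of_deriv_eq_zero
      (f := fun z => u z - μ * z) (hu.sub (by fun_prop)) (fun z => by
        have : HasDerivAt (fun z => u z - μ * z) (deriv u z - μ * 1) z :=
          (hu z).hasDerivAt.sub ((hasDerivAt_id z).const_mul μ)
        rw [this.deriv, hdu z]; ring) z 0
    have hz := h0 (-(u 0) / μ) (by
      have := hc (-(u 0) / μ)
      rw [mul_div_cancel₀ _ hμ0] at this
      linear_combination this)
    rw [hdu] at hz; linarith
  · have hc : ∀ z, u z - z + exp (a * z + b) / a = u 0 - 0 + exp (a * 0 + b) / a :=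
      fun z => is_const_of_deriv_eq_zero
      (f := fun z => u z - z + exp (a * z + b) / a) (by fun_prop) (fun z => by
        have e1 : HasDerivAt (fun z => a * z + b) (a * 1) z := ((hasDerivAt_id z).const_mul a).add_const b
        have : HasDerivAt (fun z => u z - z + exp (a * z + b) / a)
          (deriv u z - 1 + exp (a * z + b) * (a * 1) / a) z :=
          ((hu z).hasDerivAt.sub (hasDerivAt_id z)).add (e1.cexp.div_const a)
        rw [this.deriv, hder z]; field_simp; ring) z 0
    set k := u 0 - 0 + exp (a * 0 + b) / a with hk
    set β := (‖a‖⁻¹ * (1 + (2 + ‖b‖)) + ‖k‖) with hβ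
    have hβ0 : 0 ≤ β := by positivity
    have hval : ∀ n : ℕ, 3 ≤ n → (n:ℝ) ≤ 3 + 32 * (β^2 * (Real.log (2 * Real.pi * n))^2) := by
      intro n hn
      have hn' : (3:ℝ) ≤ n := by exact_mod_cast hn
      have hpi := Real.pi_gt_three
      set t : ℝ := 2 * Real.pi * n with ht
      have htn : (n:ℝ) ≤ t := by rw [ht]; nlinarith
      have ht0 : 0 < t := by linarith
      have hl1 : 1 ≤ Real.log t := by
        rw [Real.le_log_iff_exp_le ht0]
        have := Real.exp_one_lt_d9
        linarith
      set z : ℂ := ((Real.log t : ℝ) + (t + Real.pi/2) * I - b) / a with hz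
      have hzab : a * z + b = (Real.log t : ℝ) + (t + Real.pi/2) * I := by
        rw [hz]; field_simp; ring
      have hexp : exp (a * z + b) = t * I := by
        rw [hzab, exp_add, ← ofReal_exp, Real.exp_log ht0, add_mul, exp_add]
        have e1 : exp ((t:ℂ) * I) = 1 := by
          rw [Complex.exp_eq_one_iff]
          exact ⟨n, by rw [ht]; push_cast; ring⟩
        rw [e1, exp_pi_div_two_mul_I, one_mul]
      have huz : u z = ((Real.log t : ℝ) + (Real.pi/2) * I - b) / a + k := by
        have := hc z
        rw [hexp] at this
        have h3 : u z = k + z - t * I / a := by linear_combination this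
        rw [h3, hz]; field_simp; ring
      have hun : ‖u z‖ ≤ β * Real.log t := by
        rw [huz]
        have e1 : ‖((Real.log t : ℝ) + (Real.pi/2) * I - b : ℂ)‖ ≤ Real.log t + (2 + ‖b‖) := by
          refine (norm_sub_le _ _).trans ?_
          refine (add_le_add_left (norm_add_le _ _) _).trans ?_
          have e2 : ‖((Real.log t : ℝ) : ℂ)‖ = Real.log t := by
            rw [Complex.norm_real, Real.norm_of_nonneg (by linarith)]
          have e3 : ‖((Real.pi/2) * I : ℂ)‖ ≤ 2 := by
            rw [norm_mul, norm_I, mul_one]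
            have : ((Real.pi:ℂ)/2) = ((Real.pi/2 : ℝ):ℂ) := by push_cast; ring
            rw [this, Complex.norm_real, Real.norm_of_nonneg (by positivity)]
            have := Real.pi_le_four; linarith
          rw [e2]; linarith
        calc _ ≤ ‖((Real.log t : ℝ) + (Real.pi/2) * I - b : ℂ) / a‖ + ‖k‖ := norm_add_le _ _
          _ ≤ ‖a‖⁻¹ * (Real.log t + (2 + ‖b‖)) + ‖k‖ := by
            rw [norm_div, div_eq_inv_mul]; gcongr
          _ ≤ ‖a‖⁻¹ * (Real.log t * (1 + (2 + ‖b‖))) + ‖k‖ * Real.log t := by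
            gcongr
            · nlinarith [norm_nonneg b]
            · nlinarith [norm_nonneg k]
          _ = _ := by rw [hβ]; ring
      have hd := hb z
      rw [hder z, hexp] at hd
      have e5 : t - 1 ≤ ‖(1:ℂ) - t * I‖ := by
        have := norm_sub_norm_le ((t:ℂ) * I) 1
        rw [norm_mul, norm_I, mul_one, Complex.norm_real, Real.norm_of_nonneg ht0.le, norm_one, norm_sub_rev] at this
        exact this
      have e6 : ‖u z‖^2 ≤ (β * Real.log t)^2 := by gcongr
      rw [mul_pow] at e6
      linarith
    have hlit := (Real.isLittleO_pow_log_id_atTop (n := 2)).def (c := 1 / (32 * (β^2 + 1) * 4 * Real.pi)) (by positivity)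
    have hT : Tendsto (fun n : ℕ => 2 * Real.pi * (n:ℝ)) atTop atTop :=
      tendsto_natCast_atTop_atTop.const_mul_atTop (by positivity)
    obtain ⟨n, hn1, hn2⟩ := ((hT.eventually hlit).and (eventually_ge_atTop 7)).exists
    have hn := hval n (by omega)
    have hn7 : (7:ℝ) ≤ n := by exact_mod_cast hn2
    rw [Real.norm_of_nonneg (by positivity), id, Real.norm_of_nonneg (by positivity)] at hn1
    have e1 : 32 * (β^2 * (Real.log (2 * Real.pi * n))^2) ≤ 32 * ((β^2+1) * (1 / (32 * (β^2 + 1) * 4 * Real.pi) * (2 * Real.pi * n))) := by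
      gcongr; linarith
    have e2 : 32 * ((β^2+1) * (1 / (32 * (β^2 + 1) * 4 * Real.pi) * (2 * Real.pi * n))) = n / 2 := by
      field_simp; ring
    linarith


/-- Weighted maximum (doubling) lemma. -/
lemma doubling {M : ℂ → ℝ} {a : ℂ} {R B : ℝ} (hR : 0 < R) (hM0 : ∀ z, 0 ≤ M z)
    (hB : ∀ z ∈ Metric.ball a R, M z ≤ B) (ha : 0 < M a) :
    ∃ y ∈ Metric.ball a R, ∃ ρ > 0, ρ = R - ‖y - a‖ ∧ R * M a / 2 ≤ ρ * M y ∧ 0 < M y ∧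
      ∀ z ∈ Metric.ball y (ρ/2), M z ≤ 4 * M y := by
  set S : Set ℝ := (fun z => (R - ‖z - a‖) * M z) '' Metric.ball a R with hS
  have hbdd : BddAbove S := by
    refine ⟨R * B, ?_⟩
    rintro _ ⟨z, hz, rfl⟩
    have h1 : ‖z - a‖ < R := by simpa [dist_eq_norm] using hz
    have := hB z hz
    have h2 := norm_nonneg (z - a)
    have h3 := hM0 z
    simp only
    nlinarith
  have haS : R * M a ∈ S := ⟨a, Metric.mem_ball_self hR, by simp⟩
  have hle : R * M a ≤ sSup S := le_csSup hbdd haS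
  have hpos : 0 < sSup S := lt_of_lt_of_le (by positivity) hle
  obtain ⟨_, ⟨y, hy, rfl⟩, hy2⟩ := exists_lt_of_lt_csSup ⟨_, haS⟩ (show sSup S / 2 < sSup S by linarith)
  have h1 : ‖y - a‖ < R := by simpa [dist_eq_norm] using hy
  simp only at hy2
  have hMy : 0 < M y := by
    by_contra hcon
    have : M y = 0 := le_antisymm (not_lt.1 hcon) (hM0 y)
    rw [this] at hy2; linarith
  refine ⟨y, hy, R - ‖y - a‖, by linarith, rfl, by linarith, hMy, fun z hz => ?_⟩
  have hzy : ‖z - y‖ < (R - ‖y - a‖)/2 := by simpa [dist_eq_norm] using hz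
  have h2 : ‖z - a‖ ≤ ‖z - y‖ + ‖y - a‖ := by
    have := norm_add_le (z - y) (y - a); simpa using this
  have hzb : z ∈ Metric.ball a R := by rw [Metric.mem_ball, dist_eq_norm]; linarith
  have h3 : (R - ‖z - a‖) * M z ≤ sSup S := le_csSup hbdd ⟨z, hzb, rfl⟩
  have h4 : (R - ‖y - a‖)/2 * M z ≤ (R - ‖z - a‖) * M z :=
    mul_le_mul_of_nonneg_right (by linarith) (hM0 z)
  by_contra hcon
  push Not at hcon
  nlinarith

/-- The class of functions considered: analytic off the line `Im = h`, no derivative value 1,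
contracting zeros; on the line the reciprocal is analytic and small. -/
def Cls (u : ℂ → ℂ) (a : ℂ) (R b h : ℝ) : Prop := ∀ z ∈ Metric.ball a R,
  (z.im ≠ h → DifferentiableAt ℂ u z ∧ deriv u z ≠ 1 ∧
    (u z = 0 → ‖deriv u z‖ ≤ 1 ∧ (deriv u z).re < 0)) ∧
  (z.im = h → (∀ᶠ w in 𝓝 z, DifferentiableAt ℂ (fun w => (u w)⁻¹) w) ∧ ‖(u z)⁻¹‖ ≤ b)

lemma Cls.mono {u : ℂ → ℂ} {a a' : ℂ} {R R' b b' h : ℝ} (H : Cls u a R b h)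
    (hs : Metric.ball a' R' ⊆ Metric.ball a R) (hb : b ≤ b') : Cls u a' R' b' h := fun z hz =>
  ⟨(H z (hs hz)).1, fun hi => ⟨((H z (hs hz)).2 hi).1, ((H z (hs hz)).2 hi).2.trans hb⟩⟩

lemma ne_zero_of_inv_cont {u : ℂ → ℂ} {w : ℂ} (hu : DifferentiableAt ℂ u w)
    (hL : ContinuousAt (fun z => (u z)⁻¹) w) (hd : deriv u w ≠ 0) : u w ≠ 0 := by
  intro h0
  have h1 : Tendsto (fun z => u z * (u z)⁻¹) (𝓝 w) (𝓝 (u w * (u w)⁻¹)) := hu.continuousAt.mul hL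
  rw [h0, zero_mul] at h1
  have h2 : ∀ᶠ z in 𝓝 w, ‖u z * (u z)⁻¹‖ < 1 := by
    have := h1.norm
    rw [norm_zero] at this
    exact this.eventually (gt_mem_nhds one_pos)
  have h3 : u =ᶠ[𝓝 w] fun _ => 0 := by
    filter_upwards [h2] with z hz
    by_contra hne
    rw [mul_inv_cancel₀ hne] at hz; simp at hz
  exact hd (by rw [h3.deriv_eq]; simp)

lemma scale_hasDeriv {u : ℂ → ℂ} {y ζ : ℂ} {l : ℝ} (hl : 0 < l)
    (hu : DifferentiableAt ℂ u (y + ζ / l)) :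
    HasDerivAt (fun ζ : ℂ => (l:ℂ) * u (y + ζ / l)) (deriv u (y + ζ / l)) ζ := by
  have h1 : HasDerivAt (fun ζ : ℂ => y + ζ / l) (1 / (l:ℂ)) ζ :=
    ((hasDerivAt_id ζ).div_const (l:ℂ)).const_add y
  have h2 := (hu.hasDerivAt.comp ζ h1).const_mul (l:ℂ)
  refine h2.congr_deriv ?_
  have : (l:ℂ) ≠ 0 := by exact_mod_cast hl.ne'
  field_simp

lemma scale_mem {y ζ : ℂ} {l r : ℝ} (hl : 0 < l) (hζ : ζ ∈ Metric.ball (0:ℂ) (l * r)) :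
    y + ζ / l ∈ Metric.ball y r := by
  have : ‖ζ‖ < l * r := by simpa using hζ
  rw [Metric.mem_ball, dist_eq_norm, add_sub_cancel_left, norm_div, Complex.norm_real,
    Real.norm_of_nonneg hl.le, div_lt_iff₀ hl]
  linarith

lemma Cls.scale {u : ℂ → ℂ} {a y : ℂ} {R b h l r : ℝ} (H : Cls u a R b h) (hl : 0 < l)
    (hs : Metric.ball y r ⊆ Metric.ball a R) :
    Cls (fun ζ : ℂ => (l:ℂ) * u (y + ζ / l)) 0 (l * r) (b / l) (l * (h - y.im)) := by
  intro ζ hζ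
  have hm := hs (scale_mem hl hζ)
  have him : (y + ζ / l).im = y.im + ζ.im / l := by
    rw [add_im, Complex.div_ofReal_im]
  obtain ⟨h1, h2⟩ := H _ hm
  have hl0 : (l:ℂ) ≠ 0 := by exact_mod_cast hl.ne'
  constructor
  · intro hne
    obtain ⟨d1, d2, d3⟩ := h1 (by
      rw [him]; intro hh; apply hne; field_simp at hh; linarith)
    have hd := scale_hasDeriv hl d1
    refine ⟨hd.differentiableAt, by rw [hd.deriv]; exact d2, fun h0 => ?_⟩
    rw [hd.deriv]
    exact d3 (by simpa [hl0] using h0)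
  · intro heq
    obtain ⟨d1, d2⟩ := h2 (by rw [him, heq]; field_simp; ring)
    constructor
    · have hc : ContinuousAt (fun ζ : ℂ => y + ζ / l) ζ := by fun_prop
      filter_upwards [hc.eventually d1] with w hw
      have : (fun w : ℂ => ((l:ℂ) * u (y + w / l))⁻¹) = fun w : ℂ => (l:ℂ)⁻¹ * (u (y + w/l))⁻¹ := by
        ext w; rw [mul_inv]
      rw [this]
      exact (DifferentiableAt.comp (g := fun w => (u w)⁻¹) (f := fun w : ℂ => y + w / l) w hw
        (by fun_prop)).const_mul _
    · rw [mul_inv, norm_mul, norm_inv, Complex.norm_real, Real.norm_of_nonneg hl.le]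
      exact (mul_le_mul_of_nonneg_left d2 (inv_nonneg.2 hl.le)).trans_eq (by rw [div_eq_inv_mul])

/-- Near the line, `u` is large. -/
lemma line_fence {u : ℂ → ℂ} {p : ℂ} {δ h S D : ℝ} (hS : 0 < S) (hδ : |h - p.im| < δ)
    (hcls : ∀ z ∈ Metric.ball p (2*δ), z.im ≠ h → DifferentiableAt ℂ u z ∧
      (u z = 0 → deriv u z ≠ 0) ∧ (‖u z‖ ≤ 5/12 * S → ‖deriv u z‖ ≤ D))
    (hline : ∀ z ∈ Metric.ball p (2*δ), z.im = h →
      (∀ᶠ w in 𝓝 z, DifferentiableAt ℂ (fun w => (u w)⁻¹) w) ∧ ‖(u z)⁻¹‖ ≤ 1/S)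
    (hD : 0 ≤ D) (hDS : D * (2 * δ) < S / 12) :
    ∀ z ∈ Metric.ball p δ, z.im ≠ h → S / 3 ≤ ‖u z‖ := by
  intro z hz hzh
  by_contra hcon
  push Not at hcon
  have hzp : ‖z - p‖ < δ := by simpa [dist_eq_norm] using hz
  set zs : ℂ := ⟨z.re, h⟩ with hzs
  have hdiff : ‖zs - z‖ < 2 * δ := by
    have e : zs - z = ((h - z.im : ℝ) : ℂ) * I := by
      apply Complex.ext <;> simp [hzs]
    rw [e, norm_mul, norm_I, mul_one, Complex.norm_real, Real.norm_eq_abs]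
    have h1 := (Complex.abs_im_le_norm (z - p)).trans_lt hzp
    rw [sub_im] at h1
    have : |h - z.im| ≤ |h - p.im| + |z.im - p.im| := by
      have := abs_sub_le h p.im z.im
      rw [abs_sub_comm p.im z.im] at this; exact this
    linarith
  have hzsb : zs ∈ Metric.ball p (2*δ) := by
    rw [Metric.mem_ball, dist_eq_norm]
    have e : ‖zs - p‖ ≤ |(zs - p).re| + |(zs-p).im| := Complex.norm_le_abs_re_add_abs_im _
    have h1 := (Complex.abs_re_le_norm (z - p)).trans_lt hzp
    have e1 : (zs - p).re = (z - p).re := by simp [hzs]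
    have e2 : (zs - p).im = h - p.im := by simp [hzs]
    rw [e1, e2] at e
    linarith
  have hzb2 : z ∈ Metric.ball p (2*δ) := Metric.ball_subset_ball (by linarith [norm_nonneg (z-p)]) hz
  obtain ⟨l1, l2⟩ := hline zs hzsb rfl
  have hcl : ContinuousAt (fun w => (u w)⁻¹) zs := l1.self_of_nhds.continuousAt
  have hev : ∀ᶠ w in 𝓝 zs, DifferentiableAt ℂ (fun w => (u w)⁻¹) w ∧ ‖(u w)⁻¹‖ < 2 / S := by
    refine l1.and (hcl.norm.eventually (gt_mem_nhds (lt_of_le_of_lt l2 ?_)))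
    gcongr; norm_num
  have hpath : ContinuousAt (fun t : ℝ => z + (t:ℂ) * (zs - z)) 1 := by fun_prop
  have hp1 : z + ((1:ℝ):ℂ) * (zs - z) = zs := by simp
  rw [← hp1] at hev
  have hev2 := (hpath.eventually hev).filter_mono (nhdsWithin_le_nhds (s := Set.Iio 1))
  obtain ⟨s, ⟨hs1, hs2⟩, hs3⟩ := (hev2.and (Ioo_mem_nhdsLT (show (0:ℝ) < 1 by norm_num))).exists
  set w := z + (s:ℂ) * (zs - z) with hw
  have himt : ∀ t : ℝ, (z + (t:ℂ) * (zs - z)).im = z.im + t * (h - z.im) := by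
    intro t; simp [hzs]
  have hoff : ∀ t : ℝ, t < 1 → (z + (t:ℂ) * (zs - z)).im ≠ h := by
    intro t ht hh
    rw [himt] at hh
    have : (h - z.im) * (1 - t) = 0 := by linarith
    rcases mul_eq_zero.1 this with h' | h'
    · exact hzh (by linarith)
    · linarith
  have hmem : ∀ t ∈ Set.Icc (0:ℝ) 1, z + (t:ℂ) * (zs - z) ∈ Metric.ball p (2*δ) := by
    intro t ht
    have := (convex_ball p (2*δ)).add_smul_sub_mem hzb2 hzsb ht
    simpa using this
  have hwm := hcls w (hmem s ⟨hs3.1.le, hs3.2.le⟩) (hoff s hs3.2)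
  have hw0 : u w ≠ 0 := by
    by_cases h0 : u w = 0
    · exact ne_zero_of_inv_cont hwm.1 hs1.continuousAt (hwm.2.1 h0)
    · exact h0
  have hwbig : S / 2 < ‖u w‖ := by
    rw [norm_inv, inv_lt_comm₀ (norm_pos_iff.2 hw0) (by positivity)] at hs2
    rwa [inv_div] at hs2
  have hwz : w - z = s * (zs - z) := by rw [hw]; ring
  have := fence (u := u) (p := z) (q := w) (M := S/3) (M' := 5/12 * S) (D := D)
    (fun t ht => by
      have e : z + (t:ℂ) * (w - z) = z + ((t * s : ℝ):ℂ) * (zs - z) := by rw [hwz]; push_cast; ring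
      have hts : t * s ∈ Set.Icc (0:ℝ) 1 := ⟨mul_nonneg ht.1 hs3.1.le, by nlinarith [ht.1, ht.2, hs3.1, hs3.2]⟩
      rw [e]
      exact (hcls _ (hmem _ hts) (hoff _ (by nlinarith [ht.1, ht.2, hs3.1, hs3.2]))).1)
    (fun t ht hu => by
      have e : z + (t:ℂ) * (w - z) = z + ((t * s : ℝ):ℂ) * (zs - z) := by rw [hwz]; push_cast; ring
      have hts : t * s ∈ Set.Icc (0:ℝ) 1 := ⟨mul_nonneg ht.1 hs3.1.le, by nlinarith [ht.1, ht.2, hs3.1, hs3.2]⟩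
      rw [e] at hu ⊢
      exact (hcls _ (hmem _ hts) (hoff _ (by nlinarith [ht.1, ht.2, hs3.1, hs3.2]))).2.2 hu)
    hD hcon.le (by
      have : ‖w - z‖ ≤ 2 * δ := by
        rw [hwz, norm_mul, Complex.norm_real, Real.norm_of_nonneg hs3.1.le]
        nlinarith [hs3.2, norm_nonneg (zs - z), hs3.1]
      nlinarith)
  linarith

lemma deriv_of_inv_bound {u : ℂ → ℂ} {z : ℂ} (hd : DifferentiableAt ℂ u z)
    (h0 : u z = 0 → ‖deriv u z‖ ≤ 1)
    (hL : ‖deriv (fun w => (u w)⁻¹) z‖ ≤ 2 * ‖(u z)⁻¹‖^2 + 32) :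
    ‖deriv u z‖ ≤ 2 + 32 * ‖u z‖^2 := by
  by_cases hz : u z = 0
  · have := h0 hz; nlinarith [sq_nonneg ‖u z‖]
  · have h1 : deriv (fun w => (u w)⁻¹) z = - deriv u z / (u z)^2 := (hd.hasDerivAt.inv hz).deriv
    rw [h1, norm_div, norm_neg, norm_pow, norm_inv] at hL
    have hp : 0 < ‖u z‖ := norm_pos_iff.2 hz
    rw [div_le_iff₀ (by positivity)] at hL
    have e : (2 * ‖u z‖⁻¹^2 + 32) * ‖u z‖^2 = 2 + 32 * ‖u z‖^2 := by field_simp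
    linarith

/-- Locally uniform divergence to infinity: the reciprocals converge to `0`. -/
lemma NC_inv_of_large {U : Ultrafilter ℕ} {u : ℕ → ℂ → ℂ} {q : ℂ}
    (h : ∃ r > 0, ∀ M : ℝ, ∀ᶠ n in (U : Filter ℕ), ∀ z ∈ Metric.ball q r,
      DifferentiableAt ℂ (u n) z ∧ M ≤ ‖u n z‖) :
    NC U (fun n z => (u n z)⁻¹) (fun _ => 0) q := by
  obtain ⟨r, hr, h⟩ := h
  constructor
  · rw [prod_nhds_iff]
    refine ⟨r, hr, (h 1).mono fun n hn z hz => ?_⟩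
    have := hn z hz
    exact this.1.inv (by intro h0; have h2 := this.2; rw [h0] at h2; simp at h2; linarith)
  · filter_upwards [Metric.ball_mem_nhds q hr] with y hy
    rw [Metric.tendsto_nhds]
    intro ε hε
    rw [prod_nhds_iff]
    obtain ⟨s, hs, hs'⟩ := Metric.isOpen_iff.1 Metric.isOpen_ball y hy
    refine ⟨s, hs, (h (2/ε)).mono fun n hn z hz => ?_⟩
    have := (hn z (hs' hz)).2
    simp only [dist_zero_right, norm_inv]
    have h2 : 0 < 2/ε := by positivity
    calc ‖u n z‖⁻¹ ≤ (2/ε)⁻¹ := inv_anti₀ h2 this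
      _ = ε/2 := by rw [inv_div]
      _ < ε := by linarith

lemma no_seq {U : Ultrafilter ℕ} {u : ℕ → ℂ → ℂ} {k b h : ℕ → ℝ}
    (hk : Tendsto k (U : Filter ℕ) atTop) (hb : Tendsto b (U : Filter ℕ) (𝓝 0))
    (hc : ∀ n, Cls (u n) 0 (k n) (b n) (h n))
    (hM : ∀ n, ∀ z ∈ Metric.ball (0:ℂ) (k n),
      ‖deriv (fun w => (u n w)⁻¹) z‖ ≤ 2 * ‖(u n z)⁻¹‖^2 + 32)
    (hM0 : ∀ n, ‖deriv (fun w => (u n w)⁻¹) 0‖ = 2 + 2 * ‖(u n 0)⁻¹‖^2) : False := by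
  have hball : ∀ q : ℂ, ∀ r : ℝ, ∀ᶠ n in (U : Filter ℕ), ∀ z ∈ Metric.ball q r, z ∈ Metric.ball (0:ℂ) (k n) := by
    intro q r
    filter_upwards [hk.eventually (eventually_ge_atTop (‖q‖ + r))] with n hn z hz
    rw [Metric.mem_ball, dist_eq_norm] at hz
    rw [mem_ball_zero_iff]
    have := norm_add_le (z - q) q
    rw [sub_add_cancel] at this; linarith
  have hoffb : ∀ n, ∀ z ∈ Metric.ball (0:ℂ) (k n), z.im ≠ h n → DifferentiableAt ℂ (u n) z ∧
      ‖deriv (u n) z‖ ≤ 2 + 32 * ‖u n z‖^2 := by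
    intro n z hz hzh
    have h1 := (hc n z hz).1 hzh
    exact ⟨h1.1, deriv_of_inv_bound h1.1 (fun h0 => (h1.2.2 h0).1) (hM n z hz)⟩
  -- if the reciprocals tend to zero near 0 we are done
  have hfin : NC U (fun n z => (u n z)⁻¹) (fun _ => 0) 0 → False := by
    intro hN
    have h1 := hN.deriv.tendsto_pt.norm
    simp only [deriv_const, norm_zero] at h1
    have h2 := h1.eventually (gt_mem_nhds one_pos)
    obtain ⟨n, hn⟩ := h2.exists
    have := hM0 n
    nlinarith [sq_nonneg ‖(u n 0)⁻¹‖]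
  by_cases hbd : ∃ H : ℝ, ∀ᶠ n in (U : Filter ℕ), |h n| ≤ H
  swap
  · push Not at hbd
    have hinf : ∀ q : ℂ, ∀ r : ℝ, ∀ᶠ n in (U : Filter ℕ), ∀ z ∈ Metric.ball q r, z.im ≠ h n := by
      intro q r
      have := hbd (‖q‖ + r)
      filter_upwards [this] with n hn z hz hzh
      rw [Metric.mem_ball, dist_eq_norm] at hz
      have h1 := norm_add_le (z - q) q
      rw [sub_add_cancel] at h1
      have h2 := Complex.abs_im_le_norm z
      rw [hzh] at h2; linarith
    have hall : ∀ q : ℂ, ∀ r : ℝ, ∀ᶠ n in (U : Filter ℕ), ∀ z ∈ Metric.ball q r, DifferentiableAt ℂ (u n) z ∧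
      ‖deriv (u n) z‖ ≤ 2 + 32 * ‖u n z‖^2 ∧ deriv (u n) z ≠ 1 ∧ (u n z = 0 → ‖deriv (u n) z‖ ≤ 1) := by
      intro q r
      filter_upwards [hball q r, hinf q r] with n h1 h2 z hz
      have a := hoffb n z (h1 z hz) (h2 z hz)
      have c := (hc n z (h1 z hz)).1 (h2 z hz)
      exact ⟨a.1, a.2, c.2.1, fun h0 => (c.2.2 h0).1⟩
    rcases dichotomy (U := U) (u := u) (Ω := Set.univ) isPreconnected_univ (fun q _ =>
      ⟨1, one_pos, 32, by norm_num, (hall q 1).mono fun n hn z hz => ⟨(hn z hz).1, by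
        have := (hn z hz).2.1; linarith⟩⟩) with hB | hB
    · obtain ⟨f, hf⟩ := montel hB
      have hf' : ∀ z, NC U u f z := fun z => hf z (by simp)
      have hfd : Differentiable ℂ f := fun z => (hf' z).differentiableAt
      have hf2 : 2 ≤ ‖deriv f 0‖ := by
        refine ge_of_tendsto (hf' 0).deriv.tendsto_pt.norm ?_
        filter_upwards [hall 0 1] with n hn
        obtain ⟨a1, a2, a3, a4⟩ := hn 0 (Metric.mem_ball_self one_pos)
        by_cases h0 : u n 0 = 0
        · exfalso
          have hne := hM0 n
          have hdL : DifferentiableAt ℂ (fun w => (u n w)⁻¹) 0 := by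
            by_contra hcon
            rw [deriv_zero_of_not_differentiableAt hcon, norm_zero] at hne
            nlinarith [sq_nonneg ‖(u n 0)⁻¹‖]
          by_cases hd0 : deriv (u n) 0 = 0
          · have h1 : Tendsto (fun z => u n z * (u n z)⁻¹) (𝓝 0) (𝓝 (u n 0 * (u n 0)⁻¹)) :=
              a1.continuousAt.mul hdL.continuousAt
            rw [h0, zero_mul] at h1
            have h2 : ∀ᶠ z in 𝓝 (0:ℂ), ‖u n z * (u n z)⁻¹‖ < 1 := by
              have := h1.norm
              rw [norm_zero] at this
              exact this.eventually (gt_mem_nhds one_pos)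
            have h3 : (fun w => (u n w)⁻¹) =ᶠ[𝓝 0] fun _ => 0 := by
              filter_upwards [h2] with z hz
              by_contra hne
              rw [mul_inv_cancel₀ (fun h => hne (by rw [h, inv_zero]))] at hz; simp at hz
            rw [h3.deriv_eq] at hne
            rw [h0] at hne
            norm_num at hne
          · exact ne_zero_of_inv_cont a1 hdL.continuousAt hd0 h0
        · have h1 : deriv (fun w => (u n w)⁻¹) 0 = - deriv (u n) 0 / (u n 0)^2 := (a1.hasDerivAt.inv h0).deriv
          have := hM0 n
          have hp : 0 < ‖u n 0‖ := norm_pos_iff.2 h0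
          rw [h1, norm_div, norm_neg, norm_pow, norm_inv, div_eq_iff (by positivity)] at this
          have e : (2 + 2 * ‖u n 0‖⁻¹^2) * ‖u n 0‖^2 = 2 + 2 * ‖u n 0‖^2 := by field_simp; ring
          rw [this, e]; nlinarith [sq_nonneg ‖u n 0‖]
      have hfdd : Differentiable ℂ (deriv f) := fun z => (hfd.differentiableOn.deriv isOpen_univ).differentiableAt Filter.univ_mem
      refine lemE hfd ?_ ?_ ?_ hf2
      · intro z
        refine le_of_tendsto_of_tendsto (hf' z).deriv.tendsto_pt.norm
          (((hf' z).tendsto_pt.norm.pow 2).const_mul 32 |>.const_add 2) ?_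
        filter_upwards [hall z 1] with n hn
        exact (hn z (Metric.mem_ball_self one_pos)).2.1
      · intro z hz1
        have hN : NC U (fun n w => deriv (u n) w - 1) (fun w => deriv f w - 1) z :=
          (hf' z).deriv.sub (NC.const tendsto_const_nhds z)
        by_cases hid : ∀ᶠ w in 𝓝 z, deriv f w - 1 = 0
        · have han : AnalyticOnNhd ℂ (fun w => deriv f w - 1) Set.univ := by
            intro w _
            exact (hfdd.sub_const 1).analyticAt w
          have := han.eqOn_zero_of_preconnected_of_eventuallyEq_zero isPreconnected_univ (Set.mem_univ z) hid (Set.mem_univ 0)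
          simp only [Pi.zero_apply] at this
          rw [sub_eq_zero.1 this] at hf2; simp at hf2
        · obtain ⟨n, ⟨w, hw, hw2⟩, hn⟩ := ((hurwitz hN (by simp [hz1]) hid 1 one_pos).and (hall z 1)).exists
          exact (hn w hw).2.2.1 (sub_eq_zero.1 hw2)
      · intro z hz0
        by_contra hcon
        push Not at hcon
        have hid : ¬ ∀ᶠ w in 𝓝 z, f w = 0 := by
          intro hid
          have : f =ᶠ[𝓝 z] fun _ => 0 := hid
          rw [this.deriv_eq] at hcon; simp at hcon; linarith
        have h1 := (hf' z).deriv.tendsto.norm.eventually (lt_mem_nhds hcon)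
        obtain ⟨r, hr, h2⟩ := prod_nhds_iff.1 h1
        obtain ⟨n, ⟨⟨w, hw, hw2⟩, hn⟩, hn2⟩ := (((hurwitz (hf' z) hz0 hid r hr).and (hall z r)).and h2).exists
        have a := hn2 w hw
        have c := (hn w hw).2.2.2 hw2
        simp only at a
        linarith
    · exact hfin (NC_inv_of_large (hB 0 trivial))
  · obtain ⟨H, hH⟩ := hbd
    obtain ⟨hc', -, hlim'⟩ := tendsto_of_bdd_ultra (U := U) (a := fun n => (h n : ℂ)) (M := H) (hH.mono fun n hn => by
      simpa using hn)
    set hh : ℝ := hc'.re with hhh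
    have hlim : Tendsto h (U : Filter ℕ) (𝓝 hh) := by
      have := (Complex.continuous_re.tendsto hc').comp hlim'
      simpa [Function.comp_def] using this
    obtain ⟨δ, hδ⟩ : ∃ δ : ℝ, δ = 1/1000 := ⟨_, rfl⟩
    have hb1 : ∀ᶠ n in (U : Filter ℕ), b n ≤ 1 := (hb.eventually (gt_mem_nhds one_pos)).mono fun n hn => hn.le
    have hstrip : ∀ p : ℂ, |p.im - hh| < δ / 2 → ∃ r > 0, ∃ M : ℝ, ∀ᶠ n in (U : Filter ℕ), ∀ y ∈ Metric.ball p r,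
        DifferentiableAt ℂ (fun w => (u n w)⁻¹) y ∧ ‖(u n y)⁻¹‖ ≤ M := by
      intro p hp
      refine ⟨δ, by norm_num [hδ], 3, ?_⟩
      have hnear : ∀ᶠ n in (U : Filter ℕ), |h n - hh| < δ/2 := by
        have := hlim.eventually (Metric.ball_mem_nhds hh (show 0 < δ/2 by norm_num [hδ]))
        exact this.mono fun n hn => by simpa [Real.dist_eq] using hn
      filter_upwards [hnear, hb1, hball p (2*δ)] with n hn hbn hsub y hy
      have hyk := hsub y (Metric.ball_subset_ball (by norm_num [hδ]) hy)
      by_cases hyh : y.im = h n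
      · have := (hc n y hyk).2 hyh
        exact ⟨this.1.self_of_nhds, by linarith [this.2]⟩
      · have hclose : |h n - p.im| < δ := by
          have h1 := abs_sub_le (h n) hh p.im
          rw [abs_sub_comm hh p.im] at h1
          have h3 : δ / 2 + δ / 2 = δ := add_halves δ
          calc |h n - p.im| ≤ |h n - hh| + |p.im - hh| := h1
            _ < δ / 2 + δ / 2 := add_lt_add hn hp
            _ = δ := h3
        have hlf := line_fence (u := u n) (p := p) (δ := δ) (h := h n) (S := 1) (D := 34) one_pos
          hclose
          (fun z hz hzh => by
            have h1 := (hc n z (hsub z hz)).1 hzh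
            have h2 := (hoffb n z (hsub z hz) hzh).2
            refine ⟨h1.1, fun h0 hd => ?_, fun hu => ?_⟩
            · have := (h1.2.2 h0).2; rw [hd] at this; simp at this
            · have : ‖u n z‖^2 ≤ 1 := by nlinarith [norm_nonneg (u n z)]
              linarith)
          (fun z hz hzh => by
            have h1 := (hc n z (hsub z hz)).2 hzh
            exact ⟨h1.1, by linarith [h1.2]⟩) (by norm_num) (by norm_num [hδ]) y hy hyh
        have hy0 : u n y ≠ 0 := by intro h0; rw [h0] at hlf; simp at hlf; linarith
        refine ⟨((hc n y hyk).1 hyh).1.inv hy0, ?_⟩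
        rw [norm_inv]
        calc ‖u n y‖⁻¹ ≤ (1/3)⁻¹ := inv_anti₀ (by norm_num) hlf
          _ = 3 := by norm_num
    set Ω0 : Set ℂ := {p | |p.im - hh| < δ/2} with hΩ0
    have hΩ0o : IsOpen Ω0 := isOpen_lt (by fun_prop) continuous_const
    have hΩ0c : Convex ℝ Ω0 := by
      have : Ω0 = Complex.imLm ⁻¹' (Set.Ioo (hh - δ/2) (hh + δ/2)) := by
        ext p; simp only [hΩ0, Set.mem_ofPred_eq, Set.mem_preimage, Set.mem_Ioo, abs_lt]
        simp only [Complex.imLm_coe]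
        constructor <;> rintro ⟨a, b⟩ <;> constructor <;> linarith
      rw [this]
      exact (convex_Ioo _ _).linear_preimage _
    obtain ⟨f, hf⟩ := montel (U := U) (F := fun n w => (u n w)⁻¹) (Ω := Ω0) (fun z hz => hstrip z hz)
    rw [hΩ0o.interior_eq] at hf
    have hf0 : ∀ p : ℂ, p.im = hh → f p = 0 := by
      intro p hp
      have hseq : Tendsto (fun n => p + ((h n - hh : ℝ):ℂ) * I) (U : Filter ℕ) (𝓝 p) := by
        have h1 : Tendsto (fun n => h n - hh) (U : Filter ℕ) (𝓝 0) := by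
          simpa using hlim.sub_const hh
        have h2 : Tendsto (fun n => ((h n - hh : ℝ) : ℂ)) (U : Filter ℕ) (𝓝 ((0:ℝ):ℂ)) :=
          (Complex.continuous_ofReal.tendsto 0).comp h1
        simpa using (h2.mul_const I).const_add p
      have hpΩ : p ∈ Ω0 := by simp [hΩ0, hp, hδ]
      have h1 := (hf p hpΩ).tendsto_seq hseq
      have h2 : Tendsto (fun n => (u n (p + ((h n - hh : ℝ):ℂ) * I))⁻¹) (U : Filter ℕ) (𝓝 0) := by
        refine squeeze_zero_norm' ?_ hb
        have h3 := hseq.eventually (Metric.ball_mem_nhds p one_pos)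
        filter_upwards [h3, hball p 1] with n hn hn2
        exact ((hc n _ (hn2 _ hn)).2 (by simp [hp])).2
      exact tendsto_nhds_unique h1 h2
    have hfz : ∀ q ∈ Ω0, f q = 0 := by
      have han : AnalyticOnNhd ℂ f Ω0 := fun z hz => (hf z hz).analyticAt
      set p0 : ℂ := ⟨0, hh⟩
      have hp0 : p0 ∈ Ω0 := by simp [hΩ0, p0, hδ]
      refine han.eqOn_zero_of_preconnected_of_frequently_eq_zero hΩ0c.isPreconnected hp0 ?_
      have hT : Tendsto (fun t : ℝ => p0 + (t:ℂ)) (𝓝[≠] 0) (𝓝[≠] p0) := by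
        refine tendsto_nhdsWithin_iff.2 ⟨?_, ?_⟩
        · have : Continuous (fun t : ℝ => p0 + (t:ℂ)) := by fun_prop
          have := this.tendsto 0
          simp only [ofReal_zero, add_zero] at this
          exact this.mono_left nhdsWithin_le_nhds
        · filter_upwards [self_mem_nhdsWithin] with t ht
          simp only [Set.mem_compl_iff, Set.mem_singleton_iff] at ht ⊢
          intro hcon
          apply ht
          have : (t:ℂ) = 0 := by linear_combination hcon
          exact_mod_cast this
      refine hT.frequently (Eventually.frequently (Eventually.of_forall fun t => ?_))
      exact hf0 _ (by simp [p0])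
    have hN0 : ∀ q ∈ Ω0, NC U (fun n w => (u n w)⁻¹) (fun _ => 0) q := by
      intro q hq
      refine (hf q hq).congr_lim ?_
      filter_upwards [hΩ0o.mem_nhds hq] with y hy using hfz y hy
    have hside : ∀ Ω : Set ℂ, IsOpen Ω → IsPreconnected Ω → (∀ q ∈ Ω, q.im ≠ hh) → (Ω ∩ Ω0).Nonempty →
        (0:ℂ) ∈ Ω → False := by
      intro Ω hΩ hΩc hoff ⟨q0, hq0, hq0'⟩ h0
      rcases dichotomy (U := U) (u := u) (Ω := Ω) hΩc (fun q hq => by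
        set r := |q.im - hh| / 2 with hr
        have hr0 : 0 < r := by
          have := abs_pos.2 (sub_ne_zero.2 (hoff q hq)); positivity
        refine ⟨r, hr0, 32, by norm_num, ?_⟩
        have hnear : ∀ᶠ n in (U : Filter ℕ), |h n - hh| < r := by
          have := hlim.eventually (Metric.ball_mem_nhds hh hr0)
          exact this.mono fun n hn => by simpa [Real.dist_eq] using hn
        filter_upwards [hnear, hball q r] with n hn hn2 z hz
        have := hoffb n z (hn2 z hz) (by
          intro hzh
          rw [Metric.mem_ball, dist_eq_norm] at hz
          have h1 := (Complex.abs_im_le_norm (z - q)).trans_lt hz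
          rw [sub_im, hzh, abs_sub_comm] at h1
          have h2 := abs_sub_le q.im (h n) hh
          linarith)
        exact ⟨this.1, by linarith [this.2]⟩) with hB | hB
      · obtain ⟨r, hr, M, hM⟩ := hB q0 hq0
        have h1 := (hN0 q0 hq0').tendsto_pt.norm
        simp only [norm_zero] at h1
        have h2 := h1.eventually (gt_mem_nhds (show 0 < 1 / (|M| + 1) by positivity))
        have hoffq := hoff q0 hq0
        have h5 : ∀ᶠ n in (U : Filter ℕ), q0.im ≠ h n := by
          have := hlim.eventually (isOpen_ne.mem_nhds (Ne.symm hoffq))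
          exact this.mono fun n hn => Ne.symm hn
        obtain ⟨r', hr', hNd⟩ := prod_nhds_iff.1 (hN0 q0 hq0').1
        obtain ⟨n, ⟨⟨⟨h3, h4⟩, h5⟩, h6⟩, h7⟩ := ((((h2.and hM).and h5).and (hball q0 1)).and hNd).exists
        have a := (h4 q0 (Metric.mem_ball_self hr)).2
        have hcl := (hc n q0 (h6 q0 (Metric.mem_ball_self one_pos))).1 h5
        have hne : u n q0 ≠ 0 := by
          by_cases h0 : u n q0 = 0
          · refine ne_zero_of_inv_cont hcl.1 (h7 q0 (Metric.mem_ball_self hr')).continuousAt (fun hd => ?_)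
            have := (hcl.2.2 h0).2; rw [hd] at this; simp at this
          · exact h0
        rw [norm_inv, inv_lt_comm₀ (norm_pos_iff.2 hne) (by positivity), one_div, inv_inv] at h3
        linarith [le_abs_self M]
      · exact hfin (NC_inv_of_large (hB 0 h0))
    rcases lt_trichotomy hh 0 with hlt | heq | hgt
    · refine hside {z | hh < z.im} (isOpen_lt continuous_const Complex.continuous_im)
        (convex_halfSpace_im_gt hh).isPreconnected (fun q hq => (ne_of_lt hq).symm)
        ⟨⟨0, hh + δ/4⟩, by simp [hδ], by simp [hΩ0, hδ]; norm_num [abs_of_pos]⟩ (by simpa using hlt)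
    · exact hfin (hN0 0 (by simp [hΩ0, heq, hδ]))
    · refine hside {z | z.im < hh} (isOpen_lt Complex.continuous_im continuous_const)
        (convex_halfSpace_im_lt hh).isPreconnected (fun q hq => ne_of_lt hq)
        ⟨⟨0, hh - δ/4⟩, by simp [hδ], by simp [hΩ0, hδ]; norm_num [abs_of_pos]⟩ (by simpa using hgt)


noncomputable def Mf (u : ℂ → ℂ) (z : ℂ) : ℝ :=
  Real.sqrt (‖deriv (fun w => (u w)⁻¹) z‖ / 2 - ‖(u z)⁻¹‖^2)

lemma Mf_cont {u : ℂ → ℂ} {z : ℂ} (h : ∀ᶠ w in 𝓝 z, DifferentiableAt ℂ (fun w => (u w)⁻¹) w) :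
    ContinuousAt (Mf u) z := by
  have ha : AnalyticAt ℂ (fun w => (u w)⁻¹) z := Complex.analyticAt_iff_eventually_differentiableAt.2 h
  exact (((ha.deriv.continuousAt.norm.div_const 2).sub (ha.continuousAt.norm.pow 2))).sqrt

lemma bdd_of_loc {M : ℂ → ℝ} {K : Set ℂ} (hK : IsCompact K)
    (h : ∀ z ∈ K, ∃ B : ℝ, ∀ᶠ w in 𝓝 z, M w ≤ B) : ∃ B : ℝ, ∀ z ∈ K, M z ≤ B := by
  refine hK.induction_on (p := fun S => ∃ B : ℝ, ∀ z ∈ S, M z ≤ B) ⟨0, by simp⟩ ?_ ?_ ?_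
  · rintro s t hst ⟨B, hB⟩
    exact ⟨B, fun z hz => hB z (hst hz)⟩
  · rintro s t ⟨B, hB⟩ ⟨B', hB'⟩
    refine ⟨max B B', ?_⟩
    rintro z (hz | hz)
    · exact (hB z hz).trans (le_max_left _ _)
    · exact (hB' z hz).trans (le_max_right _ _)
  · intro z hz
    obtain ⟨B, hB⟩ := h z hz
    exact ⟨{w | M w ≤ B}, mem_nhdsWithin_of_mem_nhds hB, B, fun w hw => hw⟩

lemma deriv_inv_fun {u : ℂ → ℂ} {w : ℂ} (d : DifferentiableAt ℂ u w) (h : u w ≠ 0) :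
    deriv (fun w => (u w)⁻¹) w = - deriv u w / (u w)^2 := (d.hasDerivAt.inv h).deriv

lemma Mf_locbdd {u : ℂ → ℂ} {a : ℂ} {R b h : ℝ} (H : Cls u a R b h) {z : ℂ}
    (hz : z ∈ Metric.ball a R) : ∃ B : ℝ, ∀ᶠ w in 𝓝 z, Mf u w ≤ B := by
  have hcont : ContinuousAt (Mf u) z → ∃ B : ℝ, ∀ᶠ w in 𝓝 z, Mf u w ≤ B := fun hc =>
    ⟨Mf u z + 1, (hc.eventually (gt_mem_nhds (lt_add_one _))).mono fun w hw => le_of_lt hw⟩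
  by_cases hzh : z.im = h
  · exact hcont (Mf_cont ((H z hz).2 hzh).1)
  · have hnear : ∀ᶠ w in 𝓝 z, w ∈ Metric.ball a R ∧ w.im ≠ h :=
      (Filter.Eventually.and (Metric.isOpen_ball.mem_nhds hz :  ∀ᶠ w in 𝓝 z, w ∈ Metric.ball a R))
        (Complex.continuous_im.continuousAt.eventually_ne hzh)
    have hd : ∀ᶠ w in 𝓝 z, DifferentiableAt ℂ u w := hnear.mono fun w hw => ((H w hw.1).1 hw.2).1
    have han : AnalyticAt ℂ u z := Complex.analyticAt_iff_eventually_differentiableAt.2 hd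
    by_cases h0 : u z = 0
    · have h1 := ((H z hz).1 hzh).2.2 h0
      have h2 : ∀ᶠ w in 𝓝 z, ‖deriv u w‖ < 2 :=
        han.deriv.continuousAt.norm.eventually (gt_mem_nhds (by simp only; linarith [h1.1]))
      refine ⟨0, ?_⟩
      filter_upwards [h2, hnear] with w hw hn
      obtain ⟨d1, d2, d3⟩ := (H w hn.1).1 hn.2
      refine le_of_eq (Real.sqrt_eq_zero_of_nonpos ?_)
      by_cases hw0 : u w = 0
      · have hdn : deriv u w ≠ 0 := by
          intro hd; have := (d3 hw0).2; rw [hd] at this; simp at this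
        rw [deriv_zero_of_not_differentiableAt (fun hdL => ne_zero_of_inv_cont d1 hdL.continuousAt hdn hw0)]
        rw [norm_zero]; nlinarith [sq_nonneg ‖(u w)⁻¹‖]
      · rw [deriv_inv_fun d1 hw0, norm_div, norm_neg, norm_pow, norm_inv, inv_pow, div_eq_mul_inv ‖deriv u w‖]
        have : 0 < (‖u w‖^2)⁻¹ := by have := norm_pos_iff.2 hw0; positivity
        nlinarith
    · refine hcont (Mf_cont ?_)
      filter_upwards [hd, han.continuousAt.eventually_ne h0] with w h1 h2 using h1.inv h2

lemma deriv_scale_inv (u : ℂ → ℂ) (y ζ : ℂ) (l : ℝ) :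
    deriv (fun w => ((l:ℂ) * u (y + w / l))⁻¹) ζ =
      (l:ℂ)⁻¹^2 * deriv (fun w => (u w)⁻¹) (y + ζ / l) := by
  have e : (fun w => ((l:ℂ) * u (y + w / l))⁻¹) =
      fun w => (l:ℂ)⁻¹ * (fun w => (fun w => (u w)⁻¹) (y + w)) ((l:ℂ)⁻¹ * w) := by
    funext w; simp only [mul_inv, div_eq_mul_inv, mul_comm w]
  rw [e, deriv_const_mul_field, deriv_comp_mul_left (l:ℂ)⁻¹ (fun w => (fun w => (u w)⁻¹) (y + w)), deriv_comp_const_add (fun w => (u w)⁻¹), smul_eq_mul, div_eq_mul_inv, mul_comm ζ]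
  ring

/-- Normality estimate for the class. -/
lemma normality : ∃ C : ℝ, 0 < C ∧ ∀ (u : ℂ → ℂ) (a : ℂ) (R h : ℝ), 0 < R → Cls u a R (1/R) h →
    a.im ≠ h → ‖deriv u a‖ ≤ C * (1 + ‖u a‖^2 / R^2) := by
  by_contra hcon
  push Not at hcon
  have key : ∀ n : ℕ, ∃ (w : ℂ → ℂ) (k b h : ℝ), Cls w 0 k b h ∧ (n + 4 : ℝ) / 8 ≤ k ∧ 0 ≤ b ∧ b ≤ 1 / (4 * k) ∧
      (∀ z ∈ Metric.ball (0:ℂ) k, ‖deriv (fun ζ => (w ζ)⁻¹) z‖ ≤ 2 * ‖(w z)⁻¹‖^2 + 32) ∧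
      ‖deriv (fun ζ => (w ζ)⁻¹) 0‖ = 2 + 2 * ‖(w 0)⁻¹‖^2 := by
    intro n
    obtain ⟨u, a, R, h, hR, H, hah, hbig⟩ := hcon (2 * (n + 4 : ℝ)^2) (by positivity)
    have hn0 : (0:ℝ) ≤ n := Nat.cast_nonneg n
    have haR : a ∈ Metric.ball a R := Metric.mem_ball_self hR
    obtain ⟨d1, d2, d3⟩ := (H a haR).1 hah
    have hu0 : u a ≠ 0 := by
      intro h0
      have := (d3 h0).1
      rw [h0] at hbig; simp at hbig
      nlinarith
    have hup : 0 < ‖u a‖ := norm_pos_iff.2 hu0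
    have hMa : (n + 4 : ℝ) / R ≤ Mf u a := by
      refine Real.le_sqrt_of_sq_le ?_
      rw [deriv_inv_fun d1 hu0, norm_div, norm_neg, norm_pow, norm_inv, inv_pow]
      have h1 : 2 * (n + 4 : ℝ)^2 * ((‖u a‖^2)⁻¹ + (R^2)⁻¹) < ‖deriv u a‖ / ‖u a‖^2 := by
        rw [lt_div_iff₀ (by positivity)]
        refine lt_of_eq_of_lt ?_ hbig
        field_simp
      have h2 : 0 < (‖u a‖^2)⁻¹ := by positivity
      rw [div_pow, div_eq_mul_inv ((n+4:ℝ)^2)]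
      nlinarith [mul_nonneg hn0 h2.le, mul_nonneg (mul_nonneg hn0 hn0) h2.le]
    have hMa0 : 0 < Mf u a := lt_of_lt_of_le (by positivity) hMa
    obtain ⟨B, hB⟩ := bdd_of_loc (M := Mf u) (isCompact_closedBall a (R/2)) (fun z hz =>
      Mf_locbdd H (Metric.closedBall_subset_ball (by linarith) hz))
    obtain ⟨y, hy, ρ, hρ, hρe, hd1, hd2, hd3⟩ := doubling (M := Mf u) (a := a) (R := R/2) (B := B) (by linarith)
      (fun z => Real.sqrt_nonneg _) (fun z hz => hB z (Metric.ball_subset_closedBall hz)) hMa0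
    set l := Mf u y with hl
    have hsub : Metric.ball y (ρ/2) ⊆ Metric.ball a R := by
      intro z hz
      rw [Metric.mem_ball, dist_eq_norm] at hz ⊢
      have h2 : ‖z - a‖ ≤ ‖z - y‖ + ‖y - a‖ := by
        have := norm_add_le (z - y) (y - a); simpa using this
      linarith
    have hlk : (n + 4 : ℝ) ≤ 4 * (l * ρ) := by
      rw [div_le_iff₀ hR] at hMa
      nlinarith
    have hρR : ρ ≤ R / 2 := by rw [hρe]; linarith [norm_nonneg (y - a)]
    have hnl : ‖(l:ℂ)⁻¹‖ = l⁻¹ := by rw [norm_inv, Complex.norm_real, Real.norm_of_nonneg hd2.le]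
    refine ⟨_, l * (ρ/2), _, _, H.scale hd2 hsub, by linarith, by positivity, ?_, ?_, ?_⟩
    · rw [div_div, one_div_le_one_div (by positivity) (by positivity)]
      nlinarith
    · intro ζ hζ
      have hm := scale_mem (y := y) hd2 hζ
      have h1 := hd3 _ hm
      rw [deriv_scale_inv, norm_mul, norm_pow, hnl, mul_inv, norm_mul, hnl]
      have h2 : ‖deriv (fun w => (u w)⁻¹) (y + ζ / l)‖ / 2 - ‖(u (y + ζ / l))⁻¹‖^2 ≤ (4 * l)^2 :=
        (Real.sqrt_le_left (by positivity)).1 h1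
      have h3 : 0 < (l⁻¹)^2 := by positivity
      have h4 : l⁻¹^2 * (4*l)^2 = 16 := by field_simp; norm_num
      have h5 := mul_le_mul_of_nonneg_left h2 h3.le
      nlinarith
    · rw [deriv_scale_inv, norm_mul, norm_pow, hnl]
      simp only [zero_div, add_zero]
      rw [mul_inv, norm_mul, hnl]
      have h2 : ‖deriv (fun w => (u w)⁻¹) y‖ / 2 - ‖(u y)⁻¹‖^2 = l^2 := by
        have h3 : 0 ≤ ‖deriv (fun w => (u w)⁻¹) y‖ / 2 - ‖(u y)⁻¹‖^2 := by
          by_contra hneg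
          push Not at hneg
          have := Real.sqrt_eq_zero_of_nonpos hneg.le
          change l = 0 at this
          linarith
        exact (Real.sq_sqrt h3).symm
      have h4 : l⁻¹^2 * l^2 = 1 := by field_simp
      rw [← h2] at h4
      linarith
  choose w k b h h1 h2 h3 h4 h5 h6 using key
  have hk : Tendsto k atTop atTop := by
    refine tendsto_atTop_mono h2 ?_
    exact (tendsto_natCast_atTop_atTop.atTop_add tendsto_const_nhds).atTop_div_const (by norm_num)
  have hb : Tendsto b atTop (𝓝 0) := by
    refine squeeze_zero h3 h4 ?_
    simp only [one_div]
    exact (hk.const_mul_atTop (by norm_num)).inv_tendsto_atTop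
  have hU : ((hyperfilter ℕ : Ultrafilter ℕ) : Filter ℕ) ≤ atTop := Nat.hyperfilter_le_atTop
  exact no_seq (U := hyperfilter ℕ) (hk.mono_left hU) (hb.mono_left hU) h1 h5 h6

/-- Near the line, at unit relative scale, `u` is large. -/
lemma near_line : ∃ δ : ℝ, 0 < δ ∧ δ ≤ 1 / 4 ∧ ∀ (u : ℂ → ℂ) (p : ℂ) (R h : ℝ), 0 < R → Cls u p R (1/R) h →
    p.im = h → ∀ z ∈ Metric.ball p (δ * R), z.im ≠ h → R / 3 ≤ ‖u z‖ := by
  obtain ⟨C, hC, hN⟩ := normality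
  set δ := min (1/4) (1 / (96 * C)) with hδ
  have hδ0 : 0 < δ := lt_min (by norm_num) (by positivity)
  refine ⟨δ, hδ0, min_le_left _ _, fun u p R h hR H hp => ?_⟩
  have hδ4 : δ ≤ 1/4 := min_le_left _ _
  have hsub : Metric.ball p (2 * (δ * R)) ⊆ Metric.ball p R := Metric.ball_subset_ball (by nlinarith)
  refine line_fence (D := 2 * C) hR (by rw [hp]; simp; positivity) ?_ ?_ (by positivity) ?_
  · intro z hz hzh
    obtain ⟨d1, d2, d3⟩ := (H z (hsub hz)).1 hzh
    refine ⟨d1, fun h0 hd => ?_, fun hu => ?_⟩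
    · have := (d3 h0).2; rw [hd] at this; simp at this
    · have h1 := hN u z (R/2) h (by linarith) (H.mono (Metric.ball_subset (by
        rw [Metric.mem_ball] at hz; nlinarith)) (by
        rw [one_div_le_one_div hR (by linarith)]; linarith)) hzh
      refine h1.trans ?_
      have : ‖u z‖^2 / (R/2)^2 ≤ 1 := by
        rw [div_le_one (by positivity)]
        nlinarith [norm_nonneg (u z)]
      nlinarith
  · intro z hz hzh
    exact (H z (hsub hz)).2 hzh
  · have : δ * (96 * C) ≤ 1 := by
      have := min_le_right (1/4) (1 / (96 * C))
      rwa [← hδ, le_div_iff₀ (by positivity)] at this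
    nlinarith


lemma step_unit {w : ℂ → ℂ} {C : ℝ} (hC : 1 ≤ C)
    (h : ∀ ζ ∈ Metric.ball (0:ℂ) (1/2), DifferentiableAt ℂ w ζ ∧ ‖deriv w ζ‖ ≤ C * (1 + ‖w ζ‖^2) ∧ deriv w ζ ≠ 1)
    {ζ : ℂ} (hζ : ‖ζ‖ ≤ 1 / (80 * C)) :
    Real.log (1 + ‖w ζ‖) ≤ 2 + 3 * Real.log (1 + ‖w 0‖) ∧
    |Real.log ‖1 - deriv w ζ‖| ≤ 2 * (Real.log (2 * C) + 4 + 6 * Real.log (1 + ‖w 0‖)) +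
      3 * |Real.log ‖1 - deriv w 0‖| := by
  have hC0 : 0 < C := by linarith
  set r : ℝ := 1 / (20 * C) with hr
  have hr0 : 0 < r := by positivity
  have hr2 : r ≤ 1/2 := by
    rw [hr, div_le_div_iff₀ (by positivity) (by norm_num)]; linarith
  have hsub : Metric.ball (0:ℂ) r ⊆ Metric.ball (0:ℂ) (1/2) := Metric.ball_subset_ball hr2
  have hr4 : r / 4 = 1 / (80 * C) := by rw [hr]; field_simp; norm_num
  have hlog0 : 0 ≤ Real.log (1 + ‖w 0‖) := Real.log_nonneg (by linarith [norm_nonneg (w 0)])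
  have hlogC : 0 ≤ Real.log (2 * C) := Real.log_nonneg (by linarith)
  have hw : ∀ z : ℂ, ‖z‖ ≤ r / 2 → Real.log (1 + ‖w z‖) ≤ 2 + 3 * Real.log (1 + ‖w 0‖) := by
    intro z hz
    have hzr : z ∈ Metric.ball (0:ℂ) r := by rw [mem_ball_zero_iff]; linarith
    by_cases hb : ‖w 0‖ ≤ 3
    · have h1 := bdd_nearby (u := w) (q := 0) (r := r) (C := C) (M := 3) hC0 (by norm_num)
        (fun y hy => ⟨(h y (hsub hy)).1, (h y (hsub hy)).2.1⟩) hb hzr (by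
          rw [sub_zero]
          have : r < 1 / (C * (1 + (3+1)^2)) := by
            rw [hr]; apply one_div_lt_one_div_of_lt (by positivity); nlinarith
          linarith)
      have h2 : Real.log (1 + ‖w z‖) ≤ Real.log (1 + 4) :=
        Real.log_le_log (by positivity) (by linarith)
      have h3 : Real.log (1 + 4) ≤ 2 := by
        rw [Real.log_le_iff_le_exp (by norm_num)]
        have := Real.exp_one_gt_d9
        have e : Real.exp 2 = Real.exp 1 ^ 2 := by rw [← Real.exp_nat_mul]; norm_num
        rw [e]; nlinarith
      linarith
    · push Not at hb
      have hlarge : ∀ y ∈ Metric.ball (0:ℂ) r, 1 < ‖w y‖ := fun y hy =>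
        large_nearby (u := w) (q := 0) (r := r) (C := C) hC0
          (fun y hy => ⟨(h y (hsub hy)).1, (h y (hsub hy)).2.1⟩) hb hy (by
            rw [mem_ball_zero_iff] at hy
            rw [sub_zero]
            have : r < 1 / (10 * C) := by
              rw [hr]; apply one_div_lt_one_div_of_lt (by positivity); nlinarith
            linarith)
      have hne : ∀ y ∈ Metric.ball (0:ℂ) r, w y ≠ 0 := by
        intro y hy h0
        have := hlarge y hy; rw [h0] at this; simp at this; linarith
      have h1 := (harnack_le (f := fun y => (w y)⁻¹) (c := 0) (B := 0) hr0
        (fun y hy => ((h y (hsub hy)).1.inv (hne y hy)).differentiableWithinAt)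
        (fun y hy => inv_ne_zero (hne y hy))
        (fun y hy => by
          rw [norm_inv, Real.log_inv]
          have := Real.log_pos (hlarge y hy); linarith) (z := z) (by rwa [sub_zero])).1
      simp only [norm_inv, Real.log_inv] at h1
      have h2 := hlarge z hzr
      have h3 : Real.log (1 + ‖w z‖) ≤ Real.log (2 * ‖w z‖) := Real.log_le_log (by positivity) (by linarith)
      rw [Real.log_mul (by norm_num) (by linarith)] at h3
      have h4 : Real.log ‖w 0‖ ≤ Real.log (1 + ‖w 0‖) := Real.log_le_log (by linarith) (by linarith)
      have h5 := Real.log_two_lt_d9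
      linarith
  refine ⟨hw ζ (by linarith), ?_⟩
  set B := Real.log (2 * C) + 4 + 6 * Real.log (1 + ‖w 0‖) with hB
  have hB0 : 0 ≤ B := by positivity
  have hsub2 : Metric.ball (0:ℂ) (r/2) ⊆ Metric.ball (0:ℂ) (1/2) := Metric.ball_subset_ball (by linarith)
  have hup : ∀ z ∈ Metric.ball (0:ℂ) (r/2), Real.log ‖1 - deriv w z‖ ≤ B := by
    intro z hz
    have h1 := hw z (by rw [mem_ball_zero_iff] at hz; exact hz.le)
    obtain ⟨d1, d2, d3⟩ := h z (hsub2 hz)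
    have hpos : 0 < ‖1 - deriv w z‖ := norm_pos_iff.2 (sub_ne_zero.2 (Ne.symm d3))
    have h2 : ‖1 - deriv w z‖ ≤ 2 * C * (1 + ‖w z‖)^2 := by
      have := norm_sub_le 1 (deriv w z)
      rw [norm_one] at this
      have hn := norm_nonneg (w z)
      nlinarith [mul_nonneg hC0.le hn]
    have h3 := Real.log_le_log hpos h2
    rw [Real.log_mul (by positivity) (by positivity), Real.log_pow] at h3
    push_cast at h3
    linarith
  have hdd : DifferentiableOn ℂ (fun z => 1 - deriv w z) (Metric.ball 0 (r/2)) := by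
    have : DifferentiableOn ℂ w (Metric.ball 0 (r/2)) := fun z hz => (h z (hsub2 hz)).1.differentiableWithinAt
    exact (this.deriv Metric.isOpen_ball).const_sub 1
  have h1 := (harnack_le (f := fun z => 1 - deriv w z) (c := 0) (B := B) (r := r/2) (by linarith) hdd
    (fun z hz => sub_ne_zero.2 (Ne.symm (h z (hsub2 hz)).2.2)) hup (z := ζ) (by rw [sub_zero]; linarith)).1
  have h2 := hup ζ (by rw [mem_ball_zero_iff]; linarith)
  have h3 := neg_abs_le (Real.log ‖1 - deriv w 0‖)
  have h4 := abs_nonneg (Real.log ‖1 - deriv w 0‖)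
  rw [abs_le]
  constructor <;> linarith

/-- Functions with the required behaviour off the real axis. -/
def Gd (u : ℂ → ℂ) : Prop := ∀ z : ℂ, z.im ≠ 0 → DifferentiableAt ℂ u z ∧ deriv u z ≠ 1 ∧
    (u z = 0 → ‖deriv u z‖ ≤ 1 ∧ (deriv u z).re < 0)

lemma Gd.cls {u : ℂ → ℂ} (hu : Gd u) {z : ℂ} {R b : ℝ} (hR : R ≤ |z.im|) : Cls u z R b 0 := by
  intro w hw
  have hne : w.im ≠ 0 := by
    intro h0
    rw [Metric.mem_ball, dist_eq_norm] at hw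
    have := (Complex.abs_im_le_norm (w - z))
    rw [sub_im, h0, zero_sub, abs_neg] at this
    linarith
  exact ⟨fun _ => hu w hne, fun h => absurd h hne⟩

noncomputable def Tf (u : ℂ → ℂ) (z : ℂ) : ℝ :=
  1 + Real.log (1 + ‖u z‖ / |z.im|) + |Real.log ‖1 - deriv u z‖|

lemma Tf_ge (u : ℂ → ℂ) (z : ℂ) : 1 ≤ Tf u z := by
  have : 0 ≤ Real.log (1 + ‖u z‖ / |z.im|) := Real.log_nonneg (by
    have : 0 ≤ ‖u z‖ / |z.im| := by positivity
    linarith)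
  unfold Tf; linarith [abs_nonneg (Real.log ‖1 - deriv u z‖)]

lemma normality_gd : ∃ C : ℝ, 1 ≤ C ∧ ∀ u : ℂ → ℂ, Gd u → ∀ z : ℂ, z.im ≠ 0 →
    ‖deriv u z‖ ≤ C * (1 + ‖u z‖^2 / |z.im|^2) := by
  obtain ⟨C, hC, hN⟩ := normality
  refine ⟨max C 1, le_max_right _ _, fun u hu z hz => ?_⟩
  refine (hN u z |z.im| 0 (abs_pos.2 hz) (hu.cls le_rfl) hz).trans ?_
  gcongr
  exact le_max_left _ _

lemma Tf_step : ∃ δ : ℝ, 0 < δ ∧ δ ≤ 1/2 ∧ ∃ A : ℝ, 1 ≤ A ∧ ∀ u : ℂ → ℂ, Gd u → ∀ z z' : ℂ, z.im ≠ 0 →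
    ‖z' - z‖ ≤ δ * |z.im| → Tf u z' ≤ A * Tf u z := by
  obtain ⟨C, hC, hN⟩ := normality_gd
  have hC0 : 0 < 4 * C := by linarith
  have hlC : 0 ≤ Real.log (2 * (4 * C)) := Real.log_nonneg (by linarith)
  refine ⟨1 / (80 * (4 * C)), by positivity, ?_, 20 + 2 * (Real.log (2 * (4*C)) + 4), by linarith, ?_⟩
  · rw [div_le_div_iff₀ (by positivity) (by norm_num)]; linarith
  intro u hu z z' hz hzz
  set y := |z.im| with hy
  have hy0 : 0 < y := abs_pos.2 hz
  have hyc : (y:ℂ) ≠ 0 := by exact_mod_cast hy0.ne'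
  have him : ∀ q : ℂ, ‖q - z‖ ≤ y/2 → y/2 ≤ |q.im| := by
    intro q hq
    have h1 := (Complex.abs_im_le_norm (q - z)).trans hq
    rw [sub_im] at h1
    have h2 := abs_sub_abs_le_abs_sub z.im q.im
    rw [abs_sub_comm] at h2
    linarith
  set w : ℂ → ℂ := fun ζ => ((y⁻¹ : ℝ) : ℂ) * u (z + ζ / ((y⁻¹ : ℝ):ℂ)) with hw
  have hpt : ∀ ζ : ℂ, ζ / ((y⁻¹ : ℝ):ℂ) = ζ * y := by intro ζ; simp
  have hwn : ∀ ζ, ‖w ζ‖ = ‖u (z + ζ * y)‖ / y := by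
    intro ζ
    simp only [hw, hpt]
    rw [norm_mul, Complex.norm_real, Real.norm_of_nonneg (by positivity)]
    field_simp
  have hwd : ∀ ζ ∈ Metric.ball (0:ℂ) (1/2), DifferentiableAt ℂ w ζ ∧ deriv w ζ = deriv u (z + ζ * y) ∧
      y / 2 ≤ |(z + ζ * y).im| := by
    intro ζ hζ
    rw [mem_ball_zero_iff] at hζ
    have h1 := him (z + ζ * y) (by
      rw [add_sub_cancel_left, norm_mul, Complex.norm_real, Real.norm_of_nonneg hy0.le]; nlinarith)
    have h2 : (z + ζ * y).im ≠ 0 := by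
      intro h0; rw [h0] at h1; simp at h1; linarith
    have h3 := (hu _ h2).1
    have := scale_hasDeriv (u := u) (y := z) (ζ := ζ) (l := y⁻¹) (by positivity) (by rw [hpt]; exact h3)
    rw [hpt] at this
    exact ⟨this.differentiableAt, this.deriv, h1⟩
  have hst := step_unit (w := w) (C := 4 * C) (by linarith) (fun ζ hζ => by
    obtain ⟨a1, a2, a3⟩ := hwd ζ hζ
    have h2 : (z + ζ * y).im ≠ 0 := by
      intro h0; rw [h0] at a3; simp at a3; linarith
    refine ⟨a1, ?_, by rw [a2]; exact (hu _ h2).2.1⟩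
    rw [a2, hwn]
    refine (hN u hu _ h2).trans ?_
    have h4 : ‖u (z + ζ * y)‖^2 / |(z + ζ * y).im|^2 ≤ ‖u (z + ζ * y)‖^2 / (y/2)^2 := by gcongr
    have h5 : ‖u (z + ζ * y)‖^2 / (y/2)^2 = 4 * (‖u (z + ζ * y)‖ / y)^2 := by field_simp; ring
    nlinarith) (ζ := (z' - z) / y) (by
      rw [norm_div, Complex.norm_real, Real.norm_of_nonneg hy0.le, div_le_iff₀ hy0]; exact hzz)
  have hζm : (z' - z) / y ∈ Metric.ball (0:ℂ) (1/2) := by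
    rw [mem_ball_zero_iff, norm_div, Complex.norm_real, Real.norm_of_nonneg hy0.le, div_lt_iff₀ hy0]
    refine hzz.trans_lt ?_
    have : 1 / (80 * (4 * C)) < 1/2 := by
      rw [div_lt_div_iff₀ (by positivity) (by norm_num)]; linarith
    nlinarith
  have hb := hwd _ hζm
  have h0 := hwd 0 (Metric.mem_ball_self (by norm_num))
  have e : z + (z' - z) / y * y = z' := by field_simp; ring
  rw [hb.2.1, h0.2.1, hwn, hwn, e] at hst
  simp only [zero_mul, add_zero] at hst
  rw [e] at hb
  obtain ⟨s1, s2⟩ := hst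
  have hlz : 0 ≤ Real.log (1 + ‖u z‖ / y) := Real.log_nonneg (by
    have : 0 ≤ ‖u z‖ / y := by positivity
    linarith)
  have h6 : Real.log (1 + ‖u z'‖ / |z'.im|) ≤ Real.log (2 * (1 + ‖u z'‖ / y)) := by
    refine Real.log_le_log (by positivity) ?_
    have h7 : ‖u z'‖ / |z'.im| ≤ ‖u z'‖ / (y/2) := by
      have := hb.2.2
      gcongr
    have h8 : ‖u z'‖ / (y/2) = 2 * (‖u z'‖ / y) := by field_simp
    linarith
  rw [Real.log_mul (by norm_num) (by positivity)] at h6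
  have h9 := Real.log_two_lt_d9
  have h10 := abs_nonneg (Real.log ‖1 - deriv u z‖)
  unfold Tf
  rw [← hy]
  have h11 := mul_nonneg hlC hlz
  have h12 := mul_nonneg hlC h10
  nlinarith

/-- Polynomial growth of `T` away from the real axis. -/
lemma Tf_growth : ∃ N : ℕ, ∀ u : ℂ → ℂ, Gd u → ∃ B : ℝ, ∀ z : ℂ, z.im ≠ 0 → 
    Tf u z ≤ B * (max 1 ‖z‖)^(2*N) / |z.im|^N := by
  obtain ⟨δ, hδ, hδ2, A, hA, hst⟩ := Tf_step
  obtain ⟨N, hN⟩ := pow_unbounded_of_one_lt A (show 1 < 1 + δ by linarith)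
  obtain ⟨n, hn⟩ := exists_nat_gt (1/δ)
  have hA0 : 0 < A := by linarith
  have hδ1 : 0 < 1 + δ := by linarith
  refine ⟨N, fun u hu => ?_⟩
  have hT0 : ∀ z, 0 ≤ Tf u z := fun z => zero_le_one.trans (Tf_ge u z)
  -- vertical chain upwards, `s = ± 1`
  have hup : ∀ s : ℝ, |s| = 1 → ∀ k : ℕ, ∀ H : ℝ, 1 ≤ H → H ≤ (1+δ)^k →
      Tf u ⟨0, s * H⟩ ≤ A * H^N * Tf u ⟨0, s⟩ := by
    intro s hs k
    have hone : ∀ y y' : ℝ, 0 < y → |y' - y| ≤ δ * y → Tf u ⟨0, s * y'⟩ ≤ A * Tf u ⟨0, s * y⟩ := by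
      intro y y' hy hyy
      refine hst u hu _ _ ?_ ?_
      · have : s ≠ 0 := by intro h; rw [h] at hs; simp at hs
        simp; exact ⟨this, hy.ne'⟩
      · have e : (⟨0, s * y'⟩ - ⟨0, s*y⟩ : ℂ) = ((s * (y' - y) : ℝ) : ℂ) * I := by
          apply Complex.ext <;> simp; ring
        rw [e, norm_mul, Complex.norm_real, norm_I, mul_one, Real.norm_eq_abs, abs_mul, hs, one_mul]
        simp only [abs_mul, hs, one_mul, abs_of_pos hy]
        exact hyy
    induction k with
    | zero =>
      intro H h1 h2
      have : H = 1 := le_antisymm (by simpa using h2) h1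
      rw [this]; simp only [mul_one, one_pow]
      nlinarith [hT0 ⟨0, s⟩]
    | succ k ih =>
      intro H h1 h2
      by_cases hH : H ≤ 1 + δ
      · have := hone 1 H one_pos (by rw [abs_of_nonneg (by linarith)]; linarith)
        rw [mul_one] at this
        have h3 : (1:ℝ) ≤ H^N := one_le_pow₀ h1
        have h4 := mul_nonneg hA0.le (hT0 ⟨0, s⟩)
        nlinarith
      · push Not at hH
        have h3 := ih (H / (1+δ)) (by rw [le_div_iff₀ hδ1]; linarith) (by
          rw [div_le_iff₀ hδ1]; rw [pow_succ] at h2; linarith)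
        have h4 := hone (H / (1+δ)) H (by positivity) (by
          have : H - H / (1+δ) = δ * (H / (1+δ)) := by field_simp; ring
          rw [this, abs_of_nonneg (by positivity)])
        refine h4.trans ?_
        have h5 : A * (H / (1+δ))^N ≤ H^N := by
          rw [div_pow, mul_div_assoc', div_le_iff₀ (by positivity)]
          have : 0 < H^N := by positivity
          nlinarith
        calc A * Tf u ⟨0, s * (H / (1+δ))⟩ ≤ A * (A * (H / (1+δ))^N * Tf u ⟨0, s⟩) := by gcongr
          _ ≤ A * (H^N * Tf u ⟨0, s⟩) := by
            have := hT0 ⟨0, s⟩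
            gcongr
          _ = _ := by ring
  have hhor : ∀ Y : ℝ, Y ≠ 0 → ∀ k : ℕ, ∀ x : ℝ, |x| ≤ k * (δ * |Y|) → Tf u ⟨x, Y⟩ ≤ A^k * Tf u ⟨0, Y⟩ := by
    intro Y hY k
    induction k with
    | zero => 
      intro x hx
      have : x = 0 := by simpa using hx
      rw [this]; simp
    | succ k ih =>
      intro x hx
      have hY0 : 0 < |Y| := abs_pos.2 hY
      have h1 := ih (x * (k / (k+1))) (by
        rw [abs_mul, abs_of_nonneg (by positivity : (0:ℝ) ≤ (k:ℝ) / (k+1))]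
        push_cast at hx
        calc |x| * ((k:ℝ) / (k+1)) ≤ ((k:ℝ)+1) * (δ * |Y|) * ((k:ℝ) / (k+1)) := by gcongr
          _ = _ := by field_simp)
      have h2 := hst u hu ⟨x * (k / (k+1)), Y⟩ ⟨x, Y⟩ hY (by
        have e : (⟨x, Y⟩ - ⟨x * (k / (k+1)), Y⟩ : ℂ) = ((x / (k+1) : ℝ) : ℂ) := by
          apply Complex.ext
          · rw [sub_re, Complex.ofReal_re]; field_simp; ring
          · rw [sub_im, Complex.ofReal_im]; simp
        rw [e, Complex.norm_real, Real.norm_eq_abs, abs_div, abs_of_pos (by positivity : (0:ℝ) < (k:ℝ)+1),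
          div_le_iff₀ (by positivity)]
        push_cast at hx
        linarith)
      calc _ ≤ A * Tf u ⟨x * (k / (k+1)), Y⟩ := h2
        _ ≤ A * (A^k * Tf u ⟨0, Y⟩) := by gcongr
        _ = _ := by ring
  have hdown : ∀ (s x H : ℝ), |s| = 1 → 0 < H → ∀ k : ℕ, ∀ y : ℝ, 0 < y → y ≤ H → H ≤ (1+δ)^k * y →
      Tf u ⟨x, s * y⟩ ≤ A * (H/y)^N * Tf u ⟨x, s * H⟩ := by
    intro s x H hs hH k
    have hs0 : s ≠ 0 := by intro h; rw [h] at hs; simp at hs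
    have hone : ∀ y y' : ℝ, 0 < y → |y' - y| ≤ δ * y → Tf u ⟨x, s * y'⟩ ≤ A * Tf u ⟨x, s * y⟩ := by
      intro y y' hy hyy
      refine hst u hu _ _ ?_ ?_
      · simp; exact ⟨hs0, hy.ne'⟩
      · have e : (⟨x, s * y'⟩ - ⟨x, s*y⟩ : ℂ) = ((s * (y' - y) : ℝ) : ℂ) * I := by
          apply Complex.ext <;> simp; ring
        rw [e, norm_mul, Complex.norm_real, norm_I, mul_one, Real.norm_eq_abs, abs_mul, hs, one_mul]
        simp only [abs_mul, hs, one_mul, abs_of_pos hy]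
        exact hyy
    induction k with
    | zero =>
      intro y hy h1 h2
      have : y = H := le_antisymm h1 (by simpa using h2)
      rw [this, div_self hH.ne']; simp only [one_pow, mul_one]
      nlinarith [hT0 ⟨x, s * H⟩]
    | succ k ih =>
      intro y hy h1 h2
      by_cases hHy : H ≤ (1 + δ) * y
      · have := hone H y hH (by
          rw [abs_sub_comm, abs_of_nonneg (by linarith)]
          nlinarith)
        have h3 : (1:ℝ) ≤ (H/y)^N := one_le_pow₀ (by rw [le_div_iff₀ hy]; linarith)
        have h4 := mul_nonneg hA0.le (hT0 ⟨x, s * H⟩)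
        nlinarith
      · push Not at hHy
        have h3 := ih ((1+δ) * y) (by positivity) hHy.le (by rw [pow_succ] at h2; linarith)
        have h4 := hone ((1+δ)*y) y (by positivity) (by
          have e : y - (1+δ) * y = -(δ * y) := by ring
          rw [e, abs_neg, abs_of_nonneg (by positivity)]; nlinarith [mul_pos hδ (mul_pos hδ hy)])
        refine h4.trans ?_
        have h5 : A * (H / ((1+δ)*y))^N ≤ (H/y)^N := by
          have : H / y = H / ((1+δ)*y) * (1+δ) := by field_simp
          rw [this, mul_pow, mul_comm]
          gcongr
        calc A * Tf u ⟨x, s * ((1+δ)*y)⟩ ≤ A * (A * (H / ((1+δ)*y))^N * Tf u ⟨x, s * H⟩) := by gcongr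
          _ ≤ A * ((H/y)^N * Tf u ⟨x, s * H⟩) := by
            have := hT0 ⟨x, s * H⟩
            gcongr
          _ = _ := by ring
  refine ⟨A^2 * A^n * max (Tf u ⟨0,1⟩) (Tf u ⟨0,-1⟩), fun z hz => ?_⟩
  set H := max 1 ‖z‖ with hH
  have hH1 : 1 ≤ H := le_max_left _ _
  obtain ⟨s, hs, hsy⟩ : ∃ s : ℝ, (s = 1 ∨ s = -1) ∧ z.im = s * |z.im| := by
    rcases lt_or_gt_of_ne hz with h | h
    · exact ⟨-1, Or.inr rfl, by rw [abs_of_neg h]; ring⟩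
    · exact ⟨1, Or.inl rfl, by rw [abs_of_pos h]; ring⟩
  have hs1 : |s| = 1 := by rcases hs with h | h <;> simp [h]
  have hsT : Tf u ⟨0, s⟩ ≤ max (Tf u ⟨0,1⟩) (Tf u ⟨0,-1⟩) := by
    rcases hs with h | h <;> rw [h]
    · exact le_max_left _ _
    · exact le_max_right _ _
  have hy0 : 0 < |z.im| := abs_pos.2 hz
  have hyH : |z.im| ≤ H := (Complex.abs_im_le_norm z).trans (le_max_right _ _)
  obtain ⟨k, hk⟩ := pow_unbounded_of_one_lt H (show 1 < 1 + δ by linarith)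
  obtain ⟨j, hj⟩ := pow_unbounded_of_one_lt (H / |z.im|) (show 1 < 1 + δ by linarith)
  have a1 := hup s hs1 k H hH1 hk.le
  have a2 := hhor (s * H) (by
    have : s ≠ 0 := by intro h; rw [h] at hs1; simp at hs1
    have : H ≠ 0 := by linarith
    positivity) n z.re (by
      rw [abs_mul, hs1, one_mul, abs_of_pos (by linarith : 0 < H)]
      have h1 : |z.re| ≤ H := (Complex.abs_re_le_norm z).trans (le_max_right _ _)
      rw [div_lt_iff₀ hδ] at hn
      nlinarith)
  have a3 := hdown s z.re H hs1 (by linarith) j |z.im| hy0 hyH (by rw [div_lt_iff₀ hy0] at hj; exact hj.le)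
  have ez : (⟨z.re, s * |z.im|⟩ : ℂ) = z := by rw [← hsy]
  rw [ez] at a3
  calc Tf u z ≤ A * (H / |z.im|)^N * Tf u ⟨z.re, s * H⟩ := a3
    _ ≤ A * (H / |z.im|)^N * (A^n * (A * H^N * max (Tf u ⟨0,1⟩) (Tf u ⟨0,-1⟩))) := by
      have : Tf u ⟨z.re, s * H⟩ ≤ A^n * (A * H^N * max (Tf u ⟨0,1⟩) (Tf u ⟨0,-1⟩)) := by
        refine a2.trans ?_
        gcongr
        refine a1.trans ?_
        gcongr
      gcongr
    _ = _ := by rw [div_pow]; field_simp; ring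


lemma K_poly {u v q : ℂ → ℂ} (hu : Gd u) (hv : Gd v) (hq : Differentiable ℂ q)
    (hK : ∀ z : ℂ, z.im ≠ 0 → exp (q z) = (1 - deriv u z) / (1 - deriv v z)) :
    ∃ p : Polynomial ℂ, ∀ z, deriv q z = p.eval z := by
  obtain ⟨N, hN⟩ := Tf_growth
  obtain ⟨B1, hB1⟩ := hN u hu
  obtain ⟨B2, hB2⟩ := hN v hv
  have hre : ∀ z : ℂ, z.im ≠ 0 → |(q z).re| ≤ (|B1| + |B2|) * (max 1 ‖z‖)^(2*N) / |z.im|^N := by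
    intro z hz
    have h1 := hB1 z hz
    have h2 := hB2 z hz
    have hn1 : (1 - deriv u z) ≠ 0 := sub_ne_zero.2 (Ne.symm (hu z hz).2.1)
    have hn2 : (1 - deriv v z) ≠ 0 := sub_ne_zero.2 (Ne.symm (hv z hz).2.1)
    have e : (q z).re = Real.log ‖1 - deriv u z‖ - Real.log ‖1 - deriv v z‖ := by
      rw [← Real.log_div (norm_ne_zero_iff.2 hn1) (norm_ne_zero_iff.2 hn2), ← norm_div, ← hK z hz, Complex.norm_exp,
        Real.log_exp]
    have hT : ∀ w : ℂ → ℂ, |Real.log ‖1 - deriv w z‖| ≤ Tf w z := by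
      intro w
      have : 0 ≤ Real.log (1 + ‖w z‖ / |z.im|) := Real.log_nonneg (by
        have : 0 ≤ ‖w z‖ / |z.im| := by positivity
        linarith)
      unfold Tf; linarith
    have h3 := abs_sub (Real.log ‖1 - deriv u z‖) (Real.log ‖1 - deriv v z‖)
    rw [e]
    have hX : 0 ≤ (max 1 ‖z‖)^(2*N) / |z.im|^N := by positivity
    rw [mul_div_assoc] at h1 h2 ⊢
    have h4 := mul_le_mul_of_nonneg_right (le_abs_self B1) hX
    have h5 := mul_le_mul_of_nonneg_right (le_abs_self B2) hX
    have := hT u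
    have := hT v
    rw [add_mul]
    linarith
  set B := |B1| + |B2| + 1 with hB
  have hB0 : 0 < B := by positivity
  have hq' : ∀ z : ℂ, z.im ≠ 0 → ‖deriv q z‖ ≤ (32 * B * 2^(3*N)) * (max 1 ‖z‖)^(2*N) / |z.im|^(N+1) := by
    intro z hz
    have hy0 : 0 < |z.im| := abs_pos.2 hz
    have hb := borel_deriv (q := q) (c := z) (r := |z.im|/2)
      (B := B * 2^(3*N) * (max 1 ‖z‖)^(2*N) / |z.im|^N) (by positivity) hq.differentiableOn (hB0 := by positivity) (fun w hw => by
        rw [Metric.mem_ball, dist_eq_norm] at hw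
        have h1 : |z.im|/2 ≤ |w.im| := by
          have h1 := (Complex.abs_im_le_norm (w - z)).trans hw.le
          rw [sub_im] at h1
          have h2 := abs_sub_abs_le_abs_sub z.im w.im
          rw [abs_sub_comm] at h2
          linarith
        have h2 : w.im ≠ 0 := by intro h; rw [h, abs_zero] at h1; linarith
        have h3 : ‖w‖ ≤ 2 * max 1 ‖z‖ := by
          have := norm_add_le (w - z) z
          rw [sub_add_cancel] at this
          have h4 := Complex.abs_im_le_norm z
          have h5 := le_max_right 1 ‖z‖
          linarith
        have h6 : max 1 ‖w‖ ≤ 2 * max 1 ‖z‖ := max_le (by linarith [le_max_left 1 ‖z‖]) h3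
        refine (hre w h2).trans ?_
        calc (|B1| + |B2|) * (max 1 ‖w‖)^(2*N) / |w.im|^N ≤ B * (2 * max 1 ‖z‖)^(2*N) / (|z.im|/2)^N := by
              gcongr
              rw [hB]; linarith
          _ = _ := by rw [mul_pow, div_pow, pow_mul 2 3, pow_mul 2 2]; field_simp; rw [← mul_pow]; norm_num)
    refine hb.trans (le_of_eq ?_)
    rw [pow_succ]; field_simp; norm_num
  set D := 32 * B * 2^(3*N) with hD
  have hD0 : 0 < D := by positivity
  have hdq : Differentiable ℂ (deriv q) := fun z =>
    (hq.differentiableOn.deriv isOpen_univ).differentiableAt Filter.univ_mem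
  have hbig : ∀ r : ℝ, 1 ≤ r → ∀ z : ℂ, ‖z‖ ≤ r/2 → ‖deriv q z‖ ≤ D * 4^(N+1) * r^(N+1) := by
    intro r hr z hz
    have hr0 : 0 < r := by linarith
    have hmax := Complex.norm_le_of_forall_mem_frontier_norm_le (f := fun z => deriv q z * (z^2 - (r:ℂ)^2)^(N+1))
      (U := Metric.ball 0 r) (C := D * r^(2*N) * (2*r)^(N+1)) Metric.isBounded_ball
      (by
        refine Differentiable.diffContOnCl ?_
        fun_prop) (fun w hw => by
          rw [frontier_ball _ hr0.ne', mem_sphere_zero_iff_norm] at hw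
          have e : w^2 - (r:ℂ)^2 = w * (2 * w.im * I) := by
            have h1 : (r:ℂ)^2 = w * (starRingEnd ℂ) w := by
              rw [Complex.mul_conj, Complex.normSq_eq_norm_sq, hw]; push_cast; rfl
            have h2 := Complex.sub_conj w
            push_cast at h2
            rw [h1, ← h2]; ring
          have en : ‖w^2 - (r:ℂ)^2‖ = 2 * r * |w.im| := by
            rw [e]; simp [hw]; ring
          rw [norm_mul, norm_pow, en]
          by_cases hw0 : w.im = 0
          · rw [hw0]; simp; positivity
          · have := hq' w hw0
            rw [hw, max_eq_right hr] at this
            have hy : 0 < |w.im| := abs_pos.2 hw0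
            calc ‖deriv q w‖ * (2 * r * |w.im|)^(N+1) ≤ D * r^(2*N) / |w.im|^(N+1) * (2 * r * |w.im|)^(N+1) := by gcongr
              _ = _ := by rw [mul_pow (2*r)]; field_simp)
      (z := z) (subset_closure (by rw [mem_ball_zero_iff]; linarith))
    rw [norm_mul, norm_pow] at hmax
    have h1 : r^2/2 ≤ ‖z^2 - (r:ℂ)^2‖ := by
      have h2 := norm_sub_norm_le ((r:ℂ)^2) (z^2)
      rw [norm_pow, norm_pow, Complex.norm_real, Real.norm_of_nonneg hr0.le, norm_sub_rev] at h2
      nlinarith [norm_nonneg z]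
    have h3 : ‖deriv q z‖ * (r^2/2)^(N+1) ≤ D * r^(2*N) * (2*r)^(N+1) :=
      le_trans (by gcongr) hmax
    rw [← le_div_iff₀ (by positivity)] at h3
    refine h3.trans ?_
    rw [div_le_iff₀ (by positivity)]
    have e1 : D * 4^(N+1) * r^(N+1) * (r^2/2)^(N+1) = D * (2*r)^(N+1) * (r^2)^(N+1) := by
      rw [div_pow, mul_pow, show (4:ℝ) = 2*2 by norm_num, mul_pow]; field_simp
    rw [e1, ← pow_mul]
    have : r^(2*N) ≤ r^(2*(N+1)) := pow_le_pow_right₀ hr (by omega)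
    calc D * r^(2*N) * (2*r)^(N+1) ≤ D * r^(2*(N+1)) * (2*r)^(N+1) := by gcongr
      _ = _ := by ring
  obtain ⟨p, -, hp⟩ := poly_of_growth (g := deriv q) (N := N+1) (C := D * 4^(N+1) * 2^(N+1)) hdq
    (Filter.Eventually.frequently (by
      filter_upwards [eventually_ge_atTop 1] with r hr z hz
      refine (hbig (2*r) (by linarith) z (by linarith)).trans (le_of_eq ?_)
      rw [mul_pow]; ring))
  exact ⟨p, hp⟩


lemma cover_lower {U : Ultrafilter ℕ} {u : ℕ → ℂ → ℂ} {K : Set ℂ} (hK : IsCompact K)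
    (h : ∀ z ∈ K, ∃ r > 0, ∃ c > 0, ∀ᶠ n in (U : Filter ℕ), ∀ w ∈ Metric.ball z r, c ≤ ‖u n w‖) :
    ∃ c > 0, ∀ᶠ n in (U : Filter ℕ), ∀ w ∈ K, c ≤ ‖u n w‖ := by
  refine hK.induction_on (p := fun S => ∃ c > 0, ∀ᶠ n in (U : Filter ℕ), ∀ w ∈ S, c ≤ ‖u n w‖)
    ⟨1, one_pos, by simp⟩ ?_ ?_ ?_
  · rintro s t hst ⟨c, hc, h⟩
    exact ⟨c, hc, h.mono fun n hn w hw => hn w (hst hw)⟩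
  · rintro s t ⟨c, hc, h⟩ ⟨c', hc', h'⟩
    refine ⟨min c c', lt_min hc hc', ?_⟩
    filter_upwards [h, h'] with n hn hn' w hw
    rcases hw with hw | hw
    · exact (min_le_left _ _).trans (hn w hw)
    · exact (min_le_right _ _).trans (hn' w hw)
  · intro z hz
    obtain ⟨r, hr, c, hc, h⟩ := h z hz
    exact ⟨Metric.ball z r, mem_nhdsWithin_of_mem_nhds (Metric.ball_mem_nhds z hr), c, hc, h⟩

/-- Generic level sets avoid zeros of the limit. -/
lemma good_levels {U : Ultrafilter ℕ} {u : ℕ → ℂ → ℂ} {Ω K : Set ℂ} (hΩo : IsOpen Ω)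
    (hΩc : IsPreconnected Ω) (hK : IsCompact K) (hKΩ : K ⊆ Ω)
    (h : ∀ q ∈ Ω, ∃ r > 0, ∃ C > 0, ∀ᶠ n in (U : Filter ℕ), ∀ z ∈ Metric.ball q r,
      DifferentiableAt ℂ (u n) z ∧ ‖deriv (u n) z‖ ≤ C * (1 + ‖u n z‖^2))
    {p : ℂ} (hp : p ∈ Ω) {c : ℝ} (hc : 0 < c) (hpc : ∀ᶠ n in (U : Filter ℕ), c ≤ ‖u n p‖)
    {π : ℂ → ℝ} (hπ : Continuous π) :
    ∃ bad : Set ℝ, bad.Finite ∧ ∀ s ∉ bad, ∃ c' > 0, ∀ᶠ n in (U : Filter ℕ), ∀ z ∈ K, π z = s → c' ≤ ‖u n z‖ := by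
  rcases dichotomy (U := U) (u := u) (Ω := Ω) hΩc h with hB | hB
  · obtain ⟨f, hf⟩ := montel (U := U) (F := u) (Ω := Ω) hB
    rw [hΩo.interior_eq] at hf
    have han : AnalyticOnNhd ℂ f Ω := fun z hz => (hf z hz).analyticAt
    have hfp : f p ≠ 0 := by
      have h1 : c ≤ ‖f p‖ := ge_of_tendsto (hf p hp).tendsto_pt.norm hpc
      intro h0; rw [h0, norm_zero] at h1; linarith
    have hfin : (K ∩ {z | f z = 0}).Finite := by
      by_contra hinf
      obtain ⟨x, hx, hacc⟩ := Set.Infinite.exists_accPt_of_subset_isCompact hinf hK Set.inter_subset_left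
      have hfr : ∃ᶠ z in 𝓝[≠] x, f z = 0 := by
        have := accPt_iff_frequently_nhdsNE.1 hacc
        exact this.mono fun z hz => hz.2
      exact hfp (han.eqOn_zero_of_preconnected_of_frequently_eq_zero hΩc (hKΩ hx) hfr hp)
    refine ⟨π '' (K ∩ {z | f z = 0}), hfin.image _, fun s hs => ?_⟩
    have hKs : IsCompact (K ∩ π ⁻¹' {s}) := hK.inter_right (isClosed_singleton.preimage hπ)
    obtain ⟨c', hc', hh⟩ := cover_lower (U := U) (u := u) hKs (fun z hz => by
      have hz0 : f z ≠ 0 := fun h0 => hs ⟨z, ⟨hz.1, h0⟩, hz.2⟩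
      have hz1 : 0 < ‖f z‖ := norm_pos_iff.2 hz0
      have h1 := (hf z (hKΩ hz.1)).tendsto.norm.eventually (lt_mem_nhds (show ‖f z‖ / 2 < ‖f z‖ by linarith))
      obtain ⟨r, hr, h2⟩ := prod_nhds_iff.1 h1
      exact ⟨r, hr, ‖f z‖ / 2, by linarith, h2.mono fun n hn w hw => (hn w hw).le⟩)
    exact ⟨c', hc', hh.mono fun n hn z hz hzs => hn z ⟨hz, hzs⟩⟩
  · refine ⟨∅, Set.finite_empty, fun s _ => ?_⟩
    obtain ⟨c', hc', hh⟩ := cover_lower (U := U) (u := u) hK (fun z hz => by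
      obtain ⟨r, hr, h2⟩ := hB z (hKΩ hz)
      exact ⟨r, hr, 1, one_pos, (h2 1).mono fun n hn w hw => (hn w hw).2⟩)
    exact ⟨c', hc', hh.mono fun n hn z hz _ => hn z hz⟩

/-- Gronwall along a path. -/
lemma path_bound {Z D : ℂ → ℂ} {γ γ' : ℝ → ℂ} {a b K : ℝ} (hab : a ≤ b)
    (hγ : ∀ t ∈ Set.Icc a b, HasDerivAt γ (γ' t) t)
    (hZ : ∀ t ∈ Set.Icc a b, HasDerivAt Z (D (γ t) * Z (γ t)) (γ t))
    (hK : ∀ t ∈ Set.Icc a b, ‖D (γ t)‖ * ‖γ' t‖ ≤ K) :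
    ‖Z (γ b)‖ ≤ ‖Z (γ a)‖ * Real.exp (K * (b - a)) := by
  have hd : ∀ t ∈ Set.Icc a b, HasDerivAt (fun t => Z (γ t)) (D (γ t) * Z (γ t) * γ' t) t := fun t ht =>
    (hZ t ht).comp t (hγ t ht)
  have := norm_le_gronwallBound_of_norm_deriv_right_le (f := fun t => Z (γ t))
    (f' := fun t => D (γ t) * Z (γ t) * γ' t) (δ := ‖Z (γ a)‖) (K := K) (ε := 0) (a := a) (b := b)
    (fun t ht => (hd t ht).continuousAt.continuousWithinAt)
    (fun t ht => (hd t (Set.Ico_subset_Icc_self ht)).hasDerivWithinAt) le_rfl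
    (fun t ht => by
      have := hK t (Set.Ico_subset_Icc_self ht)
      rw [norm_mul, norm_mul, add_zero]
      nlinarith [norm_nonneg (Z (γ t))]) b ⟨hab, le_rfl⟩
  rwa [gronwallBound_ε0] at this

lemma path_bound_rev {Z D : ℂ → ℂ} {γ γ' : ℝ → ℂ} {a b K : ℝ} (hab : a ≤ b)
    (hγ : ∀ t ∈ Set.Icc a b, HasDerivAt γ (γ' t) t)
    (hZ : ∀ t ∈ Set.Icc a b, HasDerivAt Z (D (γ t) * Z (γ t)) (γ t))
    (hK : ∀ t ∈ Set.Icc a b, ‖D (γ t)‖ * ‖γ' t‖ ≤ K) :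
    ‖Z (γ a)‖ ≤ ‖Z (γ b)‖ * Real.exp (K * (b - a)) := by
  have hm : ∀ t ∈ Set.Icc (-b) (-a), -t ∈ Set.Icc a b := fun t ht => ⟨by linarith [ht.2], by linarith [ht.1]⟩
  have := path_bound (Z := Z) (D := D) (γ := fun t => γ (-t)) (γ' := fun t => - γ' (-t)) (a := -b) (b := -a) (K := K)
    (by linarith) (fun t ht => by
      have := (hγ (-t) (hm t ht)).scomp t (hasDerivAt_neg t)
      refine this.congr_deriv ?_
      simp)
    (fun t ht => hZ _ (hm t ht)) (fun t ht => by rw [norm_neg]; exact hK _ (hm t ht))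
  simp only [neg_neg] at this
  rwa [show -a - -b = b - a by ring] at this


/-- sup norm on the plane -/
noncomputable def supn (z : ℂ) : ℝ := max |z.re| |z.im|

lemma supn_cont : Continuous supn := by
  unfold supn; fun_prop

lemma supn_le_norm (z : ℂ) : supn z ≤ ‖z‖ := max_le (Complex.abs_re_le_norm z) (Complex.abs_im_le_norm z)

lemma norm_le_supn (z : ℂ) : ‖z‖ ≤ 2 * supn z := by
  have h := Complex.norm_le_abs_re_add_abs_im z
  have h1 : |z.re| ≤ supn z := le_max_left _ _
  have h2 : |z.im| ≤ supn z := le_max_right _ _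
  linarith

lemma side_vert {Z D : ℂ → ℂ} {C s x0 : ℝ} (hC : 0 ≤ C) (hs : 0 ≤ s) (hx0 : |x0| = s)
    (h : ∀ z, supn z = s → HasDerivAt Z (D z * Z z) z ∧ ‖D z‖ ≤ C / (1 + |z.im|))
    {y : ℝ} (hy : |y| ≤ s) :
    ‖Z (x0 + y * I)‖ ≤ ‖Z x0‖ * (1 + s) ^ C ∧ ‖Z x0‖ ≤ ‖Z (x0 + y * I)‖ * (1 + s) ^ C := by
  obtain ⟨σ, hσ, hσy⟩ : ∃ σ : ℝ, |σ| = 1 ∧ y = σ * |y| := by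
    rcases le_total 0 y with h0 | h0
    · exact ⟨1, by simp, by rw [abs_of_nonneg h0]; ring⟩
    · exact ⟨-1, by simp, by rw [abs_of_nonpos h0]; ring⟩
  have hpos : 0 < 1 + |y| := by positivity
  have hb : 0 ≤ Real.log (1 + |y|) := Real.log_nonneg (by linarith [abs_nonneg y])
  let γ : ℝ → ℂ := fun t => x0 + ((σ * (Real.exp t - 1) : ℝ) : ℂ) * I
  let γ' : ℝ → ℂ := fun t => ((σ * Real.exp t : ℝ) : ℂ) * I
  have hγ : ∀ t ∈ Set.Icc 0 (Real.log (1 + |y|)), HasDerivAt γ (γ' t) t := by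
    intro t _
    have h1 : HasDerivAt (fun t : ℝ => σ * (Real.exp t - 1)) (σ * Real.exp t) t :=
      ((Real.hasDerivAt_exp t).sub_const 1).const_mul σ
    exact (h1.ofReal_comp.mul_const I).const_add (x0:ℂ)
  have him : ∀ t, (γ t).im = σ * (Real.exp t - 1) := by
    intro t; simp only [γ, add_im, Complex.ofReal_im, Complex.im_ofReal_mul, I_im]; ring
  have hre : ∀ t, (γ t).re = x0 := by
    intro t; simp only [γ, add_re, Complex.ofReal_re, Complex.re_ofReal_mul, I_re]; ring
  have hab : ∀ t ∈ Set.Icc 0 (Real.log (1 + |y|)), 1 + |(γ t).im| = Real.exp t ∧ supn (γ t) = s := by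
    intro t ht
    have h1 : 1 ≤ Real.exp t := Real.one_le_exp ht.1
    have h2 : Real.exp t ≤ 1 + |y| := by
      rw [← Real.exp_log hpos]; exact Real.exp_le_exp.2 ht.2
    have h3 : |(γ t).im| = Real.exp t - 1 := by
      rw [him, abs_mul, hσ, one_mul, abs_of_nonneg (by linarith)]
    refine ⟨by linarith, ?_⟩
    unfold supn
    rw [h3, hre, hx0]
    exact max_eq_left (by linarith)
  have hZ : ∀ t ∈ Set.Icc 0 (Real.log (1 + |y|)), HasDerivAt Z (D (γ t) * Z (γ t)) (γ t) := fun t ht =>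
    (h _ (hab t ht).2).1
  have hK : ∀ t ∈ Set.Icc 0 (Real.log (1 + |y|)), ‖D (γ t)‖ * ‖γ' t‖ ≤ C := by
    intro t ht
    have h1 := (h _ (hab t ht).2).2
    rw [(hab t ht).1] at h1
    have h2 : ‖γ' t‖ = Real.exp t := by
      simp only [γ', norm_mul, Complex.norm_real, Complex.norm_I, Real.norm_eq_abs, hσ, Real.abs_exp]; ring
    rw [h2]
    rwa [le_div_iff₀ (Real.exp_pos t)] at h1
  have e0 : γ 0 = x0 := by simp [γ]
  have e1 : γ (Real.log (1 + |y|)) = x0 + y * I := by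
    simp only [γ, Real.exp_log hpos]
    rw [show σ * (1 + |y| - 1) = σ * |y| by ring, ← hσy]
  have hle : Real.exp (C * (Real.log (1 + |y|) - 0)) ≤ (1 + s) ^ C := by
    rw [Real.rpow_def_of_pos (by linarith)]
    apply Real.exp_le_exp.2
    have : Real.log (1 + |y|) ≤ Real.log (1 + s) := Real.log_le_log hpos (by linarith)
    nlinarith
  have k1 := path_bound hb hγ hZ hK
  have k2 := path_bound_rev hb hγ hZ hK
  rw [e0, e1] at k1 k2
  exact ⟨k1.trans (mul_le_mul_of_nonneg_left hle (norm_nonneg _)),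
    k2.trans (mul_le_mul_of_nonneg_left hle (norm_nonneg _))⟩

lemma side_horiz {Z D : ℂ → ℂ} {C s y0 : ℝ} (hC : 0 ≤ C) (hs : 0 ≤ s) (hy0 : |y0| = s)
    (h : ∀ z, supn z = s → HasDerivAt Z (D z * Z z) z ∧ ‖D z‖ ≤ C / (1 + |z.im|))
    {x x' : ℝ} (hx : |x| ≤ s) (hx' : |x'| ≤ s) (hxx : x ≤ x') :
    ‖Z (x + y0 * I)‖ ≤ ‖Z (x' + y0 * I)‖ * Real.exp (2 * C) ∧ ‖Z (x' + y0 * I)‖ ≤ ‖Z (x + y0 * I)‖ * Real.exp (2 * C) := by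
  let γ : ℝ → ℂ := fun t => (t : ℂ) + y0 * I
  have hγ : ∀ t ∈ Set.Icc x x', HasDerivAt γ 1 t := fun t _ =>
    ((hasDerivAt_id t).ofReal_comp).add_const _
  have hab : ∀ t ∈ Set.Icc x x', |(γ t).im| = s ∧ supn (γ t) = s := by
    intro t ht
    have h1 : |t| ≤ s := abs_le.2 ⟨by linarith [ht.1, (abs_le.1 hx).1], by linarith [ht.2, (abs_le.1 hx').2]⟩
    have h2 : (γ t).im = y0 := by simp [γ]
    have h3 : (γ t).re = t := by simp [γ]
    unfold supn
    rw [h2, h3, hy0]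
    exact ⟨rfl, max_eq_right h1⟩
  have hZ : ∀ t ∈ Set.Icc x x', HasDerivAt Z (D (γ t) * Z (γ t)) (γ t) := fun t ht =>
    (h _ (hab t ht).2).1
  have hK : ∀ t ∈ Set.Icc x x', ‖D (γ t)‖ * ‖(1:ℂ)‖ ≤ C / (1 + s) := by
    intro t ht
    have h1 := (h _ (hab t ht).2).2
    rw [(hab t ht).1] at h1
    simpa using h1
  have hle : Real.exp (C / (1 + s) * (x' - x)) ≤ Real.exp (2 * C) := by
    apply Real.exp_le_exp.2
    rw [div_mul_eq_mul_div, div_le_iff₀ (by linarith)]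
    have : x' - x ≤ 2 * s := by linarith [(abs_le.1 hx).1, (abs_le.1 hx').2]
    nlinarith
  have k1 := path_bound hxx hγ hZ hK
  have k2 := path_bound_rev hxx hγ hZ hK
  exact ⟨k2.trans (mul_le_mul_of_nonneg_left hle (norm_nonneg _)),
    k1.trans (mul_le_mul_of_nonneg_left hle (norm_nonneg _))⟩

lemma square_chain {Z D : ℂ → ℂ} {C s : ℝ} (hC : 0 ≤ C) (hs : 0 ≤ s)
    (h : ∀ z, supn z = s → HasDerivAt Z (D z * Z z) z ∧ ‖D z‖ ≤ C / (1 + |z.im|))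
    {E : ℝ} (hE1 : (1 + s) ^ C ≤ E) (hE2 : Real.exp (2 * C) ≤ E)
    {a b : ℂ} (ha : supn a = s) (hb : supn b = s) : ‖Z a‖ ≤ E ^ 6 * ‖Z b‖ := by
  have hE : 1 ≤ E := le_trans (Real.one_le_exp (by linarith)) hE2
  have hE0 : 0 ≤ E := by linarith
  have hv : ∀ x0 y : ℝ, |x0| = s → |y| ≤ s → ‖Z (x0 + y * I)‖ ≤ E * ‖Z x0‖ ∧ ‖Z x0‖ ≤ E * ‖Z (x0 + y * I)‖ := by
    intro x0 y h1 h2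
    obtain ⟨k1, k2⟩ := side_vert hC hs h1 h h2
    exact ⟨k1.trans (by rw [mul_comm]; gcongr), k2.trans (by rw [mul_comm]; gcongr)⟩
  have hh : ∀ y0 x x' : ℝ, |y0| = s → |x| ≤ s → |x'| ≤ s → ‖Z (x + y0 * I)‖ ≤ E * ‖Z (x' + y0 * I)‖ := by
    intro y0 x x' h1 h2 h3
    rcases le_total x x' with h4 | h4
    · exact (side_horiz hC hs h1 h h2 h3 h4).1.trans (by rw [mul_comm]; gcongr)
    · exact (side_horiz hC hs h1 h h3 h2 h4).2.trans (by rw [mul_comm]; gcongr)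
  have hss : |s| = s := abs_of_nonneg hs
  have hns : |-s| = s := by rw [abs_neg, hss]
  have chain : ∀ x y z w : ℝ, x ≤ E * y → y ≤ E * z → z ≤ E * w → x ≤ E ^ 3 * w := by
    intro x y z w h1 h2 h3
    calc x ≤ E * y := h1
      _ ≤ E * (E * z) := by gcongr
      _ ≤ E * (E * (E * w)) := by gcongr
      _ = E ^ 3 * w := by ring
  have triv : ∀ x : ℂ, ‖Z x‖ ≤ E * ‖Z x‖ := fun x => le_mul_of_one_le_left (norm_nonneg _) hE
  have key : ∀ a : ℂ, supn a = s → ‖Z a‖ ≤ E ^ 3 * ‖Z (s + s * I)‖ ∧ ‖Z (s + s * I)‖ ≤ E ^ 3 * ‖Z a‖ := by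
    intro a ha
    have hr : |a.re| ≤ s := ha ▸ le_max_left _ _
    have hi : |a.im| ≤ s := ha ▸ le_max_right _ _
    have hcase : |a.re| = s ∨ |a.im| = s := by
      unfold supn at ha
      rcases max_choice |a.re| |a.im| with h1 | h1
      · left; rw [← h1, ha]
      · right; rw [← h1, ha]
    have hae : a = a.re + a.im * I := (Complex.re_add_im a).symm
    rcases hcase with h1 | h1
    · have e1 := hv a.re a.im h1 hi
      rw [← hae] at e1
      have e2 := hv a.re s h1 (le_of_eq hss)
      have e3 := hh s a.re s hss hr (le_of_eq hss)
      have e4 := hh s s a.re hss (le_of_eq hss) hr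
      exact ⟨chain _ _ _ _ e1.1 e2.2 e3, chain _ _ _ _ e4 e2.1 e1.2⟩
    · rcases abs_choice a.im with h2 | h2
      · have h3 : a.im = s := by rw [← h2, h1]
        have e3 := hh s a.re s hss hr (le_of_eq hss)
        have e4 := hh s s a.re hss (le_of_eq hss) hr
        rw [← h3, ← hae, h3] at e3 
        have e4' : ‖Z (s + s * I)‖ ≤ E * ‖Z a‖ := by
          rw [hae, h3]; exact e4
        exact ⟨chain _ _ _ _ e3 (triv _) (triv _), chain _ _ _ _ e4' (triv _) (triv _)⟩
      · have h3 : a.im = -s := by linarith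
        have e3 := hh (-s) a.re s hns hr (le_of_eq hss)
        have e4 := hh (-s) s a.re hns (le_of_eq hss) hr
        have ea : a = a.re + ((-s : ℝ) : ℂ) * I := by rw [← h3]; exact hae
        rw [← ea] at e3 e4
        have e5 := hv s (-s) hss (le_of_eq hns)
        have e6 := hv s s hss (le_of_eq hss)
        exact ⟨chain _ _ _ _ e3 e5.1 e6.2, chain _ _ _ _ e6.1 e5.2 e4⟩
  calc ‖Z a‖ ≤ E ^ 3 * ‖Z (s + s * I)‖ := (key a ha).1
    _ ≤ E ^ 3 * (E ^ 3 * ‖Z b‖) := by gcongr; exact (key b hb).2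
    _ = E ^ 6 * ‖Z b‖ := by ring

lemma square_max {W : ℂ → ℂ} (hW : Differentiable ℂ W) {s B : ℝ}
    (h : ∀ z, supn z = s → ‖W z‖ ≤ B) {z : ℂ} (hz : supn z ≤ s) : ‖W z‖ ≤ B := by
  rcases hz.lt_or_eq with h1 | h1
  · refine Complex.norm_le_of_forall_mem_frontier_norm_le (U := {z | supn z < s}) ?_ hW.diffContOnCl ?_
      (subset_closure h1)
    · refine (Metric.isBounded_closedBall (x := (0:ℂ)) (r := 2 * s)).subset ?_
      intro w hw
      simp only [mem_closedBall_zero_iff]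
      have : supn w < s := hw
      linarith [norm_le_supn w]
    · intro w hw
      exact h w (frontier_lt_subset_eq supn_cont continuous_const hw)
  · exact h z h1

lemma poly_core {Z D W : ℂ → ℂ} {A r0 : ℝ} {C k N : ℕ} (hW : Differentiable ℂ W)
    (hWZ : ∀ z ≠ 0, W z = z ^ N * Z z)
    (h : ∀ r ≥ r0, ∃ s ≥ r, (∀ z, supn z = s → HasDerivAt Z (D z * Z z) z ∧ ‖D z‖ ≤ C / (1 + |z.im|)) ∧
      ∃ b, supn b = s ∧ ‖Z b‖ ≤ A * s ^ k) :
    ∃ p : Polynomial ℂ, ∀ z, W z = p.eval z := by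
  obtain ⟨B, hB⟩ : ∃ B : ℝ, B = 2 ^ N * ((Real.exp (2 * C) * 2 ^ C) ^ 6 * |A|) := ⟨_, rfl⟩
  have := poly_of_growth (g := W) (C := B) (N := N + (C * 6 + k)) hW ?_
  · obtain ⟨p, -, hp⟩ := this; exact ⟨p, hp⟩
  rw [Filter.frequently_atTop]
  intro r
  obtain ⟨s, hs, hbd, b, hb, hZb⟩ := h (max (max r r0) 1) (le_max_of_le_left (le_max_right _ _))
  have hs1 : 1 ≤ s := le_trans (le_max_right _ _) hs
  have hsr : r ≤ s := le_trans (le_trans (le_max_left _ _) (le_max_left _ _)) hs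
  refine ⟨s, hsr, fun z hz => ?_⟩
  refine square_max hW (s := s) ?_ ((supn_le_norm z).trans hz)
  intro a ha
  have ha0 : a ≠ 0 := by
    rintro rfl
    simp [supn] at ha; linarith
  have hC0 : (0:ℝ) ≤ C := Nat.cast_nonneg _
  have hE1 : (1 + s) ^ (C:ℝ) ≤ Real.exp (2 * C) * (2 * s) ^ C := by
    rw [Real.rpow_natCast]
    have h1 : (1 + s) ^ C ≤ (2 * s) ^ C := by gcongr; linarith
    have h2 : 1 ≤ Real.exp (2 * C) := Real.one_le_exp (by linarith)
    nlinarith [pow_pos (show 0 < 2 * s by linarith) C]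
  have hE2 : Real.exp (2 * C) ≤ Real.exp (2 * C) * (2 * s) ^ C :=
    le_mul_of_one_le_right (Real.exp_pos _).le (one_le_pow₀ (by linarith))
  have hc := square_chain hC0 (by linarith) hbd hE1 hE2 ha hb
  rw [hWZ a ha0, norm_mul, norm_pow]
  have hna : ‖a‖ ≤ 2 * s := by rw [← ha]; exact norm_le_supn a
  calc ‖a‖ ^ N * ‖Z a‖ ≤ (2 * s) ^ N * ((Real.exp (2 * C) * (2 * s) ^ C) ^ 6 * (|A| * s ^ k)) := by
        gcongr
        refine hc.trans ?_
        gcongr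
        refine hZb.trans ?_
        gcongr
        exact le_abs_self A
    _ = B * s ^ (N + (C * 6 + k)) := by rw [hB]; ring


lemma Gd.neg {u : ℂ → ℂ} (hu : Gd u) : Gd (fun z => - u (-z)) := by
  intro z hz
  obtain ⟨h1, h2, h3⟩ := hu (-z) (by simpa using hz)
  have hd : HasDerivAt (fun z => - u (-z)) (deriv u (-z)) z := by
    have := (h1.hasDerivAt.comp z (hasDerivAt_neg z)).neg
    refine this.congr_deriv ?_
    ring
  refine ⟨hd.differentiableAt, by rwa [hd.deriv], fun h0 => ?_⟩
  rw [hd.deriv]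
  exact h3 (by simpa using h0)

lemma affine_hasDeriv {u : ℂ → ℂ} {a ζ : ℂ} {r : ℝ} (hr : 0 < r)
    (hu : DifferentiableAt ℂ u (a + r * ζ)) :
    HasDerivAt (fun ζ : ℂ => u (a + r * ζ) / r) (deriv u (a + r * ζ)) ζ := by
  have h1 : HasDerivAt (fun ζ : ℂ => a + r * ζ) (r:ℂ) ζ := by
    refine (((hasDerivAt_id ζ).const_mul (r:ℂ)).const_add a).congr_deriv ?_
    ring
  have h2 := (hu.hasDerivAt.comp ζ h1).div_const (r:ℂ)
  refine h2.congr_deriv ?_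
  have : (r:ℂ) ≠ 0 := by exact_mod_cast hr.ne'
  field_simp

lemma half_levels {U : Ultrafilter ℕ} {u : ℂ → ℂ} (hu : Gd u) {a r : ℕ → ℝ} (hr : ∀ n, 0 < r n)
    {K : Set ℂ} (hK : IsCompact K) (hKp : ∀ z ∈ K, 0 < z.im) {p : ℂ} (hp : 0 < p.im) {c : ℝ} (hc : 0 < c)
    (hpc : ∀ᶠ n in (U : Filter ℕ), c ≤ ‖u (a n + r n * p) / r n‖) {π : ℂ → ℝ} (hπ : Continuous π) :
    ∃ bad : Set ℝ, bad.Finite ∧ ∀ s ∉ bad, ∃ c' > 0, ∀ᶠ n in (U : Filter ℕ), ∀ z ∈ K, π z = s →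
      c' ≤ ‖u (a n + r n * z) / r n‖ := by
  obtain ⟨C, hC, hN⟩ := normality_gd
  refine good_levels (u := fun n z => u (a n + r n * z) / r n) (Ω := {z : ℂ | 0 < z.im})
    (isOpen_lt continuous_const Complex.continuous_im)
    ((convex_halfSpace_im_gt 0).isPreconnected) hK hKp ?_ hp hc hpc hπ
  intro q hq
  have hq0 : 0 < q.im := hq
  refine ⟨q.im / 2, by linarith, C * (1 + 4 / q.im ^ 2), by positivity, Eventually.of_forall fun n z hz => ?_⟩
  have hz1 : q.im / 2 ≤ z.im := by
    rw [Metric.mem_ball, dist_eq_norm] at hz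
    have := (Complex.abs_im_le_norm (z - q)).trans hz.le
    rw [Complex.sub_im] at this
    linarith [(abs_le.1 this).1]
  have him : ((a n : ℂ) + r n * z).im = r n * z.im := by simp
  have hpos : 0 < r n * z.im := mul_pos (hr n) (by linarith)
  have hne : ((a n : ℂ) + r n * z).im ≠ 0 := by rw [him]; exact hpos.ne'
  have hd := affine_hasDeriv (hr n) (hu _ hne).1
  refine ⟨hd.differentiableAt, ?_⟩
  rw [hd.deriv]
  refine (hN u hu _ hne).trans ?_
  rw [him, norm_div, Complex.norm_real, Real.norm_of_nonneg (hr n).le, abs_of_pos hpos, mul_assoc]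
  have hC0 : 0 ≤ C := by linarith
  refine mul_le_mul_of_nonneg_left ?_ hC0
  obtain ⟨X, hX⟩ : ∃ X : ℝ, X = (‖u (a n + r n * z)‖ / r n) ^ 2 := ⟨_, rfl⟩
  have hX0 : 0 ≤ X := by rw [hX]; positivity
  have e1 : ‖u (a n + r n * z)‖ ^ 2 / (r n * z.im) ^ 2 = X / z.im ^ 2 := by
    rw [hX, div_pow, mul_pow, div_div]
  rw [e1, ← hX]
  have h4 : X / z.im ^ 2 ≤ X * (4 / q.im ^ 2) := by
    rw [div_eq_mul_inv]
    refine mul_le_mul_of_nonneg_left ?_ hX0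
    have hz0 : 0 < z.im := by linarith
    rw [inv_eq_one_div, div_le_div_iff₀ (by positivity) (by positivity)]
    nlinarith
  have h5 : 0 ≤ 4 / q.im ^ 2 := by positivity
  nlinarith

lemma cone_bound {u : ℂ → ℂ} {k : ℝ} (hk : 1 ≤ k) (hu : Gd u)
    (hre : ∀ x : ℝ, x ≠ 0 → (∀ᶠ w in 𝓝 (x:ℂ), DifferentiableAt ℂ (fun w => (u w)⁻¹) w) ∧ ‖(u x)⁻¹‖ ≤ k / |x|) :
    ∃ σ > 0, σ ≤ 1 ∧ ∃ κ > 0, ∀ z : ℂ, z.im ≠ 0 → |z.im| < σ * |z.re| → κ * |z.re| ≤ ‖u z‖ := by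
  obtain ⟨δ, hδ, hδ4, H⟩ := near_line
  have hk0 : 0 < k := by linarith
  refine ⟨δ / (2 * k), by positivity, ?_, 1 / (6 * k), by positivity, ?_⟩
  · rw [div_le_one (by positivity)]; linarith
  intro z hz hzc
  have hx : 0 < |z.re| := by
    by_contra h
    have : |z.re| = 0 := le_antisymm (not_lt.1 h) (abs_nonneg _)
    rw [this] at hzc
    have := abs_nonneg z.im
    linarith
  have hR : 0 < |z.re| / (2 * k) := by positivity
  have := H u (z.re : ℂ) (|z.re| / (2 * k)) 0 hR ?_ (by simp) z ?_ hz
  · refine le_trans (le_of_eq ?_) this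
    field_simp; ring
  · intro w hw
    refine ⟨fun h => hu w h, fun h => ?_⟩
    have hwr : w = (w.re : ℂ) := by apply Complex.ext <;> simp [h]
    have h1 : |w.re - z.re| ≤ |z.re| / 2 := by
      rw [Metric.mem_ball, dist_eq_norm] at hw
      have h2 := (Complex.abs_re_le_norm (w - z.re)).trans hw.le
      simp only [Complex.sub_re, Complex.ofReal_re] at h2
      refine h2.trans ?_
      apply div_le_div_of_nonneg_left hx.le (by norm_num) (by linarith)
    have h3 : |z.re| / 2 ≤ |w.re| := by
      have := abs_sub_abs_le_abs_sub z.re w.re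
      rw [abs_sub_comm] at this
      linarith
    have hw0 : w.re ≠ 0 := abs_pos.1 (by linarith)
    obtain ⟨h4, h5⟩ := hre w.re hw0
    rw [← hwr] at h4 h5
    refine ⟨h4, h5.trans ?_⟩
    rw [one_div_div, div_le_div_iff₀ (by linarith) hx]
    nlinarith
  · rw [Metric.mem_ball, dist_eq_norm]
    have : z - (z.re : ℂ) = z.im * I := by
      apply Complex.ext <;> simp
    rw [this, norm_mul, Complex.norm_I, Complex.norm_real, mul_one, Real.norm_eq_abs]
    refine hzc.trans_le (le_of_eq ?_)
    ring

lemma levels_square {u : ℂ → ℂ} (hu : Gd u) {σ κ : ℝ} (hσ : 0 < σ) (hσ1 : σ ≤ 1) (hκ : 0 < κ)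
    (hcone : ∀ z : ℂ, z.im ≠ 0 → |z.im| < σ * |z.re| → κ * |z.re| ≤ ‖u z‖) :
    ∃ c > 0, ∃ r0 > 0, ∀ r ≥ r0, ∃ s ≥ r, s ≤ 2 * r ∧ ∀ z : ℂ, supn z = s → z.im ≠ 0 → c * r ≤ ‖u z‖ := by
  by_contra hcon
  push Not at hcon
  have h1 : ∀ n : ℕ, ∃ r : ℝ, 1 ≤ r ∧ ∀ s ≥ r, s ≤ 2 * r → ∃ z : ℂ, supn z = s ∧ z.im ≠ 0 ∧
      ‖u z‖ < (1 / ((n:ℝ) + 1)) * r := fun n => hcon (1 / ((n:ℝ) + 1)) (by positivity) 1 one_pos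
  choose r hr hbad using h1
  have hr0 : ∀ n, 0 < r n := fun n => by linarith [hr n]
  obtain ⟨U, hU⟩ : ∃ U : Ultrafilter ℕ, (U : Filter ℕ) ≤ atTop := ⟨hyperfilter ℕ, Nat.hyperfilter_le_atTop⟩
  let K : Set ℂ := {z | supn z ≤ 2 ∧ σ / 2 ≤ z.im}
  have hK : IsCompact K := by
    refine Metric.isCompact_of_isClosed_isBounded ?_ ?_
    · exact (isClosed_le supn_cont continuous_const).inter (isClosed_le continuous_const Complex.continuous_im)
    · refine (Metric.isBounded_closedBall (x := (0:ℂ)) (r := 4)).subset ?_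
      intro w hw
      have h2 : supn w ≤ 2 := hw.1
      rw [mem_closedBall_zero_iff]
      linarith [norm_le_supn w]
  have hKp : ∀ z ∈ K, 0 < z.im := fun z hz => by
    have : σ / 2 ≤ z.im := hz.2
    linarith
  have main : ∀ w : ℂ → ℂ, Gd w → (∀ z : ℂ, z.im ≠ 0 → |z.im| < σ * |z.re| → κ * |z.re| ≤ ‖w z‖) →
      ∃ bad : Set ℝ, bad.Finite ∧ ∀ s ∉ bad, ∃ c' > 0, ∀ᶠ n in (U : Filter ℕ), ∀ z ∈ K, supn z = s →
      c' * r n ≤ ‖w (r n * z)‖ := by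
    intro w hw hcw
    obtain ⟨bad, hb, hb2⟩ := half_levels (U := U) hw (a := fun _ => 0) hr0 hK hKp (p := 1 + (σ / 2 : ℝ) * I)
      (by simp; linarith) hκ (Eventually.of_forall fun n => by
        have him : ((r n : ℂ) * (1 + (σ / 2 : ℝ) * I)).im = r n * (σ / 2) := by simp
        have hrr : ((r n : ℂ) * (1 + (σ / 2 : ℝ) * I)).re = r n := by simp
        have := hcw ((r n : ℂ) * (1 + (σ / 2 : ℝ) * I)) (by rw [him]; have := hr0 n; positivity)
          (by rw [him, hrr, abs_of_pos (hr0 n), abs_of_pos (by have := hr0 n; positivity)]; nlinarith [hr0 n])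
        rw [hrr, abs_of_pos (hr0 n)] at this
        rw [norm_div, Complex.norm_real, Real.norm_of_nonneg (hr0 n).le, le_div_iff₀ (hr0 n)]
        simpa using this) supn_cont
    refine ⟨bad, hb, fun s hs => ?_⟩
    obtain ⟨c', hc', h⟩ := hb2 s hs
    refine ⟨c', hc', h.mono fun n hn z hz hzs => ?_⟩
    have := hn z hz hzs
    rw [norm_div, Complex.norm_real, Real.norm_of_nonneg (hr0 n).le, le_div_iff₀ (hr0 n)] at this
    simpa using this
  obtain ⟨b1, hb1, H1⟩ := main u hu hcone
  obtain ⟨b2, hb2, H2⟩ := main _ hu.neg (fun z hz hc => by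
    rw [norm_neg]
    have := hcone (-z) (by simpa using hz) (by simpa using hc)
    simpa using this)
  obtain ⟨s, hs, hsb⟩ : ∃ s ∈ Set.Icc (1:ℝ) 2, s ∉ b1 ∪ b2 :=
    ((Set.Icc_infinite (by norm_num : (1:ℝ) < 2)).exists_notMem_finite (hb1.union hb2))
  obtain ⟨c1, hc1, E1⟩ := H1 s (fun h => hsb (Or.inl h))
  obtain ⟨c2, hc2, E2⟩ := H2 s (fun h => hsb (Or.inr h))
  obtain ⟨c, hcd⟩ : ∃ c, c = min κ (min c1 c2) := ⟨_, rfl⟩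
  have hc0 : 0 < c := by rw [hcd]; exact lt_min hκ (lt_min hc1 hc2)
  have hlim : ∀ᶠ n : ℕ in (U : Filter ℕ), 1 / ((n:ℝ) + 1) < c :=
    ((tendsto_one_div_add_atTop_nhds_zero_nat (𝕜 := ℝ)).mono_left hU).eventually_lt_const hc0
  obtain ⟨n, ⟨hn1, hn2⟩, hn3⟩ := ((E1.and E2).and hlim).exists
  obtain ⟨z, hz1, hz2, hz3⟩ := hbad n (s * r n) (by nlinarith [hs.1, hr0 n]) (by nlinarith [hs.2, hr0 n])
  have hrn := hr0 n
  have hrc : (r n : ℂ) ≠ 0 := by exact_mod_cast hrn.ne'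
  obtain ⟨ζ, hζ⟩ : ∃ ζ : ℂ, ζ = z / r n := ⟨_, rfl⟩
  have hzζ : z = r n * ζ := by rw [hζ]; field_simp
  have hre : z.re = r n * ζ.re := by rw [hzζ]; simp
  have him : z.im = r n * ζ.im := by rw [hzζ]; simp
  have hsz : supn ζ = s := by
    have : supn z = r n * supn ζ := by
      unfold supn; rw [hre, him, abs_mul, abs_mul, abs_of_pos hrn, mul_max_of_nonneg _ _ hrn.le]
    rw [hz1] at this
    nlinarith [mul_right_cancel₀ hrn.ne' (show s * r n = supn ζ * r n by linarith)]
  have hlow : c * r n ≤ ‖u z‖ := by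
    have hcr : ∀ c' ≥ c, c' * r n ≤ ‖u z‖ → c * r n ≤ ‖u z‖ := fun c' h1 h2 => by nlinarith
    by_cases hA : σ / 2 ≤ ζ.im
    · refine hcr c1 (by rw [hcd]; exact (min_le_right _ _).trans (min_le_left _ _)) ?_
      rw [hzζ]
      exact hn1 ζ ⟨by rw [hsz]; exact hs.2, hA⟩ hsz
    by_cases hB : ζ.im ≤ -(σ / 2)
    · refine hcr c2 (by rw [hcd]; exact (min_le_right _ _).trans (min_le_right _ _)) ?_
      have := hn2 (-ζ) ⟨by unfold supn at hsz ⊢; simp only [Complex.neg_re, Complex.neg_im, abs_neg]; rw [hsz]; exact hs.2,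
        by simp only [Complex.neg_im]; linarith⟩ (by unfold supn at hsz ⊢; simp only [Complex.neg_re, Complex.neg_im, abs_neg]; exact hsz)
      rw [norm_neg, mul_neg, neg_neg, ← hzζ] at this
      exact this
    · push Not at hA hB
      have h1 : |ζ.im| < σ / 2 := abs_lt.2 ⟨hB, hA⟩
      have h2 : 1 ≤ |ζ.re| := by
        have : max |ζ.re| |ζ.im| = s := hsz
        rcases max_choice |ζ.re| |ζ.im| with h3 | h3 <;> linarith [hs.1]
      have h4 := hcone z hz2 (by
        rw [him, hre, abs_mul, abs_mul, abs_of_pos hrn]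
        have h5 : |ζ.im| < σ * |ζ.re| := by nlinarith
        nlinarith)
      rw [hre, abs_mul, abs_of_pos hrn] at h4
      refine hcr κ (by rw [hcd]; exact min_le_left _ _) (le_trans ?_ h4)
      gcongr
      nlinarith
  nlinarith

lemma b1_core {u Z W : ℂ → ℂ} {k : ℝ} {N : ℕ} (hu : Gd u)
    (hre : ∀ x : ℝ, x ≠ 0 → (∀ᶠ w in 𝓝 (x:ℂ), DifferentiableAt ℂ (fun w => (u w)⁻¹) w) ∧ ‖(u x)⁻¹‖ ≤ k / |x|)
    (hW : Differentiable ℂ W) (hWZ : ∀ z ≠ 0, W z = z ^ N * Z z)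
    (hZ : ∀ z ≠ 0, (z.im ≠ 0 → u z ≠ 0) → HasDerivAt Z (-(u z)⁻¹ * Z z) z) :
    ∃ p : Polynomial ℂ, ∀ z, W z = p.eval z := by
  obtain ⟨k', hk'⟩ : ∃ k' : ℕ, max k 1 ≤ k' := exists_nat_ge _
  have hk1 : (1:ℝ) ≤ k' := le_trans (le_max_right _ _) hk'
  have hre' : ∀ x : ℝ, x ≠ 0 → (∀ᶠ w in 𝓝 (x:ℂ), DifferentiableAt ℂ (fun w => (u w)⁻¹) w) ∧ ‖(u x)⁻¹‖ ≤ k' / |x| :=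
    fun x hx => ⟨(hre x hx).1, (hre x hx).2.trans (by
      apply div_le_div_of_nonneg_right (le_trans (le_max_left _ _) hk') (abs_nonneg _))⟩
  obtain ⟨σ, hσ, hσ1, κ, hκ, hcone⟩ := cone_bound hk1 hu hre'
  obtain ⟨c, hc, r0, hr0, hlev⟩ := levels_square hu hσ hσ1 hκ hcone
  obtain ⟨C, hC⟩ : ∃ C : ℕ, max (4 / c) (3 * k') ≤ C := exists_nat_ge _
  have hC1 : 4 / c ≤ C := le_trans (le_max_left _ _) hC
  have hC2 : 3 * (k':ℝ) ≤ C := le_trans (le_max_right _ _) hC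
  refine poly_core (Z := Z) (D := fun z => -(u z)⁻¹) (C := C) (k := k') (A := ‖Z 1‖) (r0 := max r0 1) hW hWZ ?_
  intro r hr
  have hr1 : 1 ≤ r := le_trans (le_max_right _ _) hr
  obtain ⟨s, hs, hs2, hl⟩ := hlev r (le_trans (le_max_left _ _) hr)
  have hs1 : 1 ≤ s := by linarith
  refine ⟨s, hs, fun z hz => ?_, (s:ℂ), by simp [supn, abs_of_pos (show 0 < s by linarith)]; linarith, ?_⟩
  · have hz0 : z ≠ 0 := by rintro rfl; simp [supn] at hz; linarith
    have him : |z.im| ≤ s := hz ▸ le_max_right _ _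
    have key : (z.im ≠ 0 → u z ≠ 0) ∧ ‖(u z)⁻¹‖ ≤ C / (1 + |z.im|) := by
      by_cases h0 : z.im = 0
      · refine ⟨fun h => absurd h0 h, ?_⟩
        have hzr : z = (z.re : ℂ) := by apply Complex.ext <;> simp [h0]
        have hxs : |z.re| = s := by
          have : max |z.re| |z.im| = s := hz
          rw [h0, abs_zero, max_eq_left (abs_nonneg _)] at this; exact this
        have hx0 : z.re ≠ 0 := abs_pos.1 (by linarith)
        have := (hre' z.re hx0).2
        rw [← hzr, hxs] at this
        rw [h0, abs_zero, add_zero, div_one]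
        refine this.trans ((div_le_self (by linarith) hs1).trans (by linarith))
      · have h1 := hl z hz h0
        have hpos : 0 < ‖u z‖ := lt_of_lt_of_le (by nlinarith) h1
        refine ⟨fun _ => norm_pos_iff.1 hpos, ?_⟩
        rw [norm_inv, inv_eq_one_div, div_le_div_iff₀ hpos (by positivity)]
        rw [div_le_iff₀ hc] at hC1
        have h2 : 1 + |z.im| ≤ 4 * r := by linarith
        have hC0 : (0:ℝ) ≤ C := Nat.cast_nonneg _
        nlinarith
    refine ⟨hZ z hz0 key.1, ?_⟩
    simp only [norm_neg]; exact key.2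
  · have hpos : 0 < s := by linarith
    have hb : 0 ≤ Real.log s := Real.log_nonneg hs1
    have k1 := path_bound (Z := Z) (D := fun z => -(u z)⁻¹) (γ := fun t => ((Real.exp t : ℝ) : ℂ))
      (γ' := fun t => ((Real.exp t : ℝ) : ℂ)) (K := k') hb
      (fun t _ => (Real.hasDerivAt_exp t).ofReal_comp) (fun t _ => by
        refine hZ _ (by exact_mod_cast (Real.exp_pos t).ne') (fun h => absurd (Complex.ofReal_im _) h))
      (fun t _ => by
        have := (hre' (Real.exp t) (Real.exp_pos t).ne').2
        rw [norm_neg, Complex.norm_real, Real.norm_eq_abs]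
        rwa [le_div_iff₀ (abs_pos.2 (Real.exp_pos t).ne')] at this)
    simp only [Real.exp_zero, Complex.ofReal_one, Real.exp_log hpos, sub_zero] at k1
    refine k1.trans (le_of_eq ?_)
    rw [mul_comm (k':ℝ), Real.exp_mul, Real.exp_log hpos, Real.rpow_natCast]


lemma poly_scale_absurd {U : Ultrafilter ℕ} {a : ℕ → ℂ} {r : ℕ → ℝ} (hr : ∀ n, 1 ≤ r n) :
    ∀ (N : ℕ) (p : Polynomial ℂ) (j : ℕ), p.natDegree ≤ N → p ≠ 0 →
      NC U (fun n ζ => (r n : ℂ) ^ j * p.eval (a n + r n * ζ)) (fun _ => 0) 0 → False := by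
  intro N
  induction N with
  | zero =>
    intro p j hp hp0 h
    obtain ⟨c, hc⟩ : ∃ c, p = Polynomial.C c := ⟨_, Polynomial.eq_C_of_natDegree_le_zero hp⟩
    have hc0 : c ≠ 0 := by rintro rfl; simp [hc] at hp0
    have h1 := h.tendsto_pt.norm
    rw [norm_zero] at h1
    have h2 : ‖c‖ ≤ 0 := by
      refine ge_of_tendsto h1 (Eventually.of_forall fun n => ?_)
      rw [hc, Polynomial.eval_C, norm_mul, norm_pow, Complex.norm_real, Real.norm_of_nonneg (by linarith [hr n])]
      exact le_mul_of_one_le_left (norm_nonneg _) (one_le_pow₀ (hr n))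
    exact hc0 (norm_le_zero_iff.1 h2)
  | succ N ih =>
    intro p j hp hp0 h
    by_cases hz : p.natDegree = 0
    · have := Polynomial.eq_C_of_natDegree_eq_zero hz
      obtain ⟨c, hc⟩ : ∃ c, p = Polynomial.C c := ⟨_, this⟩
      have hc0 : c ≠ 0 := by rintro rfl; simp [hc] at hp0
      have h1 := h.tendsto_pt.norm
      rw [norm_zero] at h1
      have h2 : ‖c‖ ≤ 0 := by
        refine ge_of_tendsto h1 (Eventually.of_forall fun n => ?_)
        rw [hc, Polynomial.eval_C, norm_mul, norm_pow, Complex.norm_real, Real.norm_of_nonneg (by linarith [hr n])]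
        exact le_mul_of_one_le_left (norm_nonneg _) (one_le_pow₀ (hr n))
      exact hc0 (norm_le_zero_iff.1 h2)
    · refine ih (Polynomial.derivative p) (j + 1) ?_ ?_ ?_
      · have := Polynomial.natDegree_derivative_lt hz
        omega
      · intro h0
        exact hz (Polynomial.derivative_eq_zero.1 h0)
      · have h1 := h.deriv
        have e : deriv (fun _ : ℂ => (0:ℂ)) = fun _ => 0 := by funext x; simp
        rw [e] at h1
        refine h1.congr (Eventually.of_forall fun x => ?_)
        have hd : HasDerivAt (fun ζ : ℂ => (r x.1 : ℂ) ^ j * p.eval (a x.1 + r x.1 * ζ))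
            ((r x.1 : ℂ) ^ j * ((Polynomial.derivative p).eval (a x.1 + r x.1 * x.2) * r x.1)) x.2 := by
          have h2 : HasDerivAt (fun ζ : ℂ => a x.1 + r x.1 * ζ) (r x.1 : ℂ) x.2 := by
            refine (((hasDerivAt_id x.2).const_mul (r x.1 : ℂ)).const_add (a x.1)).congr_deriv ?_
            ring
          exact ((p.hasDerivAt (a x.1 + r x.1 * x.2)).comp x.2 h2).const_mul _
        show deriv (fun ζ : ℂ => (r x.1 : ℂ) ^ j * p.eval (a x.1 + r x.1 * ζ)) x.2 = _
        rw [hd.deriv]; ring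

lemma far_lower {u q : ℂ → ℂ} {d : ℂ} (hu : Gd u) (hu1 : Gd (fun z => u z / (1 - deriv u z)))
    (hv1 : Gd (fun z => (u z + d) / (1 - deriv u z))) (hq : Differentiable ℂ q)
    (hK : ∀ z : ℂ, z.im ≠ 0 → exp (q z) = (1 - deriv (fun z => u z / (1 - deriv u z)) z) /
      (1 - deriv (fun z => (u z + d) / (1 - deriv u z)) z))
    (hqn : ∃ z, deriv q z ≠ 0) :
    ∃ C > 0, ∀ z : ℂ, C ≤ |z.im| → |z.im| ≤ C * ‖u z‖ := by
  obtain ⟨pl, hpl⟩ := K_poly hu1 hv1 hq hK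
  by_contra hcon
  push Not at hcon
  choose a ha1 ha2 using fun n : ℕ => hcon ((n:ℝ) + 1) (by positivity)
  obtain ⟨r, hrd⟩ : ∃ r : ℕ → ℝ, ∀ n, r n = |(a n).im| := ⟨_, fun _ => rfl⟩
  have hr : ∀ n, 1 ≤ r n := fun n => by
    rw [hrd]; have := ha1 n; have h2 : (0:ℝ) ≤ n := Nat.cast_nonneg _; linarith
  have hr0 : ∀ n, 0 < r n := fun n => by linarith [hr n]
  have hrc : ∀ n, (r n : ℂ) ≠ 0 := fun n => by exact_mod_cast (hr0 n).ne'
  obtain ⟨U, hU⟩ : ∃ U : Ultrafilter ℕ, (U : Filter ℕ) ≤ atTop := ⟨hyperfilter ℕ, Nat.hyperfilter_le_atTop⟩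
  have himb : ∀ n, ∀ ζ : ℂ, r n * (1 - ‖ζ‖) ≤ |(a n + r n * ζ).im| := by
    intro n ζ
    have e : (a n + r n * ζ).im = (a n).im + r n * ζ.im := by simp
    rw [e]
    have h1 := abs_sub_abs_le_abs_sub (a n).im (-(r n * ζ.im))
    rw [sub_neg_eq_add, abs_neg, abs_mul, abs_of_pos (hr0 n), ← hrd] at h1
    have h2 := Complex.abs_im_le_norm ζ
    nlinarith [hr0 n]
  have himn : ∀ n, ∀ ζ ∈ Metric.ball (0:ℂ) 1, (a n + r n * ζ).im ≠ 0 := by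
    intro n ζ hζ h0
    have := himb n ζ
    rw [h0, abs_zero] at this
    rw [mem_ball_zero_iff] at hζ
    nlinarith [hr0 n]
  let un : ℕ → ℂ → ℂ := fun n ζ => u (a n + r n * ζ) / r n
  obtain ⟨C, hC, hN⟩ := normality_gd
  have hloc : ∀ y ∈ Metric.ball (0:ℂ) 1, ∃ ρ > 0, ∃ C > 0, ∀ᶠ n in (U : Filter ℕ), ∀ z ∈ Metric.ball y ρ,
      DifferentiableAt ℂ (un n) z ∧ ‖deriv (un n) z‖ ≤ C * (1 + ‖un n z‖^2) := by
    intro y hy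
    rw [mem_ball_zero_iff] at hy
    obtain ⟨t, ht⟩ : ∃ t : ℝ, t = (1 - ‖y‖) / 2 := ⟨_, rfl⟩
    have ht0 : 0 < t := by rw [ht]; linarith
    refine ⟨t, ht0, C * (1 + 1 / t ^ 2), by positivity, Eventually.of_forall fun n z hz => ?_⟩
    have hz1 : t ≤ 1 - ‖z‖ := by
      rw [Metric.mem_ball, dist_eq_norm] at hz
      have := norm_add_le (z - y) y
      rw [sub_add_cancel] at this
      linarith
    have hzb : z ∈ Metric.ball (0:ℂ) 1 := by rw [mem_ball_zero_iff]; linarith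
    have hne := himn n z hzb
    have hd := affine_hasDeriv (hr0 n) (hu _ hne).1
    refine ⟨hd.differentiableAt, ?_⟩
    show ‖deriv (fun ζ => u (a n + r n * ζ) / r n) z‖ ≤ C * (1 + 1 / t ^ 2) * (1 + ‖u (a n + r n * z) / r n‖ ^ 2)
    rw [hd.deriv]
    refine (hN u hu _ hne).trans ?_
    rw [mul_assoc]
    refine mul_le_mul_of_nonneg_left ?_ (by linarith)
    rw [norm_div, Complex.norm_real, Real.norm_of_nonneg (hr0 n).le]
    have h1 : r n * t ≤ |(a n + r n * z).im| := le_trans (by nlinarith [hr0 n]) (himb n z)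
    have h2 : ‖u (a n + r n * z)‖ ^ 2 / |(a n + r n * z).im| ^ 2 ≤ ‖u (a n + r n * z)‖ ^ 2 / (r n * t) ^ 2 := by
      have : 0 < r n * t := mul_pos (hr0 n) ht0
      gcongr
    have h3 : ‖u (a n + r n * z)‖ ^ 2 / (r n * t) ^ 2 = (‖u (a n + r n * z)‖ / r n) ^ 2 * (1 / t ^ 2) := by
      have := (hr0 n).ne'
      field_simp
    rw [h3] at h2
    have h4 : 0 ≤ (‖u (a n + r n * z)‖ / r n) ^ 2 := by positivity
    have h5 : 0 ≤ 1 / t ^ 2 := by positivity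
    nlinarith
  have h0lim : Tendsto (fun n => un n 0) (U : Filter ℕ) (𝓝 0) := by
    refine squeeze_zero_norm (a := fun n : ℕ => 1 / ((n:ℝ) + 1)) (fun n => ?_)
      ((tendsto_one_div_add_atTop_nhds_zero_nat (𝕜 := ℝ)).mono_left hU)
    show ‖u (a n + r n * 0) / r n‖ ≤ _
    rw [mul_zero, add_zero, norm_div, Complex.norm_real, Real.norm_of_nonneg (hr0 n).le,
      div_le_div_iff₀ (hr0 n) (by positivity)]
    have := ha2 n
    rw [← hrd] at this
    linarith
  have h0mem : (0:ℂ) ∈ Metric.ball (0:ℂ) 1 := by simp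
  have hbd := (dichotomy (U := U) (u := un) (convex_ball (0:ℂ) 1).isPreconnected hloc).resolve_right (by
    intro h
    obtain ⟨ρ, hρ, h⟩ := h 0 h0mem
    have h1 : ∀ᶠ n in (U : Filter ℕ), ‖un n 0‖ < 1 := by
      have := h0lim.norm
      rw [norm_zero] at this
      exact this.eventually_lt_const one_pos
    obtain ⟨n, h2, h3⟩ := ((h 1).and h1).exists
    linarith [(h2 0 (Metric.mem_ball_self hρ)).2])
  obtain ⟨f, hf⟩ := montel (U := U) (F := un) hbd
  have hNC : NC U un f 0 := hf 0 (by rw [Metric.isOpen_ball.interior_eq]; exact h0mem)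
  have hf0 : f 0 = 0 := tendsto_nhds_unique hNC.tendsto_pt h0lim
  have hre : (deriv f 0).re ≤ 0 := by
    by_cases hz : ∀ᶠ w in 𝓝 (0:ℂ), f w = 0
    · have : deriv f 0 = 0 := by
        have e : f =ᶠ[𝓝 0] fun _ => 0 := hz
        rw [e.deriv_eq]; simp
      rw [this]; simp
    · have hw := hurwitz hNC hf0 hz
      have hD := hNC.deriv.tendsto
      have hcl : Tendsto (fun p : ℕ × ℂ => (deriv (un p.1) p.2).re) ((U : Filter ℕ) ×ˢ 𝓝 0) (𝓝 (deriv f 0).re) :=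
        (Complex.continuous_re.tendsto _).comp hD
      by_contra hpos
      push Not at hpos
      have hev := hcl.eventually (lt_mem_nhds hpos)
      obtain ⟨ρ, hρ, hev⟩ := prod_nhds_iff.1 hev
      obtain ⟨n, hn1, w, hw1, hw2⟩ := (hev.and (hw (min ρ 1) (lt_min hρ one_pos))).exists
      have hwb : w ∈ Metric.ball (0:ℂ) 1 := Metric.ball_subset_ball (min_le_right _ _) hw1
      have h1 := hn1 w (Metric.ball_subset_ball (min_le_left _ _) hw1)
      have hd := affine_hasDeriv (hr0 n) (hu _ (himn n w hwb)).1
      have h2 : deriv (un n) w = deriv u (a n + r n * w) := hd.deriv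
      have h3 : u (a n + r n * w) = 0 := by
        have : u (a n + r n * w) / r n = 0 := hw2
        rcases div_eq_zero_iff.1 this with h | h
        · exact h
        · exact absurd h (hrc n)
      have h4 := ((hu _ (himn n w hwb)).2.2 h3).2
      simp only [h2] at h1
      linarith
  -- scaled next functions
  have hP : NC U (fun n ζ => 1 - deriv (un n) ζ) (fun ζ => 1 - deriv f ζ) 0 :=
    (NC.const (c := fun _ => (1:ℂ)) tendsto_const_nhds 0).sub hNC.deriv
  have hP0 : 1 - deriv f 0 ≠ 0 := by
    intro h
    have := congrArg Complex.re h
    simp at this; linarith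
  have hA : NC U (fun n ζ => un n ζ / (1 - deriv (un n) ζ)) (fun ζ => f ζ / (1 - deriv f ζ)) 0 := hNC.div hP hP0
  have hrlim : Tendsto (fun n => d / (r n : ℂ)) (U : Filter ℕ) (𝓝 0) := by
    refine squeeze_zero_norm (a := fun n : ℕ => ‖d‖ * (1 / ((n:ℝ) + 1))) (fun n => ?_) ?_
    · rw [norm_div, Complex.norm_real, Real.norm_of_nonneg (hr0 n).le, div_eq_mul_one_div]
      have := ha1 n
      rw [← hrd] at this
      gcongr
    · have := ((tendsto_one_div_add_atTop_nhds_zero_nat (𝕜 := ℝ)).mono_left hU).const_mul ‖d‖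
      simpa using this
  have hB : NC U (fun n ζ => (un n ζ + d / r n) / (1 - deriv (un n) ζ)) (fun ζ => f ζ / (1 - deriv f ζ)) 0 := by
    have := (hNC.add (NC.const hrlim 0)).div hP hP0
    simpa using this
  let g : ℂ → ℂ := fun ζ => f ζ / (1 - deriv f ζ)
  have hgd : 1 - deriv g 0 ≠ 0 := by
    have h1 : HasDerivAt f (deriv f 0) 0 := hNC.differentiableAt.hasDerivAt
    have h2 : HasDerivAt (fun ζ => 1 - deriv f ζ) (deriv (fun ζ => 1 - deriv f ζ) 0) 0 := hP.differentiableAt.hasDerivAt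
    have h3 := (h1.div h2 hP0).deriv
    have h4 : deriv g 0 = deriv f 0 / (1 - deriv f 0) := by
      show deriv (fun ζ => f ζ / (1 - deriv f ζ)) 0 = _
      have h5 : (fun ζ => f ζ / (1 - deriv f ζ)) = f / fun ζ => 1 - deriv f ζ := rfl
      rw [h5, h3, hf0]
      field_simp
      ring
    rw [h4]
    intro h
    have h5 : 1 - deriv f 0 = deriv f 0 := by
      have := sub_eq_zero.1 h
      rw [eq_div_iff hP0] at this
      linear_combination this
    have := congrArg Complex.re h5
    simp at this; linarith
  have one := NC.const (U := U) (c := fun _ => (1:ℂ)) tendsto_const_nhds 0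
  have hE := (one.sub hA.deriv).div (one.sub hB.deriv) hgd
  have hball : ∀ᶠ p in (U : Filter ℕ) ×ˢ 𝓝 (0:ℂ), p.2 ∈ Metric.ball (0:ℂ) 1 :=
    prod_nhds_iff.2 ⟨1, one_pos, Eventually.of_forall fun n y hy => hy⟩
  have hPd : ∀ n, ∀ ζ ∈ Metric.ball (0:ℂ) 1, deriv (un n) ζ = deriv u (a n + r n * ζ) := fun n ζ hζ =>
    (affine_hasDeriv (hr0 n) (hu _ (himn n ζ hζ)).1).deriv
  have hE2 : NC U (fun n ζ => exp (q (a n + r n * ζ))) (fun _ => 1) 0 := by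
    refine (hE.congr_lim ?_).congr ?_
    · have hgan : AnalyticAt ℂ g 0 := hA.analyticAt
      have : ContinuousAt (fun ζ => 1 - deriv g ζ) 0 := continuousAt_const.sub hgan.deriv.continuousAt
      filter_upwards [this.eventually_ne hgd] with ζ hζ
      exact div_self hζ
    · filter_upwards [hball] with p hp
      obtain ⟨n, ζ⟩ := p
      simp only at hp ⊢
      have hnhd : ∀ᶠ w in 𝓝 ζ, w ∈ Metric.ball (0:ℂ) 1 := Metric.isOpen_ball.mem_nhds hp
      rw [hK _ (himn n ζ hp)]
      have e1 : deriv (fun ζ => un n ζ / (1 - deriv (un n) ζ)) ζ =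
          deriv (fun z => u z / (1 - deriv u z)) (a n + r n * ζ) := by
        rw [← (affine_hasDeriv (hr0 n) (hu1 _ (himn n ζ hp)).1).deriv]
        apply Filter.EventuallyEq.deriv_eq
        filter_upwards [hnhd] with w hw
        rw [hPd n w hw]
        show u (a n + r n * w) / r n / _ = _
        ring
      have e2 : deriv (fun ζ => (un n ζ + d / r n) / (1 - deriv (un n) ζ)) ζ =
          deriv (fun z => (u z + d) / (1 - deriv u z)) (a n + r n * ζ) := by
        rw [← (affine_hasDeriv (hr0 n) (hv1 _ (himn n ζ hp)).1).deriv]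
        apply Filter.EventuallyEq.deriv_eq
        filter_upwards [hnhd] with w hw
        rw [hPd n w hw]
        show (u (a n + r n * w) / r n + d / r n) / _ = _
        ring
      rw [e1, e2]
  have hF := hE2.deriv.div hE2 one_ne_zero
  refine poly_scale_absurd (U := U) (a := a) hr pl.natDegree pl 1 le_rfl ?_ ((hF.congr_lim ?_).congr ?_)
  · rintro rfl
    obtain ⟨z, hz⟩ := hqn
    exact hz (by rw [hpl]; simp)
  · exact Eventually.of_forall fun ζ => by simp
  · refine Eventually.of_forall fun p => ?_
    obtain ⟨n, ζ⟩ := p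
    simp only
    have h2 : HasDerivAt (fun ζ : ℂ => a n + r n * ζ) (r n : ℂ) ζ := by
      refine (((hasDerivAt_id ζ).const_mul (r n : ℂ)).const_add (a n)).congr_deriv ?_
      ring
    have h3 : HasDerivAt (fun ζ => exp (q (a n + r n * ζ))) (exp (q (a n + r n * ζ)) * (deriv q (a n + r n * ζ) * r n)) ζ :=
      ((hq (a n + r n * ζ)).hasDerivAt.comp ζ h2).cexp
    rw [h3.deriv, hpl, pow_one, mul_div_assoc, mul_comm (exp _), div_mul_cancel₀ _ (exp_ne_zero _)]
    ring


lemma strip_bound {u : ℂ → ℂ} {κ : ℝ} (hκ : 0 < κ) (hu : Gd u)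
    (hre : ∀ x : ℝ, (∀ᶠ w in 𝓝 (x:ℂ), DifferentiableAt ℂ (fun w => (u w)⁻¹) w) ∧ ‖(u x)⁻¹‖ ≤ 1 / κ) :
    ∃ σ > 0, ∀ z : ℂ, z.im ≠ 0 → |z.im| < σ → κ / 3 ≤ ‖u z‖ := by
  obtain ⟨δ, hδ, hδ4, H⟩ := near_line
  refine ⟨δ * κ, by positivity, fun z hz hzs => ?_⟩
  refine H u (z.re : ℂ) κ 0 hκ ?_ (by simp) z ?_ hz
  · intro w hw
    refine ⟨fun h => hu w h, fun h => ?_⟩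
    have hwr : w = (w.re : ℂ) := by apply Complex.ext <;> simp [h]
    rw [hwr]; exact hre w.re
  · rw [Metric.mem_ball, dist_eq_norm]
    have : z - (z.re : ℂ) = z.im * I := by
      apply Complex.ext <;> simp
    rw [this, norm_mul, Complex.norm_I, Complex.norm_real, mul_one, Real.norm_eq_abs]
    exact hzs

lemma levels_strip {u : ℂ → ℂ} (hu : Gd u) {σ κ H : ℝ} (hσ : 0 < σ) (hκ : 0 < κ)
    (hstrip : ∀ z : ℂ, z.im ≠ 0 → |z.im| < σ → κ ≤ ‖u z‖) :
    ∃ c > 0, ∀ R ≥ 1, ∃ s ≥ R, s ≤ R + 1 ∧ ∀ z : ℂ, |z.re| = s → z.im ≠ 0 → |z.im| ≤ H → c ≤ ‖u z‖ := by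
  by_contra hcon
  push Not at hcon
  choose R hR1 hbad using fun n : ℕ => hcon (1 / ((n:ℝ) + 1)) (by positivity)
  obtain ⟨U, hU⟩ : ∃ U : Ultrafilter ℕ, (U : Filter ℕ) ≤ atTop := ⟨hyperfilter ℕ, Nat.hyperfilter_le_atTop⟩
  let K : Set ℂ := {z | (|z.re| ≤ 1 ∧ |z.im| ≤ H) ∧ σ / 2 ≤ z.im}
  have hK : IsCompact K := by
    refine Metric.isCompact_of_isClosed_isBounded ?_ ?_
    · have c1 : IsClosed {z : ℂ | |z.re| ≤ 1} := isClosed_le (by fun_prop) continuous_const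
      have c2 : IsClosed {z : ℂ | |z.im| ≤ H} := isClosed_le (by fun_prop) continuous_const
      have c3 : IsClosed {z : ℂ | σ / 2 ≤ z.im} := isClosed_le continuous_const Complex.continuous_im
      exact (c1.inter c2).inter c3
    · refine (Metric.isBounded_closedBall (x := (0:ℂ)) (r := 1 + H)).subset ?_
      intro w hw
      rw [mem_closedBall_zero_iff]
      refine (Complex.norm_le_abs_re_add_abs_im w).trans (add_le_add hw.1.1 hw.1.2)
  have hKp : ∀ z ∈ K, 0 < z.im := fun z hz => by
    have : σ / 2 ≤ z.im := hz.2
    linarith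
  have main : ∀ (w : ℂ → ℂ) (a : ℕ → ℝ), Gd w → (∀ z : ℂ, z.im ≠ 0 → |z.im| < σ → κ ≤ ‖w z‖) →
      ∃ bad : Set ℝ, bad.Finite ∧ ∀ s ∉ bad, ∃ c' > 0, ∀ᶠ n in (U : Filter ℕ), ∀ z ∈ K, z.re = s →
      c' ≤ ‖w (a n + z)‖ := by
    intro w a hw hcw
    have := half_levels (U := U) hw (a := a) (r := fun _ => 1) (fun _ => one_pos) hK hKp (p := (σ / 2 : ℝ) * I)
      (by simp; linarith) hκ (Eventually.of_forall fun n => by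
        have him : ((a n : ℂ) + (σ / 2 : ℝ) * I).im = σ / 2 := by simp
        have := hcw ((a n : ℂ) + (σ / 2 : ℝ) * I) (by rw [him]; positivity)
          (by rw [him, abs_of_pos (by positivity)]; linarith)
        simpa using this) Complex.continuous_re
    simpa using this
  have hneg : ∀ z : ℂ, z.im ≠ 0 → |z.im| < σ → κ ≤ ‖-u (-z)‖ := fun z hz hc => by
    rw [norm_neg]; exact hstrip (-z) (by simpa using hz) (by simpa using hc)
  obtain ⟨b1, hb1, H1⟩ := main u R hu hstrip
  obtain ⟨b2, hb2, H2⟩ := main _ R hu.neg hneg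
  obtain ⟨b3, hb3, H3⟩ := main u (fun n => - R n) hu hstrip
  obtain ⟨b4, hb4, H4⟩ := main _ (fun n => - R n) hu.neg hneg
  obtain ⟨s, hs, hsb⟩ : ∃ s ∈ Set.Icc (0:ℝ) 1, s ∉ (b1 ∪ b2) ∪ (((fun x : ℝ => -x) '' b3) ∪ ((fun x : ℝ => -x) '' b4)) :=
    ((Set.Icc_infinite (by norm_num : (0:ℝ) < 1)).exists_notMem_finite
      ((hb1.union hb2).union ((hb3.image _).union (hb4.image _))))
  obtain ⟨c1, hc1, E1⟩ := H1 s (fun h => hsb (Or.inl (Or.inl h)))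
  obtain ⟨c2, hc2, E2⟩ := H2 s (fun h => hsb (Or.inl (Or.inr h)))
  obtain ⟨c3, hc3, E3⟩ := H3 (-s) (fun h => hsb (Or.inr (Or.inl ⟨-s, h, neg_neg s⟩)))
  obtain ⟨c4, hc4, E4⟩ := H4 (-s) (fun h => hsb (Or.inr (Or.inr ⟨-s, h, neg_neg s⟩)))
  obtain ⟨c, hcd⟩ : ∃ c, c = min κ (min (min c1 c2) (min c3 c4)) := ⟨_, rfl⟩
  have hc0 : 0 < c := by rw [hcd]; exact lt_min hκ (lt_min (lt_min hc1 hc2) (lt_min hc3 hc4))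
  have k0 : c ≤ κ := by rw [hcd]; exact min_le_left _ _
  have k1 : c ≤ c1 := by rw [hcd]; exact (min_le_right _ _).trans ((min_le_left _ _).trans (min_le_left _ _))
  have k2 : c ≤ c2 := by rw [hcd]; exact (min_le_right _ _).trans ((min_le_left _ _).trans (min_le_right _ _))
  have k3 : c ≤ c3 := by rw [hcd]; exact (min_le_right _ _).trans ((min_le_right _ _).trans (min_le_left _ _))
  have k4 : c ≤ c4 := by rw [hcd]; exact (min_le_right _ _).trans ((min_le_right _ _).trans (min_le_right _ _))
  have hlim : ∀ᶠ n : ℕ in (U : Filter ℕ), 1 / ((n:ℝ) + 1) < c :=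
    ((tendsto_one_div_add_atTop_nhds_zero_nat (𝕜 := ℝ)).mono_left hU).eventually_lt_const hc0
  obtain ⟨n, ⟨⟨hn1, hn2⟩, ⟨hn3, hn4⟩⟩, hn5⟩ := (((E1.and E2).and (E3.and E4)).and hlim).exists
  obtain ⟨z, hz1, hz2, hz3, hz4⟩ := hbad n (R n + s) (by linarith [hs.1]) (by linarith [hs.2])
  have hsa : |s| ≤ 1 := abs_le.2 ⟨by linarith [hs.1], hs.2⟩
  have hlow : c ≤ ‖u z‖ := by
    by_cases hA : |z.im| < σ
    · exact k0.trans (hstrip z hz2 hA)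
    push Not at hA
    rcases le_total 0 z.im with hi | hi <;> rcases le_total 0 z.re with hr | hr
    · rw [abs_of_nonneg hi] at hA
      rw [abs_of_nonneg hr] at hz1
      have := hn1 (z - R n) ⟨⟨by simpa [hz1] using hsa, by simpa using hz3⟩, by simp; linarith⟩ (by simp [hz1])
      rw [add_sub_cancel] at this
      exact k1.trans this
    · rw [abs_of_nonneg hi] at hA
      rw [abs_of_nonpos hr] at hz1
      have hz1' : z.re = -(R n + s) := by linarith
      have := hn3 (z + R n) ⟨⟨by simpa [hz1'] using hsa, by simpa using hz3⟩, by simp; linarith⟩ (by simp [hz1'])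
      have e : (((-R n : ℝ) : ℂ) + (z + R n)) = z := by push_cast; ring
      rw [e] at this
      exact k3.trans this
    · rw [abs_of_nonpos hi] at hA
      rw [abs_of_nonneg hr] at hz1
      have := hn4 (-(z - R n)) ⟨⟨by rw [neg_re, abs_neg]; simpa [hz1] using hsa, by rw [neg_im, abs_neg]; simpa using hz3⟩, by simp; linarith⟩ (by simp [hz1])
      have e : -(((-R n : ℝ) : ℂ) + -(z - R n)) = z := by push_cast; ring
      rw [e, norm_neg] at this
      exact k4.trans this
    · rw [abs_of_nonpos hi] at hA
      rw [abs_of_nonpos hr] at hz1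
      have hz1' : z.re = -(R n + s) := by linarith
      have := hn2 (-(z + R n)) ⟨⟨by rw [neg_re, abs_neg]; simpa [hz1'] using hsa, by rw [neg_im, abs_neg]; simpa using hz3⟩, by simp; linarith⟩ (by simp [hz1'])
      have e : -((R n : ℂ) + -(z + R n)) = z := by ring
      rw [e, norm_neg] at this
      exact k2.trans this
  linarith

lemma b2_core {u q Z : ℂ → ℂ} {d : ℂ} {κ : ℝ} (hκ : 0 < κ) (hu : Gd u) (hu1 : Gd (fun z => u z / (1 - deriv u z)))
    (hv1 : Gd (fun z => (u z + d) / (1 - deriv u z))) (hq : Differentiable ℂ q)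
    (hK : ∀ z : ℂ, z.im ≠ 0 → exp (q z) = (1 - deriv (fun z => u z / (1 - deriv u z)) z) /
      (1 - deriv (fun z => (u z + d) / (1 - deriv u z)) z))
    (hqn : ∃ z, deriv q z ≠ 0)
    (hre : ∀ x : ℝ, (∀ᶠ w in 𝓝 (x:ℂ), DifferentiableAt ℂ (fun w => (u w)⁻¹) w) ∧ ‖(u x)⁻¹‖ ≤ 1 / κ)
    (hW : Differentiable ℂ Z)
    (hZ : ∀ z, (z.im ≠ 0 → u z ≠ 0) → HasDerivAt Z (-(u z)⁻¹ * Z z) z) :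
    ∃ p : Polynomial ℂ, ∀ z, Z z = p.eval z := by
  obtain ⟨B', hB', hfar'⟩ := far_lower hu hu1 hv1 hq hK hqn
  obtain ⟨B, hB⟩ : ∃ B : ℕ, max B' 1 ≤ B := exists_nat_ge _
  have hB1 : (1:ℝ) ≤ B := le_trans (le_max_right _ _) hB
  have hBB : B' ≤ (B:ℝ) := le_trans (le_max_left _ _) hB
  have hfar : ∀ z : ℂ, (B:ℝ) ≤ |z.im| → |z.im| ≤ B * ‖u z‖ := fun z hz =>
    (hfar' z (hBB.trans hz)).trans (by gcongr)
  obtain ⟨σ, hσ, hstrip⟩ := strip_bound hκ hu hre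
  obtain ⟨c, hc, hlev⟩ := levels_strip (H := B) hu hσ (by positivity : 0 < κ / 3) hstrip
  obtain ⟨C, hC⟩ : ∃ C : ℕ, max (max (1 / κ) (2 * B)) ((1 + B) / c) ≤ C := exists_nat_ge _
  have hC1 : 1 / κ ≤ C := le_trans (le_trans (le_max_left _ _) (le_max_left _ _)) hC
  have hC2 : 2 * (B:ℝ) ≤ C := le_trans (le_trans (le_max_right _ _) (le_max_left _ _)) hC
  have hC3 : (1 + B) / c ≤ C := le_trans (le_max_right _ _) hC
  have hC0 : (0:ℝ) ≤ C := Nat.cast_nonneg _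
  have farL : ∀ z : ℂ, (B:ℝ) ≤ |z.im| → u z ≠ 0 ∧ ‖(u z)⁻¹‖ * |z.im| ≤ B := by
    intro z hz
    have h1 := hfar z hz
    have h2 : 0 < ‖u z‖ := by
      by_contra h
      have : ‖u z‖ = 0 := le_antisymm (not_lt.1 h) (norm_nonneg _)
      rw [this] at h1; linarith
    refine ⟨norm_pos_iff.1 h2, ?_⟩
    rw [norm_inv, inv_mul_le_iff₀ h2]
    linarith
  refine poly_core (Z := Z) (D := fun z => -(u z)⁻¹) (C := C) (k := B) (N := 0) (A := ‖Z (B * I)‖) (r0 := max B 1) hW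
    (fun z _ => by simp) ?_
  intro r hr
  have hr1 : 1 ≤ r := le_trans (le_max_right _ _) hr
  have hrB : (B:ℝ) ≤ r := le_trans (le_max_left _ _) hr
  obtain ⟨s, hs, hs2, hl⟩ := hlev r hr1
  have hs1 : 1 ≤ s := by linarith
  refine ⟨s, hs, fun z hz => ?_, (s:ℂ) * I, by simp [supn, abs_of_pos (show 0 < s by linarith)]; linarith, ?_⟩
  · have key : (z.im ≠ 0 → u z ≠ 0) ∧ ‖(u z)⁻¹‖ ≤ C / (1 + |z.im|) := by
      have hp : 0 < 1 + |z.im| := by positivity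
      by_cases hb : (B:ℝ) ≤ |z.im|
      · obtain ⟨h1, h2⟩ := farL z hb
        refine ⟨fun _ => h1, ?_⟩
        rw [le_div_iff₀ hp]
        have := norm_nonneg (u z)⁻¹
        nlinarith
      · push Not at hb
        by_cases h0 : z.im = 0
        · refine ⟨fun h => absurd h0 h, ?_⟩
          have hzr : z = (z.re : ℂ) := by apply Complex.ext <;> simp [h0]
          rw [h0, abs_zero, add_zero, div_one]
          refine le_trans ?_ hC1
          rw [hzr]; exact (hre z.re).2
        · have hzr : |z.re| = s := by
            have : max |z.re| |z.im| = s := hz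
            rcases max_choice |z.re| |z.im| with h3 | h3 <;> linarith
          have h1 := hl z hzr h0 hb.le
          have hpos : 0 < ‖u z‖ := by linarith
          refine ⟨fun _ => norm_pos_iff.1 hpos, ?_⟩
          rw [norm_inv, inv_eq_one_div, div_le_div_iff₀ hpos hp]
          rw [div_le_iff₀ hc] at hC3
          nlinarith
    refine ⟨hZ z key.1, ?_⟩
    simp only [norm_neg]; exact key.2
  · have hpos : 0 < s := by linarith
    have hBp : (0:ℝ) < B := by linarith
    have hb : Real.log B ≤ Real.log s := Real.log_le_log hBp (by linarith)
    have hex : ∀ t ∈ Set.Icc (Real.log B) (Real.log s), (B:ℝ) ≤ |(((Real.exp t : ℝ) : ℂ) * I).im| := by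
      intro t ht
      have : (((Real.exp t : ℝ) : ℂ) * I).im = Real.exp t := by
        rw [Complex.im_ofReal_mul, I_im, mul_one]
      rw [this, abs_of_pos (Real.exp_pos t)]
      calc (B:ℝ) = Real.exp (Real.log B) := (Real.exp_log hBp).symm
        _ ≤ _ := Real.exp_le_exp.2 ht.1
    have k1 := path_bound (Z := Z) (D := fun z => -(u z)⁻¹) (γ := fun t => ((Real.exp t : ℝ) : ℂ) * I)
      (γ' := fun t => ((Real.exp t : ℝ) : ℂ) * I) (K := B) hb
      (fun t _ => (Real.hasDerivAt_exp t).ofReal_comp.mul_const I) (fun t ht => by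
        exact hZ _ (fun _ => (farL _ (hex t ht)).1))
      (fun t ht => by
        have := (farL _ (hex t ht)).2
        have e : (((Real.exp t : ℝ) : ℂ) * I).im = Real.exp t := by
          rw [Complex.im_ofReal_mul, I_im, mul_one]
        have e2 : ‖((Real.exp t : ℝ) : ℂ) * I‖ = |Real.exp t| := by
          rw [norm_mul, Complex.norm_I, mul_one, Complex.norm_real, Real.norm_eq_abs]
        rw [norm_neg, e2]
        rwa [e] at this)
    simp only [Real.exp_log hpos, Real.exp_log hBp] at k1
    refine k1.trans ?_
    have h3 : Real.exp (B * (Real.log s - Real.log B)) ≤ s ^ B := by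
      have h4 : s ^ B = Real.exp (B * Real.log s) := by
        rw [mul_comm (B:ℝ), Real.exp_mul, Real.exp_log hpos, Real.rpow_natCast]
      rw [h4]
      apply Real.exp_le_exp.2
      have := Real.log_nonneg hB1
      nlinarith
    have e : ((B:ℝ):ℂ) = (B:ℂ) := by simp
    rw [e]
    gcongr


noncomputable def Tq (K : ℂ → ℂ) (z : ℂ) : ℂ :=
  deriv (deriv (deriv K)) z * (K z - 1) ^ 2 - 6 * (deriv K z * deriv (deriv K) z * (K z - 1)) + 6 * deriv K z ^ 3

lemma zalcman_exp {K : ℂ → ℂ} (hK : Differentiable ℂ K) (h0 : ∀ z, K z ≠ 0) (hn : ∃ z, deriv K z ≠ 0) :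
    ∃ (U : Ultrafilter ℕ) (y : ℕ → ℂ) (l : ℕ → ℝ) (a b : ℂ), (∀ n, 0 < l n) ∧ a ≠ 0 ∧
      ∀ z, NC U (fun n ζ => K (y n + ζ / l n)) (fun ζ => exp (a * ζ + b)) z := by
  have hdc : Differentiable ℂ (deriv K) := fun z =>
    (hK.differentiableOn.deriv isOpen_univ).differentiableAt Filter.univ_mem
  obtain ⟨M, hM⟩ : ∃ M : ℂ → ℝ, ∀ z, M z = ‖deriv K z‖ / (1 + ‖K z‖ ^ 2) := ⟨_, fun _ => rfl⟩
  have hp : ∀ z, 0 < 1 + ‖K z‖ ^ 2 := fun z => by positivity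
  have hMc : Continuous M := by
    have : M = fun z => ‖deriv K z‖ / (1 + ‖K z‖ ^ 2) := funext hM
    rw [this]
    exact hdc.continuous.norm.div (continuous_const.add (hK.continuous.norm.pow 2)) (fun z => (hp z).ne')
  have hM0 : ∀ z, 0 ≤ M z := fun z => by rw [hM]; have := hp z; positivity
  have lin : ∀ f : ℂ → ℂ, Differentiable ℂ f → (∀ z, f z ≠ 0) → (∃ z, deriv f z ≠ 0) →
      ∀ C > 0, (∀ z, ‖deriv f z‖ ≤ C * (1 + ‖f z‖ ^ 2)) → ∃ a b : ℂ, a ≠ 0 ∧ ∀ z, f z = exp (a * z + b) := by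
    intro f hf hf0 hfn C hC hb
    obtain ⟨A, hA, hgr⟩ := clunie_hayman hf hC hb
    obtain ⟨a, b, hab⟩ := exp_linear hf hf0 hA (fun z => by
      refine le_trans (Real.log_le_log (norm_pos_iff.2 (hf0 z)) ?_) (hgr z)
      linarith)
    refine ⟨a, b, ?_, hab⟩
    rintro rfl
    obtain ⟨z, hz⟩ := hfn
    apply hz
    have : f = fun _ => exp (0 * 0 + b) := by funext w; rw [hab w]; simp
    rw [this]; simp
  by_cases hbd : ∃ C, ∀ z, M z ≤ C
  · obtain ⟨C, hC⟩ := hbd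
    obtain ⟨a, b, ha, hab⟩ := lin K hK h0 hn (max C 1) (by positivity) (fun z => by
      have := (hC z).trans (le_max_left C 1)
      rwa [hM, div_le_iff₀ (hp z)] at this)
    refine ⟨hyperfilter ℕ, fun _ => 0, fun _ => 1, a, b, fun _ => one_pos, ha, fun z => ?_⟩
    have e : (fun (_ : ℕ) (ζ : ℂ) => K (0 + ζ / ((1:ℝ):ℂ))) = fun _ ζ => exp (a * ζ + b) := by
      funext n ζ; simp [hab]
    rw [e]
    refine ⟨Eventually.of_forall fun p => by fun_prop, Eventually.of_forall fun y => ?_⟩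
    have hc : Continuous fun ζ : ℂ => exp (a * ζ + b) := by fun_prop
    exact (hc.tendsto y).comp tendsto_snd
  push Not at hbd
  choose a ha using fun n : ℕ => hbd ((n:ℝ) + 1)
  have hbnd : ∀ n, ∃ B, ∀ z ∈ Metric.ball (a n) 1, M z ≤ B := by
    intro n
    obtain ⟨B, hB⟩ := (isCompact_closedBall (a n) 1).bddAbove_image hMc.continuousOn
    exact ⟨B, fun z hz => hB ⟨z, Metric.ball_subset_closedBall hz, rfl⟩⟩
  choose B hB using hbnd
  choose y hy ρ hρ hρe h1 h2 h3 using fun n => doubling one_pos hM0 (hB n) (lt_trans (by positivity) (ha n))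
  obtain ⟨U, hU⟩ : ∃ U : Ultrafilter ℕ, (U : Filter ℕ) ≤ atTop := ⟨hyperfilter ℕ, Nat.hyperfilter_le_atTop⟩
  obtain ⟨l, hl⟩ : ∃ l : ℕ → ℝ, ∀ n, l n = M (y n) := ⟨_, fun _ => rfl⟩
  have hl0 : ∀ n, 0 < l n := fun n => by rw [hl]; exact h2 n
  have hlc : ∀ n, (l n : ℂ) ≠ 0 := fun n => by exact_mod_cast (hl0 n).ne'
  let Kn : ℕ → ℂ → ℂ := fun n ζ => K (y n + ζ / l n)
  have hKd : ∀ n ζ, HasDerivAt (Kn n) (deriv K (y n + ζ / l n) / l n) ζ := by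
    intro n ζ
    have h1 : HasDerivAt (fun ζ : ℂ => y n + ζ / l n) (1 / (l n:ℂ)) ζ :=
      ((hasDerivAt_id ζ).div_const (l n:ℂ)).const_add (y n)
    refine ((hK _).hasDerivAt.comp ζ h1).congr_deriv ?_
    ring
  have hsph : ∀ n : ℕ, ∀ ζ ∈ Metric.ball (0:ℂ) (((n:ℝ)+1)/4), ‖deriv (Kn n) ζ‖ ≤ 4 * (1 + ‖Kn n ζ‖ ^ 2) := by
    intro n ζ hζ
    rw [(hKd n ζ).deriv, norm_div, Complex.norm_real, Real.norm_of_nonneg (hl0 n).le, div_le_iff₀ (hl0 n)]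
    have hin : y n + ζ / l n ∈ Metric.ball (y n) (ρ n / 2) := by
      apply scale_mem (hl0 n)
      rw [mem_ball_zero_iff] at hζ ⊢
      have h4 := h1 n
      have h5 := ha n
      rw [← hl] at h4
      nlinarith
    have h6 := h3 n _ hin
    rw [hM, div_le_iff₀ (hp _), ← hl] at h6
    show _ ≤ 4 * (1 + ‖K (y n + ζ / l n)‖ ^ 2) * l n
    linarith
  have hsph0 : ∀ n, ‖deriv (Kn n) 0‖ = 1 + ‖Kn n 0‖ ^ 2 := by
    intro n
    rw [(hKd n 0).deriv, norm_div, Complex.norm_real, Real.norm_of_nonneg (hl0 n).le, div_eq_iff (hl0 n).ne', hl, hM]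
    have e : Kn n 0 = K (y n) := by show K (y n + 0 / l n) = _; simp
    rw [e]
    have := (hp (y n)).ne'
    have e2 : y n + 0 / (l n : ℂ) = y n := by simp
    have e3 : y n + 0 / ((‖deriv K (y n)‖ / (1 + ‖K (y n)‖ ^ 2) : ℝ) : ℂ) = y n := by simp
    first
      | rw [e2]; field_simp
      | rw [e3]; field_simp
  have hev : ∀ q : ℂ, ∀ᶠ n : ℕ in (U : Filter ℕ), ∀ z ∈ Metric.ball q 1, z ∈ Metric.ball (0:ℂ) (((n:ℝ)+1)/4) := by
    intro q
    have ht : Tendsto (fun n : ℕ => ((n:ℝ)+1)/4) (U : Filter ℕ) atTop :=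
      ((tendsto_natCast_atTop_atTop.atTop_add tendsto_const_nhds).atTop_div_const (by norm_num)).mono_left hU
    filter_upwards [ht.eventually (eventually_ge_atTop (‖q‖ + 1))] with n hn z hz
    rw [Metric.mem_ball, dist_eq_norm] at hz
    rw [mem_ball_zero_iff]
    have := norm_add_le (z - q) q
    rw [sub_add_cancel] at this; linarith
  have hKn0 : ∀ n ζ, Kn n ζ ≠ 0 := fun n ζ => h0 _
  rcases dichotomy (U := U) (u := Kn) (Ω := Set.univ) isPreconnected_univ (fun q _ =>
    ⟨1, one_pos, 4, by norm_num, (hev q).mono fun n hn z hz => ⟨(hKd n z).differentiableAt, hsph n z (hn z hz)⟩⟩) with hA | hA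
  · obtain ⟨f, hf⟩ := montel hA
    have hf' : ∀ z, NC U Kn f z := fun z => hf z (by simp)
    have hfd : Differentiable ℂ f := fun z => (hf' z).differentiableAt
    have hdf0 : 1 ≤ ‖deriv f 0‖ := by
      refine ge_of_tendsto (hf' 0).deriv.tendsto_pt.norm (Eventually.of_forall fun n => ?_)
      rw [hsph0 n]; nlinarith [sq_nonneg ‖Kn n 0‖]
    have hdfn : deriv f 0 ≠ 0 := norm_pos_iff.1 (by linarith)
    have hf0 : ∀ z, f z ≠ 0 := by
      intro z hz
      have hne : ¬ ∀ᶠ w in 𝓝 z, f w = 0 := by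
        intro h
        have han : AnalyticOnNhd ℂ f Set.univ := fun w _ => (hf' w).analyticAt
        have h4 := han.eqOn_zero_of_preconnected_of_eventuallyEq_zero isPreconnected_univ (Set.mem_univ z) h
        have h5 : f = fun _ => 0 := by funext w; exact h4 (Set.mem_univ w)
        rw [h5] at hdfn; simp at hdfn
      obtain ⟨n, w, -, hw⟩ := (hurwitz (hf' z) hz hne 1 one_pos).exists
      exact hKn0 n w hw
    obtain ⟨α, β, hα, hab⟩ := lin f hfd hf0 ⟨0, hdfn⟩ 4 (by norm_num) (fun z => by
      refine le_of_tendsto_of_tendsto (hf' z).deriv.tendsto_pt.norm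
        (((hf' z).tendsto_pt.norm.pow 2).const_add 1 |>.const_mul 4) ?_
      filter_upwards [hev z] with n hn
      exact hsph n z (hn z (Metric.mem_ball_self one_pos)))
    refine ⟨U, y, l, α, β, hl0, hα, fun z => ?_⟩
    have : f = fun ζ => exp (α * ζ + β) := funext hab
    rw [← this]; exact hf' z
  · exfalso
    have hbb : ∀ q ∈ (Set.univ : Set ℂ), ∃ r > 0, ∃ M : ℝ, ∀ᶠ n in (U : Filter ℕ), ∀ z ∈ Metric.ball q r,
        DifferentiableAt ℂ (fun z => (Kn n z)⁻¹) z ∧ ‖(Kn n z)⁻¹‖ ≤ M := by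
      intro q hq
      obtain ⟨r, hr, h⟩ := hA q hq
      refine ⟨r, hr, 1, (h 1).mono fun n hn z hz => ⟨(hn z hz).1.inv (hKn0 n z), ?_⟩⟩
      rw [norm_inv]; exact inv_le_one_of_one_le₀ (hn z hz).2
    obtain ⟨f, hf⟩ := montel (F := fun n z => (Kn n z)⁻¹) hbb
    have hf' : ∀ z, NC U (fun n z => (Kn n z)⁻¹) f z := fun z => hf z (by simp)
    have hfz : ∀ z, f z = 0 := by
      intro z
      obtain ⟨r, hr, h⟩ := hA z (Set.mem_univ z)
      have h4 := (hf' z).tendsto_pt.norm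
      have h5 : ∀ ε > 0, ‖f z‖ ≤ ε := by
        intro ε hε
        refine le_of_tendsto h4 ((h (1 / ε)).mono fun n hn => ?_)
        rw [norm_inv]
        have := (hn z (Metric.mem_ball_self hr)).2
        rw [inv_le_comm₀ (norm_pos_iff.2 (hKn0 n z)) hε, ← one_div]
        exact this
      exact norm_le_zero_iff.1 (le_of_forall_pos_le_add fun ε hε => by rw [zero_add]; exact h5 ε hε)
    have hf0 : f = fun _ => 0 := funext hfz
    have h6 := (hf' 0).deriv.tendsto_pt.norm
    rw [hf0] at h6
    simp only [deriv_const, norm_zero] at h6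
    obtain ⟨n, hn⟩ := (h6.eventually (gt_mem_nhds one_pos)).exists
    have h7 : deriv (fun w => (Kn n w)⁻¹) 0 = - deriv (Kn n) 0 / (Kn n 0)^2 :=
      ((hKd n 0).differentiableAt.hasDerivAt.inv (hKn0 n 0)).deriv
    rw [h7, norm_div, norm_neg, norm_pow, hsph0 n, div_lt_one (by have := norm_pos_iff.2 (hKn0 n 0); positivity)] at hn
    linarith

lemma a_core {K : ℂ → ℂ} (hK : Differentiable ℂ K) (h0 : ∀ z, K z ≠ 0) (hn : ∃ z, deriv K z ≠ 0)
    (hr : ∀ x : ℝ, ‖K x‖ = 1) (hT : ∀ z : ℂ, z.im ≠ 0 → K z ≠ 1 → Tq K z ≠ 0) : False := by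
  obtain ⟨U, y, l, a, b, hl, ha, hN⟩ := zalcman_exp hK h0 hn
  have hlc : ∀ n, (l n : ℂ) ≠ 0 := fun n => by exact_mod_cast (hl n).ne'
  obtain ⟨t, ht⟩ : ∃ t : ℝ, t = -2 + Real.sqrt 3 := ⟨_, rfl⟩
  have h3 : Real.sqrt 3 ^ 2 = 3 := Real.sq_sqrt (by norm_num)
  have h3p : 0 < Real.sqrt 3 := Real.sqrt_pos.2 (by norm_num)
  have hs1 : 1 < Real.sqrt 3 := by nlinarith
  have hs2 : Real.sqrt 3 < 2 := by nlinarith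
  have ht0 : t ≠ 0 := by rw [ht]; linarith
  have htq : t ^ 2 + 4 * t + 1 = 0 := by rw [ht]; nlinarith
  have htn : |t| < 1 := by rw [ht, abs_lt]; constructor <;> linarith
  obtain ⟨z0, hz0⟩ : ∃ z0 : ℂ, exp (a * z0 + b) = t := by
    refine ⟨(Complex.log t - b) / a, ?_⟩
    rw [mul_div_cancel₀ _ ha, sub_add_cancel, Complex.exp_log (by exact_mod_cast ht0)]
  let h : ℂ → ℂ := fun ζ => exp (a * ζ + b)
  have hlin : ∀ z, HasDerivAt (fun ζ => a * ζ + b) a z := fun z => by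
    refine (((hasDerivAt_id z).const_mul a).add_const b).congr_deriv ?_
    ring
  have hd1 : deriv h = fun z => a * h z := by
    funext z
    have := ((hlin z).cexp).deriv
    show deriv (fun ζ => exp (a * ζ + b)) z = a * exp (a * z + b)
    rw [this]; ring
  have hh : Differentiable ℂ h := fun z => ((hlin z).cexp).differentiableAt
  have hd2 : deriv (deriv h) = fun z => a ^ 2 * h z := by
    rw [hd1]; funext z
    rw [deriv_const_mul_field, hd1]; ring
  have hd3 : deriv (deriv (deriv h)) = fun z => a ^ 3 * h z := by
    rw [hd2]; funext z
    rw [deriv_const_mul_field, hd1]; ring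
  have hTh : Tq h = fun z => a ^ 3 * h z * (h z ^ 2 + 4 * h z + 1) := by
    funext z
    unfold Tq
    rw [hd3, hd2, hd1]; ring
  let Kn : ℕ → ℂ → ℂ := fun n ζ => K (y n + ζ / l n)
  have hNh : NC U Kn h z0 := hN z0
  have c6 : NC U (fun _ _ => (6:ℂ)) (fun _ => 6) z0 := NC.const tendsto_const_nhds z0
  have c1 : NC U (fun _ _ => (1:ℂ)) (fun _ => 1) z0 := NC.const tendsto_const_nhds z0
  have hm := hNh.sub c1
  have hNT : NC U (fun n => Tq (Kn n)) (Tq h) z0 := by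
    have k1 := (hNh.deriv.deriv.deriv.mul (hm.mul hm)).sub (c6.mul ((hNh.deriv.mul hNh.deriv.deriv).mul hm))
    have k2 := k1.add (c6.mul (hNh.deriv.mul (hNh.deriv.mul hNh.deriv)))
    refine (k2.congr_lim (Eventually.of_forall fun z => ?_)).congr (Eventually.of_forall fun p => ?_)
    · simp only [Tq]; ring
    · simp only [Tq]; ring
  have hz0h : h z0 = t := hz0
  have htqc : (t:ℂ) ^ 2 + 4 * t + 1 = 0 := by exact_mod_cast htq
  have hT0 : Tq h z0 = 0 := by rw [hTh]; simp only [hz0h, htqc, mul_zero]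
  have hTne : ¬ ∀ᶠ w in 𝓝 z0, Tq h w = 0 := by
    intro hev
    have e : Tq h =ᶠ[𝓝 z0] fun _ => 0 := hev
    have h5 : deriv (Tq h) z0 = 0 := by rw [e.deriv_eq]; simp
    have hhd : HasDerivAt h (a * h z0) z0 := by
      have := (hh z0).hasDerivAt
      rwa [hd1] at this
    have h6 : HasDerivAt (Tq h) (a ^ 3 * (a * h z0) * (h z0 ^ 2 + 4 * h z0 + 1) +
        a ^ 3 * h z0 * (2 * h z0 * (a * h z0) + 4 * (a * h z0))) z0 := by
      rw [hTh]
      have k1 := ((hhd.pow 2).add (hhd.const_mul 4)).add_const 1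
      refine ((hhd.const_mul (a ^ 3)).mul k1).congr_deriv ?_
      simp
    rw [h6.deriv, hz0h, htqc] at h5
    have h7 : a ^ 4 * (t:ℂ) ^ 2 * (2 * (t + 2)) = 0 := by linear_combination h5
    have h8 : (t:ℂ) + 2 ≠ 0 := by
      have : t + 2 ≠ 0 := by rw [ht]; linarith
      exact_mod_cast this
    have h9 : (t:ℂ) ≠ 0 := by exact_mod_cast ht0
    have : a ^ 4 * (t:ℂ) ^ 2 * (2 * (t + 2)) ≠ 0 := mul_ne_zero (mul_ne_zero (pow_ne_zero _ ha) (pow_ne_zero _ h9)) (mul_ne_zero two_ne_zero h8)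
    exact this h7
  have hclose : ∀ᶠ p in (U : Filter ℕ) ×ˢ 𝓝 z0, ‖Kn p.1 p.2‖ < 1 := by
    have := hNh.tendsto.norm
    refine this.eventually (gt_mem_nhds ?_)
    rw [hz0h, Complex.norm_real]; exact htn
  obtain ⟨ρ, hρ, hclose⟩ := prod_nhds_iff.1 hclose
  obtain ⟨n, hn1, w, hw1, hw2⟩ := (hclose.and (hurwitz hNT hT0 hTne ρ hρ)).exists
  have hlt : ‖K (y n + w / l n)‖ < 1 := hn1 w hw1
  have hdiff : ∀ G : ℂ → ℂ, Differentiable ℂ G → ∀ c : ℂ, deriv (fun ζ => c * G (y n + ζ / l n)) =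
      fun ζ => (c / l n) * deriv G (y n + ζ / l n) := by
    intro G hG c
    funext ζ
    have h1 : HasDerivAt (fun ζ : ℂ => y n + ζ / l n) (1 / (l n:ℂ)) ζ :=
      ((hasDerivAt_id ζ).div_const (l n:ℂ)).const_add (y n)
    have h2 := ((hG _).hasDerivAt.comp ζ h1).const_mul c
    have h3 : deriv (fun ζ => c * G (y n + ζ / l n)) ζ = c * (deriv G (y n + ζ / l n) * (1 / l n)) := h2.deriv
    rw [h3]; ring
  have hdc : Differentiable ℂ (deriv K) := fun z =>
    (hK.differentiableOn.deriv isOpen_univ).differentiableAt Filter.univ_mem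
  have hdcc : Differentiable ℂ (deriv (deriv K)) := fun z =>
    (hdc.differentiableOn.deriv isOpen_univ).differentiableAt Filter.univ_mem
  have e0 : Kn n = fun ζ => 1 * K (y n + ζ / l n) := by funext ζ; simp [Kn]
  have e1 : deriv (Kn n) = fun ζ => (1 / l n) * deriv K (y n + ζ / l n) := by rw [e0, hdiff K hK]
  have e2 : deriv (deriv (Kn n)) = fun ζ => (1 / l n / l n) * deriv (deriv K) (y n + ζ / l n) := by rw [e1, hdiff _ hdc]
  have e3 : deriv (deriv (deriv (Kn n))) = fun ζ => (1 / l n / l n / l n) * deriv (deriv (deriv K)) (y n + ζ / l n) := by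
    rw [e2, hdiff _ hdcc]
  have eT : Tq (Kn n) w = (1 / l n) ^ 3 * Tq K (y n + w / l n) := by
    unfold Tq
    rw [e3, e2, e1]
    show _ * (K (y n + w / l n) - 1) ^ 2 - 6 * (_ * _ * (K (y n + w / l n) - 1)) + _ = _
    ring
  rw [eT] at hw2
  have hT2 : Tq K (y n + w / l n) = 0 := by
    rcases mul_eq_zero.1 hw2 with h | h
    · exact absurd h (pow_ne_zero _ (one_div_ne_zero (hlc n)))
    · exact h
  refine hT _ ?_ ?_ hT2
  · intro him
    have : y n + w / l n = ((y n + w / l n).re : ℂ) := by apply Complex.ext <;> simp [him]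
    rw [this, hr] at hlt
    exact lt_irrefl _ hlt
  · intro h1
    rw [h1, norm_one] at hlt
    exact lt_irrefl _ hlt


theorem meroOrder_eq (h : ℂ → ℂ) (z : ℂ) : meroOrder h z = meromorphicOrderAt h z := by
  unfold meroOrder
  split_ifs with hh
  · rfl
  · rw [meromorphicOrderAt_of_not_meromorphicAt hh]

theorem MeroEq.refl (h : ℂ → ℂ) : MeroEq h h := fun _ => Eventually.of_forall fun _ => rfl
theorem MeroEq.symm {h k : ℂ → ℂ} (H : MeroEq h k) : MeroEq k h := fun z => (H z).mono fun _ => Eq.symm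
theorem MeroEq.trans {h k l : ℂ → ℂ} (H : MeroEq h k) (H' : MeroEq k l) : MeroEq h l := fun z => by
  filter_upwards [H z, H' z] with w h1 h2 using h1.trans h2
theorem MeroEq.deriv {h k : ℂ → ℂ} (H : MeroEq h k) : MeroEq (deriv h) (deriv k) := fun z =>
  Filter.EventuallyEq.nhdsNE_deriv (H z)
theorem MeroEq.order {h k : ℂ → ℂ} (H : MeroEq h k) (z : ℂ) :
    meromorphicOrderAt h z = meromorphicOrderAt k z := meromorphicOrderAt_congr (H z)
theorem MeroEq.mer {h k : ℂ → ℂ} (H : MeroEq h k) (hh : ∀ z, MeromorphicAt h z) :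
    ∀ z, MeromorphicAt k z := fun z => (hh z).congr (H z)

theorem MeroEq.eq_at {h k : ℂ → ℂ} (H : MeroEq h k) {z : ℂ} (hh : ContinuousAt h z)
    (hk : ContinuousAt k z) : h =ᶠ[𝓝 z] k :=
  (ContinuousAt.eventuallyEq_nhds_iff_eventuallyEq_nhdsNE hh hk).1 (H z)

theorem analytic_ne {h : ℂ → ℂ} (hh : ∀ z, MeromorphicAt h z) (z : ℂ) :
    ∀ᶠ w in 𝓝[≠] z, AnalyticAt ℂ h w := (hh z).eventually_analyticAt

/-- normal form on the plane -/
noncomputable def nf (h : ℂ → ℂ) : ℂ → ℂ := toMeromorphicNFOn h Set.univ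

theorem nf_eq {h : ℂ → ℂ} (hh : ∀ z, MeromorphicAt h z) : MeroEq (nf h) h := fun z =>
  MeromorphicOn.toMeromorphicNFOn_eq_self_on_nhdsNE (fun z _ => hh z) (Set.mem_univ z)

theorem nf_nf (h : ℂ → ℂ) (z : ℂ) : MeromorphicNFAt (nf h) z :=
  meromorphicNFOn_toMeromorphicNFOn h Set.univ (Set.mem_univ z)

theorem nf_mer (h : ℂ → ℂ) (z : ℂ) : MeromorphicAt (nf h) z := (nf_nf h z).meromorphicAt

theorem nf_order {h : ℂ → ℂ} (hh : ∀ z, MeromorphicAt h z) (z : ℂ) :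
    meromorphicOrderAt (nf h) z = meromorphicOrderAt h z := (nf_eq hh).order z

theorem nf_an {h : ℂ → ℂ} (hh : ∀ z, MeromorphicAt h z) {z : ℂ} (hz : 0 ≤ meromorphicOrderAt h z) :
    AnalyticAt ℂ (nf h) z :=
  (nf_nf h z).meromorphicOrderAt_nonneg_iff_analyticAt.1 (by rwa [nf_order hh])

theorem ne_top_all {h : ℂ → ℂ} (hh : ∀ z, MeromorphicAt h z) {z : ℂ}
    (hz : meromorphicOrderAt h z ≠ ⊤) (w : ℂ) : meromorphicOrderAt h w ≠ ⊤ :=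
  MeromorphicOn.meromorphicOrderAt_ne_top_of_isPreconnected (U := Set.univ) (fun z _ => hh z)
    isPreconnected_univ (Set.mem_univ z) (Set.mem_univ w) hz

theorem ne_ev {h : ℂ → ℂ} (hh : ∀ z, MeromorphicAt h z) {z : ℂ}
    (hz : meromorphicOrderAt h z ≠ ⊤) : ∀ᶠ w in 𝓝[≠] z, h w ≠ 0 :=
  (meromorphicOrderAt_ne_top_iff_eventually_ne_zero (hh z)).1 hz

theorem mero_zero {h : ℂ → ℂ} (hh : ∀ z, MeromorphicAt h z) {z : ℂ}
    (hz : meromorphicOrderAt h z = ⊤) : MeroEq h (fun _ => 0) := fun w => by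
  have : meromorphicOrderAt h w = ⊤ := by
    by_contra H
    exact ne_top_all hh H z hz
  exact meromorphicOrderAt_eq_top_iff.1 this

theorem mero_const {h : ℂ → ℂ} (hh : ∀ z, MeromorphicAt h z) (hd : MeroEq (deriv h) (fun _ => 0)) :
    ∃ d : ℂ, MeroEq h (fun _ => d) := by
  have hn : ∀ z, 0 ≤ meromorphicOrderAt h z := by
    intro z
    by_contra H
    push Not at H
    have h1 : meromorphicOrderAt h z ≠ ⊤ := ne_top_of_lt H
    lift meromorphicOrderAt h z to ℤ using h1 with n hn
    have h2 : n < 0 := by exact_mod_cast H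
    have h3 := meromorphicOrderAt_deriv_eq_sub_one (f := h) (x := z) (n := n)
      (by exact_mod_cast h2.ne) hn.symm
    have h4 : meromorphicOrderAt (deriv h) z = ⊤ := meromorphicOrderAt_eq_top_iff.2 (hd z)
    rw [h4] at h3
    exact WithTop.top_ne_coe h3
  have ha : ∀ z, AnalyticAt ℂ (nf h) z := fun z => nf_an hh (hn z)
  have hdn : ∀ z, deriv (nf h) z = 0 := fun z =>
    ((((nf_eq hh).deriv.trans hd).eq_at (ha z).deriv.continuousAt continuousAt_const)).self_of_nhds
  refine ⟨nf h 0, (nf_eq hh).symm.trans fun z => Eventually.of_forall fun w => ?_⟩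
  exact is_const_of_deriv_eq_zero (fun z => (ha z).differentiableAt) hdn w 0

/- mtilde -/
theorem mtilde_mtilde (h : ℂ → ℂ) : mtilde (mtilde h) = h := by
  funext z; simp [mtilde]

theorem mtilde_deriv (h : ℂ → ℂ) : deriv (mtilde h) = mtilde (deriv h) := by
  exact deriv_conj_conj (f := h)

theorem mtilde_iter (h : ℂ → ℂ) (n : ℕ) : iteratedDeriv n (mtilde h) = mtilde (iteratedDeriv n h) := by
  induction n with
  | zero => simp
  | succ n ih => rw [iteratedDeriv_succ, iteratedDeriv_succ, ih, mtilde_deriv]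

theorem conj_tendsto_ne (z : ℂ) :
    Tendsto (starRingEnd ℂ) (𝓝[≠] z) (𝓝[≠] ((starRingEnd ℂ) z)) := by
  refine tendsto_nhdsWithin_iff.2 ⟨?_, ?_⟩
  · exact (Complex.continuous_conj.tendsto z).mono_left nhdsWithin_le_nhds
  · filter_upwards [self_mem_nhdsWithin] with w hw h
    exact hw ((starRingEnd ℂ).injective h)

theorem MeroEq.tilde {h k : ℂ → ℂ} (H : MeroEq h k) : MeroEq (mtilde h) (mtilde k) := fun z => by
  filter_upwards [(conj_tendsto_ne z).eventually (H _)] with w hw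
  simp [mtilde, hw]

theorem mtilde_an {h : ℂ → ℂ} {z : ℂ} (hh : AnalyticAt ℂ h ((starRingEnd ℂ) z)) :
    AnalyticAt ℂ (mtilde h) z := by
  rw [Complex.analyticAt_iff_eventually_differentiableAt] at hh ⊢
  filter_upwards [(Complex.continuous_conj.tendsto z).eventually hh] with w hw
  have := DifferentiableAt.conj_conj hw
  simpa [mtilde, Function.comp_def] using! this

theorem mtilde_order {h : ℂ → ℂ} {z : ℂ} {n : ℤ} (hh : MeromorphicAt h ((starRingEnd ℂ) z))
    (hn : meromorphicOrderAt h ((starRingEnd ℂ) z) = n) :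
    MeromorphicAt (mtilde h) z ∧ meromorphicOrderAt (mtilde h) z = n := by
  obtain ⟨g, hg, hg0, hgh⟩ := (meromorphicOrderAt_eq_int_iff hh).1 hn
  have h1 : ∀ᶠ w in 𝓝[≠] z, mtilde h w = (w - z) ^ n • mtilde g w := by
    filter_upwards [(conj_tendsto_ne z).eventually hgh] with w hw
    simp [mtilde, hw]
  have h2 : MeromorphicAt (mtilde h) z := by
    refine MeromorphicAt.congr (f := fun w => (w - z) ^ n • mtilde g w) ?_ (h1.mono fun _ => Eq.symm)
    have := (mtilde_an hg).meromorphicAt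
    fun_prop
  refine ⟨h2, (meromorphicOrderAt_eq_int_iff h2).2 ⟨mtilde g, mtilde_an hg, ?_, h1⟩⟩
  simpa [mtilde] using hg0

theorem mtilde_mer {h : ℂ → ℂ} (hh : ∀ z, MeromorphicAt h z) : ∀ z, MeromorphicAt (mtilde h) z := by
  intro z
  by_cases H : meromorphicOrderAt h ((starRingEnd ℂ) z) = ⊤
  · have h1 := meromorphicOrderAt_eq_top_iff.1 H
    refine MeromorphicAt.congr (f := fun _ => (0:ℂ)) (by fun_prop) ?_
    filter_upwards [(conj_tendsto_ne z).eventually h1] with w hw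
    simp [mtilde, hw]
  · lift meromorphicOrderAt h ((starRingEnd ℂ) z) to ℤ using H with n hn
    exact (mtilde_order (hh _) hn.symm).1

theorem mtilde_ord {h : ℂ → ℂ} (hh : ∀ z, MeromorphicAt h z) (z : ℂ) :
    meromorphicOrderAt (mtilde h) z = meromorphicOrderAt h ((starRingEnd ℂ) z) := by
  by_cases H : meromorphicOrderAt h ((starRingEnd ℂ) z) = ⊤
  · have h1 := meromorphicOrderAt_eq_top_iff.1 H
    rw [H, meromorphicOrderAt_eq_top_iff]
    filter_upwards [(conj_tendsto_ne z).eventually h1] with w hw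
    simp [mtilde, hw]
  · lift meromorphicOrderAt h ((starRingEnd ℂ) z) to ℤ using H with n hn
    exact (mtilde_order (hh _) hn.symm).2

theorem Gd.tilde {u : ℂ → ℂ} (hu : Gd u) : Gd (mtilde u) := by
  intro z hz
  have hz' : ((starRingEnd ℂ) z).im ≠ 0 := by simpa using hz
  obtain ⟨h1, h2, h3⟩ := hu _ hz'
  refine ⟨?_, ?_, ?_⟩
  · have := DifferentiableAt.conj_conj h1
    simpa [mtilde, Function.comp_def] using! this
  · rw [mtilde_deriv]
    intro H
    apply h2
    have := congrArg (starRingEnd ℂ) H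
    simpa [mtilde] using this
  · intro H
    rw [mtilde_deriv]
    have := h3 (by
      have := congrArg (starRingEnd ℂ) H
      simpa [mtilde] using this)
    simpa [mtilde] using this

theorem im_ne_nhds {z : ℂ} (hz : z.im ≠ 0) : ∀ᶠ w in 𝓝 z, w.im ≠ 0 :=
  Complex.continuous_im.continuousAt.eventually_ne hz

theorem Gd.congr {u v : ℂ → ℂ} (hu : Gd u) (h : ∀ z, z.im ≠ 0 → u z = v z) : Gd v := by
  intro z hz
  have h1 : u =ᶠ[𝓝 z] v := (im_ne_nhds hz).mono h
  obtain ⟨h2, h3, h4⟩ := hu z hz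
  refine ⟨h2.congr_of_eventuallyEq h1.symm, ?_, ?_⟩
  · rwa [← h1.deriv_eq]
  · rw [← h1.deriv_eq, ← h z hz]; exact h4


theorem poleCount_bdd {X : ℂ → ℂ} (hfin : {z | meroOrder X z < 0}.Finite) :
    ∃ M : ℝ, ∀ t, |poleCount X t| ≤ M := by
  refine ⟨∑ z ∈ hfin.toFinset, (poleMult X z : ℝ), fun t => ?_⟩
  have h0 : ∀ z, z ∉ hfin.toFinset → poleMult X z = 0 := by
    intro z hz
    simp only [Set.Finite.mem_toFinset, Set.mem_ofPred_eq, not_lt] at hz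
    unfold poleMult
    cases h : meroOrder X z with
    | top => simp
    | coe n =>
      rw [h] at hz
      have : 0 ≤ n := by exact_mod_cast hz
      simp only [WithTop.untopD_coe, Int.toNat_eq_zero]; omega
  have h1 : poleCount X t = ∑ z ∈ hfin.toFinset.filter (fun z => z ∈ Metric.closedBall (0:ℂ) t), (poleMult X z : ℝ) := by
    unfold poleCount
    rw [finsum_mem_eq_sum_of_inter_support_eq]
    ext z
    simp only [Set.mem_inter_iff, Function.mem_support, Finset.coe_filter, Set.mem_ofPred_eq]
    constructor
    · rintro ⟨h1, h2⟩
      refine ⟨⟨?_, h1⟩, h2⟩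
      by_contra H
      exact h2 (by rw [h0 z H]; simp)
    · rintro ⟨⟨_, h1⟩, h2⟩
      exact ⟨h1, h2⟩
  rw [h1, abs_of_nonneg (Finset.sum_nonneg fun _ _ => by positivity)]
  exact Finset.sum_le_sum_of_subset_of_nonneg (Finset.filter_subset _ _) (fun _ _ _ => by positivity)

theorem finiteOrder_of_growth {X R : ℂ → ℂ} (hX : MeroEq X R) (k : ℕ)
    (hR : ∀ᶠ r : ℝ in atTop, ∀ z : ℂ, ‖z‖ = r → ‖R z‖ ≤ Real.exp (r ^ k))
    (hfin : {z | meroOrder X z < 0}.Finite) : FiniteOrder X := by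
  obtain ⟨M, hM⟩ := poleCount_bdd hfin
  have hM0 : 0 ≤ M := (abs_nonneg _).trans (hM 0)
  refine ⟨((k + 3 : ℕ) : ℝ), ?_⟩
  filter_upwards [hR, eventually_ge_atTop 2, eventually_ge_atTop M] with r hr h2 hrM
  have hr0 : 0 < r := by linarith
  rw [Real.rpow_natCast]
  have hN : NCount X r ≤ M * r := by
    have := intervalIntegral.norm_integral_le_of_norm_le_const (a := 1) (b := r)
      (f := fun t => poleCount X t / t) (C := M) (fun t ht => by
        rw [Set.uIoc_of_le (by linarith)] at ht
        rw [norm_div, Real.norm_eq_abs, Real.norm_of_nonneg (by linarith [ht.1]), div_le_iff₀ (by linarith [ht.1])]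
        nlinarith [hM t, ht.1])
    rw [abs_of_nonneg (by linarith)] at this
    have h3 := (le_abs_self _).trans this
    unfold NCount
    nlinarith
  have hP : proximity X r ≤ r ^ k := by
    have hae : ∀ᵐ θ : ℝ, θ ∈ Set.uIoc 0 (2 * Real.pi) → ‖logPlus ‖X ((r : ℂ) * Complex.exp (θ * Complex.I))‖‖ ≤ r ^ k := by
      have hs : {w | X w = R w} ∈ codiscreteWithin (Metric.sphere (0:ℂ) |r|) := by
        rw [mem_codiscreteWithin_iff_forall_mem_nhdsNE]
        intro z _
        filter_upwards [hX z] with w hw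
        exact Or.inl hw
      have hc := circleMap_preimage_codiscrete (c := 0) hr0.ne' (R := r) hs
      have : ∀ᵐ θ : ℝ, X (circleMap 0 r θ) = R (circleMap 0 r θ) := by
        have h5 := ae_restrict_le_codiscreteWithin (μ := (volume : Measure ℝ)) MeasurableSet.univ hc
        rwa [Measure.restrict_univ] at h5
      filter_upwards [this] with θ hθ _
      have e : circleMap 0 r θ = (r : ℂ) * Complex.exp (θ * Complex.I) := by simp [circleMap]
      rw [← e, hθ]
      have h3 := hr (circleMap 0 r θ) (by rw [norm_circleMap_zero, abs_of_pos hr0])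
      unfold logPlus
      rw [Real.norm_of_nonneg (le_max_right _ _)]
      refine max_le ?_ (by positivity)
      rcases (norm_nonneg (R (circleMap 0 r θ))).eq_or_lt with h | h
      · rw [← h]; simp; positivity
      · rw [Real.log_le_iff_le_exp h]; exact h3
    have := intervalIntegral.norm_integral_le_of_norm_le_const_ae hae
    rw [sub_zero, abs_of_pos (by positivity)] at this
    have h3 := (le_abs_self _).trans this
    unfold proximity
    calc _ ≤ (2 * Real.pi)⁻¹ * (r ^ k * (2 * Real.pi)) := by gcongr
      _ = r ^ k := by field_simp
  unfold TChar
  have h1 : 1 ≤ r ^ k := one_le_pow₀ (by linarith)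
  calc proximity X r + NCount X r ≤ r ^ k + r * r := by nlinarith
    _ ≤ r ^ (k + 3) := by
      rw [pow_add]
      have h5 : 1 ≤ r ^ 2 := by nlinarith
      have h6 : 2 * r ^ 2 ≤ r ^ 3 := by nlinarith
      have h7 : r ^ k * (2 * r ^ 2) ≤ r ^ k * r ^ 3 := by gcongr
      have h8 : r ^ k * 1 ≤ r ^ k * r ^ 2 := by gcongr
      have h9 : 1 * r ^ 2 ≤ r ^ k * r ^ 2 := by gcongr
      nlinarith

theorem poly_growth (p : Polynomial ℂ) (A : ℝ) :
    ∀ᶠ r : ℝ in atTop, ∀ z : ℂ, ‖z‖ = r → A * ‖p.eval z‖ ≤ Real.exp r := by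
  let P : Polynomial ℝ := ∑ i ∈ Finset.range (p.natDegree + 1), Polynomial.C (|A| * ‖p.coeff i‖) * Polynomial.X ^ i
  have h1 : ∀ z : ℂ, A * ‖p.eval z‖ ≤ P.eval ‖z‖ := by
    intro z
    simp only [P, Polynomial.eval_finsetSum, Polynomial.eval_mul, Polynomial.eval_C, Polynomial.eval_pow, Polynomial.eval_X]
    rw [Polynomial.eval_eq_sum_range]
    calc A * ‖∑ i ∈ Finset.range (p.natDegree + 1), p.coeff i * z ^ i‖
        ≤ |A| * ∑ i ∈ Finset.range (p.natDegree + 1), ‖p.coeff i * z ^ i‖ := by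
          gcongr
          · exact le_abs_self A
          · exact norm_sum_le _ _
      _ = _ := by
        rw [Finset.mul_sum]
        refine Finset.sum_congr rfl fun i _ => ?_
        rw [norm_mul, norm_pow, mul_assoc]
  have h2 := P.tendsto_div_exp_atTop
  filter_upwards [h2.eventually (gt_mem_nhds one_pos)] with r hr z hz
  rw [div_lt_one (Real.exp_pos r)] at hr
  rw [← hz] at hr ⊢
  exact (h1 z).trans hr.le

theorem rat_growth (p q : Polynomial ℂ) (hq : q ≠ 0) :
    ∀ᶠ r : ℝ in atTop, ∀ z : ℂ, ‖z‖ = r → ‖p.eval z / q.eval z‖ ≤ Real.exp (r ^ 1) := by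
  have hδ : ∃ δ > 0, ∀ᶠ r : ℝ in atTop, ∀ z : ℂ, ‖z‖ = r → δ ≤ ‖q.eval z‖ := by
    by_cases hd : 0 < q.degree
    · refine ⟨1, one_pos, ?_⟩
      have h1 := q.tendsto_norm_atTop hd (l := comap norm atTop) (z := id) tendsto_comap
      have h2 := h1.eventually (eventually_ge_atTop 1)
      rw [eventually_comap] at h2
      filter_upwards [h2] with r hr z hz
      exact hr z hz
    · obtain ⟨a, rfl⟩ : ∃ a, q = Polynomial.C a := ⟨_, Polynomial.eq_C_of_degree_le_zero (not_lt.1 hd)⟩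
      refine ⟨‖a‖, norm_pos_iff.2 (by simpa using hq), Eventually.of_forall fun r z _ => by simp⟩
  obtain ⟨δ, hδ, h1⟩ := hδ
  filter_upwards [h1, poly_growth p δ⁻¹] with r hr hr2 z hz
  rw [norm_div, pow_one]
  refine le_trans ?_ (hr2 z hz)
  rw [div_eq_inv_mul]
  gcongr
  exact hr z hz

theorem rat_absurd {X : ℂ → ℂ} (p q : Polynomial ℂ) (hq : q ≠ 0)
    (hX : MeroEq X (fun z => p.eval z / q.eval z))
    (hio : ¬ FiniteOrder X ∨ {z : ℂ | meroOrder X z < 0}.Infinite) : False := by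
  have hfin : {z : ℂ | meroOrder X z < 0}.Finite := by
    refine (q.roots.toFinset.finite_toSet).subset fun z hz => ?_
    by_contra H
    have h1 : q.eval z ≠ 0 := by simpa [hq] using H
    have h2 : AnalyticAt ℂ (fun z => p.eval z / q.eval z) z := by
      refine AnalyticAt.div ?_ ?_ h1
      · exact p.differentiable.analyticAt z
      · exact q.differentiable.analyticAt z
    have hz' : meroOrder X z < 0 := hz
    rw [meroOrder_eq, hX.order z] at hz'
    exact absurd h2.meromorphicOrderAt_nonneg (not_le.2 hz')
  rcases hio with h | h
  · exact h (finiteOrder_of_growth hX 1 (rat_growth p q hq) hfin)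
  · exact h hfin

theorem exp_absurd {X : ℂ → ℂ} (C b : ℂ)
    (hX : MeroEq X (fun z => C * Complex.exp (b * z)))
    (hio : ¬ FiniteOrder X ∨ {z : ℂ | meroOrder X z < 0}.Infinite) : False := by
  have hfin : {z : ℂ | meroOrder X z < 0}.Finite := by
    refine Set.finite_empty.subset fun z hz => ?_
    have h2 : AnalyticAt ℂ (fun z => C * Complex.exp (b * z)) z := by fun_prop
    have hz' : meroOrder X z < 0 := hz
    rw [meroOrder_eq, hX.order z] at hz'
    exact absurd h2.meromorphicOrderAt_nonneg (not_le.2 hz')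
  rcases hio with h | h
  · refine h (finiteOrder_of_growth hX 2 ?_ hfin)
    filter_upwards [eventually_ge_atTop (‖b‖ + Real.log (‖C‖ + 1) + 1)] with r hr z hz
    have hC : 0 ≤ Real.log (‖C‖ + 1) := Real.log_nonneg (by linarith [norm_nonneg C])
    have hb := norm_nonneg b
    rw [norm_mul, Complex.norm_exp]
    calc ‖C‖ * Real.exp (b * z).re ≤ Real.exp (Real.log (‖C‖ + 1)) * Real.exp (‖b‖ * r) := by
          gcongr
          · rw [Real.exp_log (by positivity)]; linarith
          · rw [← hz, ← norm_mul]; exact Complex.re_le_norm _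
      _ ≤ Real.exp (r ^ 2) := by
          rw [← Real.exp_add]
          apply Real.exp_le_exp.2
          nlinarith
  · exact h hfin


noncomputable def uq (X : ℂ → ℂ) : ℂ → ℂ := nf (fun z => X z / deriv X z)
noncomputable def Zq (X : ℂ → ℂ) : ℂ → ℂ := nf (fun z => (X z)⁻¹)

/-- nondegenerate meromorphic function -/
def Nd (X : ℂ → ℂ) : Prop := (∀ z, MeromorphicAt X z) ∧ (∀ z, meromorphicOrderAt X z ≠ ⊤)

theorem Nd.ev {X : ℂ → ℂ} (h : Nd X) (z : ℂ) : ∀ᶠ w in 𝓝[≠] z, X w ≠ 0 := ne_ev h.1 (h.2 z)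

theorem mer_deriv {X : ℂ → ℂ} (h : ∀ z, MeromorphicAt X z) : ∀ z, MeromorphicAt (deriv X) z :=
  fun z => (h z).deriv

theorem uq_mer0 {X : ℂ → ℂ} (h : ∀ z, MeromorphicAt X z) :
    ∀ z, MeromorphicAt (fun z => X z / deriv X z) z := fun z => (h z).div (h z).deriv

theorem uq_eq {X : ℂ → ℂ} (h : ∀ z, MeromorphicAt X z) : MeroEq (uq X) (fun z => X z / deriv X z) :=
  nf_eq (uq_mer0 h)

theorem Zq_mer0 {X : ℂ → ℂ} (h : ∀ z, MeromorphicAt X z) :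
    ∀ z, MeromorphicAt (fun z => (X z)⁻¹) z := fun z => (h z).inv

theorem Zq_eq {X : ℂ → ℂ} (h : ∀ z, MeromorphicAt X z) : MeroEq (Zq X) (fun z => (X z)⁻¹) :=
  nf_eq (Zq_mer0 h)

theorem uq_ord {X : ℂ → ℂ} (h : ∀ z, MeromorphicAt X z) (z : ℂ) :
    meromorphicOrderAt (uq X) z = - meromorphicOrderAt (logDeriv X) z := by
  rw [(uq_eq h).order z, ← meromorphicOrderAt_inv]
  refine meromorphicOrderAt_congr (Eventually.of_forall fun w => ?_)
  simp [logDeriv_apply]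

theorem uq_ord_one {X : ℂ → ℂ} (h : Nd X) {z : ℂ} (hz : meromorphicOrderAt X z ≠ 0) :
    meromorphicOrderAt (uq X) z = 1 := by
  rw [uq_ord h.1, meromorphicOrderAt_logDeriv_eq_neg_one (h.1 z) hz (h.2 z)]
  rfl

theorem ord_deriv_nonneg {X : ℂ → ℂ} {z : ℂ} (h : MeromorphicAt X z) (hz : 0 ≤ meromorphicOrderAt X z) :
    0 ≤ meromorphicOrderAt (deriv X) z := by
  have h1 : AnalyticAt ℂ (toMeromorphicNFAt X z) z :=
    (h.meromorphicOrderAt_nonneg_iff_analyticAt_toMeromorphicNFAt).1 hz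
  have h2 : X =ᶠ[𝓝[≠] z] toMeromorphicNFAt X z := h.eq_nhdsNE_toMeromorphicNFAt
  rw [meromorphicOrderAt_congr h2.nhdsNE_deriv]
  exact h1.deriv.meromorphicOrderAt_nonneg

theorem an_ne_of_ord {h : ℂ → ℂ} {z : ℂ} (ha : AnalyticAt ℂ h z) : meromorphicOrderAt h z = 0 ↔ h z ≠ 0 :=
  ha.meromorphicNFAt.meromorphicOrderAt_eq_zero_iff

theorem uq_P {X : ℂ → ℂ} (h : Nd X) (h1 : Nd (deriv X)) :
    MeroEq (fun z => 1 - deriv (uq X) z) (fun z => X z * deriv (deriv X) z / deriv X z ^ 2) := by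
  intro z
  filter_upwards [(uq_eq h.1).deriv z, analytic_ne h.1 z, analytic_ne h1.1 z, h1.ev z] with w a1 a2 a3 a4
  rw [a1]
  rw [((a2.differentiableAt.hasDerivAt).fun_div (a3.differentiableAt.hasDerivAt) a4).deriv]
  field_simp
  ring

theorem uq_pole {X : ℂ → ℂ} (h : Nd X) {z : ℂ} {n : ℤ} (hn : meromorphicOrderAt X z = n) (hn0 : n ≠ 0) :
    uq X z = 0 ∧ deriv (uq X) z = 1 / (n:ℂ) := by
  obtain ⟨g, hg, hg0, hgX⟩ := (meromorphicOrderAt_eq_int_iff (h.1 z)).1 hn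
  have hu1 : meromorphicOrderAt (uq X) z = 1 := uq_ord_one h (by rw [hn]; exact_mod_cast hn0)
  have hua : AnalyticAt ℂ (uq X) z := (nf_nf _ z).meromorphicOrderAt_nonneg_iff_analyticAt.1 (by
    change 0 ≤ meromorphicOrderAt (uq X) z
    rw [hu1]; exact zero_le_one)
  have hnc : (n:ℂ) ≠ 0 := by exact_mod_cast hn0
  have hden : AnalyticAt ℂ (fun w => (n:ℂ) * g w + (w - z) * deriv g w) z := by
    have := hg.deriv
    fun_prop
  have hden0 : (n:ℂ) * g z + (z - z) * deriv g z ≠ 0 := by simpa using ⟨hn0, hg0⟩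
  have hk : AnalyticAt ℂ (fun w => g w / ((n:ℂ) * g w + (w - z) * deriv g w)) z := hg.div hden hden0
  have heq : uq X =ᶠ[𝓝[≠] z] fun w => (w - z) * (g w / ((n:ℂ) * g w + (w - z) * deriv g w)) := by
    filter_upwards [uq_eq h.1 z, hgX, Filter.EventuallyEq.nhdsNE_deriv hgX, self_mem_nhdsWithin,
      hg.eventually_analyticAt.filter_mono nhdsWithin_le_nhds] with w a1 a2 a3 a4 a5
    have hw : w - z ≠ 0 := sub_ne_zero.2 a4
    have hd : HasDerivAt (fun w => (w - z) ^ n • g w) (((n:ℂ) * (w - z) ^ (n - 1) * 1) * g w + (w - z) ^ n * deriv g w) w := by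
      have e1 : HasDerivAt (fun w : ℂ => w - z) 1 w := (hasDerivAt_id w).sub_const z
      have e2 := (hasDerivAt_zpow n (w - z) (Or.inl hw)).comp w e1
      exact e2.mul a5.differentiableAt.hasDerivAt
    rw [a1, a2, a3, hd.deriv, smul_eq_mul]
    have e3 : (w - z) ^ n = (w - z) ^ (n - 1) * (w - z) := by
      rw [← zpow_add_one₀ hw]; simp
    have e4 : (w - z) ^ (n - 1) ≠ 0 := zpow_ne_zero _ hw
    rw [e3]
    rw [show (n:ℂ) * (w - z) ^ (n - 1) * 1 * g w + (w - z) ^ (n - 1) * (w - z) * deriv g w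
      = (w - z) ^ (n - 1) * ((n:ℂ) * g w + (w - z) * deriv g w) by ring, mul_assoc,
      mul_div_mul_left _ _ e4, mul_div_assoc]
  have hk2 : HasDerivAt (fun w => (w - z) * (g w / ((n:ℂ) * g w + (w - z) * deriv g w))) (1 / (n:ℂ)) z := by
    have e1 : HasDerivAt (fun w : ℂ => w - z) 1 z := (hasDerivAt_id z).sub_const z
    refine (e1.mul hk.differentiableAt.hasDerivAt).congr_deriv ?_
    simp
    field_simp
  have heq2 := (ContinuousAt.eventuallyEq_nhds_iff_eventuallyEq_nhdsNE hua.continuousAt hk2.continuousAt).1 heq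
  refine ⟨?_, ?_⟩
  · rw [heq2.self_of_nhds]; simp
  · rw [heq2.deriv_eq, hk2.deriv]

theorem ord_zero_of_u {X : ℂ → ℂ} (h : Nd X) {z : ℂ} (hu : uq X z ≠ 0) : meromorphicOrderAt X z = 0 := by
  by_contra H
  have h1 := h.2 z
  lift meromorphicOrderAt X z to ℤ using h1 with n hn
  exact hu (uq_pole h hn.symm (by exact_mod_cast H)).1

theorem gd_uq {X : ℂ → ℂ} (h : Nd X) (h1 : Nd (deriv X)) (h2 : Nd (deriv (deriv X)))
    (k0 : ∀ z : ℂ, 0 < meromorphicOrderAt X z → z.im = 0)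
    (k1 : ∀ z : ℂ, 0 < meromorphicOrderAt (deriv X) z → z.im = 0)
    (k2 : ∀ z : ℂ, 0 < meromorphicOrderAt (deriv (deriv X)) z → z.im = 0) : Gd (uq X) := by
  intro z hz
  have i0 : meromorphicOrderAt X z ≤ 0 := not_lt.1 fun H => hz (k0 z H)
  have i1 : meromorphicOrderAt (deriv X) z ≤ 0 := not_lt.1 fun H => hz (k1 z H)
  have i2 : meromorphicOrderAt (deriv (deriv X)) z ≤ 0 := not_lt.1 fun H => hz (k2 z H)
  have hP := (uq_P h h1).order z
  have hPo : meromorphicOrderAt (fun z => X z * deriv (deriv X) z / deriv X z ^ 2) z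
      = meromorphicOrderAt X z + meromorphicOrderAt (deriv (deriv X)) z - (meromorphicOrderAt (deriv X) z + meromorphicOrderAt (deriv X) z) := by
    have e : (fun z => X z * deriv (deriv X) z / deriv X z ^ 2) = (X * deriv (deriv X)) / (deriv X * deriv X) := by
      funext w; simp [sq]
    rw [e, meromorphicOrderAt_div ((h.1 z).mul (h2.1 z)) ((h1.1 z).mul (h1.1 z)),
      meromorphicOrderAt_mul (h.1 z) (h2.1 z), meromorphicOrderAt_mul (h1.1 z) (h1.1 z)]
  rw [hPo] at hP
  have key : ∀ ha : AnalyticAt ℂ (uq X) z, meromorphicOrderAt (fun z => 1 - deriv (uq X) z) z = 0 →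
      deriv (uq X) z ≠ 1 := by
    intro ha h0 H
    have h3 : AnalyticAt ℂ (fun z => 1 - deriv (uq X) z) z := analyticAt_const.sub ha.deriv
    exact (an_ne_of_ord h3).1 h0 (by rw [H]; simp)
  rcases i0.lt_or_eq with hlt | he
  · have hnt := h.2 z
    lift meromorphicOrderAt X z to ℤ using hnt with n hn
    have hn0 : n < 0 := by exact_mod_cast hlt
    obtain ⟨p1, p2⟩ := uq_pole h hn.symm hn0.ne
    have hua : AnalyticAt ℂ (uq X) z := (nf_nf _ z).meromorphicOrderAt_nonneg_iff_analyticAt.1 (by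
      change 0 ≤ meromorphicOrderAt (uq X) z
      rw [uq_ord_one h (by rw [← hn]; exact_mod_cast hn0.ne)]; exact zero_le_one)
    have o1 := meromorphicOrderAt_deriv_eq_sub_one (f := X) (x := z) (n := n) (by exact_mod_cast hn0.ne) hn.symm
    have o2 := meromorphicOrderAt_deriv_eq_sub_one (f := deriv X) (x := z) (n := n - 1) (by
      have : n - 1 ≠ 0 := by omega
      exact_mod_cast this) o1
    refine ⟨hua.differentiableAt, key hua ?_, fun _ => ?_⟩
    · rw [hP, o1, o2]
      norm_cast
      omega
    · rw [p2]
      obtain ⟨k, rfl⟩ : ∃ k : ℤ, n = -k := ⟨-n, by simp⟩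
      have hk : (1:ℝ) ≤ k := by
        have : 1 ≤ k := by omega
        exact_mod_cast this
      have e : (1 / (((-k : ℤ)) : ℂ)) = ((-(1/(k:ℝ)) : ℝ) : ℂ) := by
        push_cast
        rw [div_neg]
      rw [e, Complex.norm_real, Complex.ofReal_re, norm_neg, Real.norm_of_nonneg (by positivity)]
      refine ⟨?_, ?_⟩
      · rw [div_le_one (by linarith)]; exact hk
      · have : 0 < 1 / (k:ℝ) := by positivity
        linarith
  · have o1 : meromorphicOrderAt (deriv X) z = 0 := le_antisymm i1 (ord_deriv_nonneg (h.1 z) he.ge)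
    have o2 : meromorphicOrderAt (deriv (deriv X)) z = 0 := le_antisymm i2 (ord_deriv_nonneg (h1.1 z) o1.ge)
    have hu0 : meromorphicOrderAt (uq X) z = 0 := by
      rw [(uq_eq h.1).order z]
      have e : (fun z => X z / deriv X z) = X / deriv X := rfl
      rw [e, meromorphicOrderAt_div (h.1 z) (h1.1 z), he, o1]; simp
    have hua : AnalyticAt ℂ (uq X) z := (nf_nf _ z).meromorphicOrderAt_nonneg_iff_analyticAt.1 hu0.ge
    refine ⟨hua.differentiableAt, key hua ?_, fun H => ?_⟩
    · rw [hP, he, o1, o2]; simp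
    · exact absurd H ((an_ne_of_ord hua).1 hu0)

theorem uinv_an {X : ℂ → ℂ} (h : Nd X) {z : ℂ} (hz : meromorphicOrderAt X z = 0) :
    AnalyticAt ℂ (fun w => (uq X w)⁻¹) z := by
  have h1 : MeromorphicNFAt (uq X)⁻¹ z := (nf_nf _ z).inv
  refine h1.meromorphicOrderAt_nonneg_iff_analyticAt.1 ?_
  rw [meromorphicOrderAt_inv, uq_ord h.1, neg_neg]
  exact meromorphicOrderAt_logDeriv_nonneg (h.1 z) hz

theorem Zq_an {X : ℂ → ℂ} (h : Nd X) {z : ℂ} (hz : meromorphicOrderAt X z ≤ 0) :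
    AnalyticAt ℂ (Zq X) z := by
  refine nf_an (Zq_mer0 h.1) ?_
  have e : (fun z => (X z)⁻¹) = X⁻¹ := rfl
  rw [e, meromorphicOrderAt_inv]
  have h1 := h.2 z
  lift meromorphicOrderAt X z to ℤ using h1 with n hn
  have : n ≤ 0 := by exact_mod_cast hz
  have : 0 ≤ -n := by omega
  exact_mod_cast this

theorem Zq_deriv {X : ℂ → ℂ} (h : Nd X) {z : ℂ} (hz : meromorphicOrderAt X z = 0) :
    HasDerivAt (Zq X) (-(uq X z)⁻¹ * Zq X z) z := by
  have hZ := Zq_an h hz.le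
  have hL := uinv_an h hz
  have heq : deriv (Zq X) =ᶠ[𝓝[≠] z] fun w => -(uq X w)⁻¹ * Zq X w := by
    filter_upwards [(Zq_eq h.1).deriv z, Zq_eq h.1 z, uq_eq h.1 z, h.ev z, analytic_ne h.1 z] with w a1 a2 a3 a4 a5
    rw [a1, a2, a3, (a5.differentiableAt.hasDerivAt.fun_inv a4).deriv]
    field_simp
  have h2 := (ContinuousAt.eventuallyEq_nhds_iff_eventuallyEq_nhdsNE hZ.deriv.continuousAt
    (hL.neg.mul hZ).continuousAt).1 heq
  have h3 := hZ.differentiableAt.hasDerivAt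
  rw [h2.self_of_nhds] at h3
  exact h3


theorem real_bd {X ℓ : ℂ → ℂ} (h : Nd X) {c : ℂ} (hc : ‖c‖ = 1) (hl : Continuous ℓ)
    (hrel : MeroEq (uq X) (fun z => c * mtilde (uq X) z + ℓ z)) (x : ℝ) (hx : ℓ x ≠ 0) :
    meromorphicOrderAt X x = 0 ∧ ‖(uq X x)⁻¹‖ ≤ 2 / ‖ℓ x‖ := by
  rcases meromorphicNFAt_iff_analyticAt_or.1 (nf_nf (fun z => X z / deriv X z) (x:ℂ)) with ha | ⟨_, h1, h2⟩
  · change AnalyticAt ℂ (uq X) x at ha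
    have ht : AnalyticAt ℂ (mtilde (uq X)) (x:ℂ) := mtilde_an (by simpa using ha)
    have h1 := (hrel.eq_at ha.continuousAt
      ((continuousAt_const.mul ht.continuousAt).add hl.continuousAt)).self_of_nhds
    have h2 : ‖ℓ x‖ ≤ 2 * ‖uq X x‖ := by
      have e : ℓ x = uq X x - c * mtilde (uq X) x := by rw [h1]; ring
      have e2 : ‖mtilde (uq X) (x:ℂ)‖ = ‖uq X x‖ := by simp [mtilde]
      calc ‖ℓ x‖ ≤ ‖uq X x‖ + ‖c * mtilde (uq X) x‖ := by rw [e]; exact norm_sub_le _ _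
        _ = 2 * ‖uq X x‖ := by rw [norm_mul, hc, e2]; ring
    have h3 : 0 < ‖ℓ x‖ := norm_pos_iff.2 hx
    have h4 : 0 < ‖uq X x‖ := by linarith
    refine ⟨ord_zero_of_u h (norm_pos_iff.1 h4), ?_⟩
    rw [norm_inv, inv_le_comm₀ h4 (by positivity), inv_div]
    linarith
  · change meromorphicOrderAt (uq X) x < 0 at h1
    change uq X x = 0 at h2
    refine ⟨?_, ?_⟩
    · by_contra H
      rw [uq_ord_one h H] at h1
      exact absurd h1 (by decide)
    · rw [h2]; simp; positivity

theorem rel_unit {u : ℂ → ℂ} (hG : Gd u) {c d : ℂ}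
    (hrel : MeroEq u (fun z => c * mtilde u z + ((1 - c) * z - d))) :
    ‖c‖ = 1 ∧ d = - c * (starRingEnd ℂ) d := by
  have hG2 := hG.tilde
  have hp : ∀ z : ℂ, z.im ≠ 0 → u z = c * mtilde u z + ((1 - c) * z - d) := by
    intro z hz
    exact (hrel.eq_at (hG z hz).1.continuousAt
      ((continuousAt_const.mul (hG2 z hz).1.continuousAt).add (by fun_prop))).self_of_nhds
  have hq : ∀ z : ℂ, z.im ≠ 0 → mtilde u z = (starRingEnd ℂ) c * u z + ((1 - (starRingEnd ℂ) c) * z - (starRingEnd ℂ) d) := by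
    intro z hz
    have := congrArg (starRingEnd ℂ) (hp ((starRingEnd ℂ) z) (by simpa using hz))
    simpa [mtilde] using this
  have hcc : c * (starRingEnd ℂ) c = ((‖c‖ ^ 2 : ℝ) : ℂ) := by
    rw [Complex.mul_conj, Complex.normSq_eq_norm_sq]
  have hr : ∀ z : ℂ, z.im ≠ 0 → (1 - c * (starRingEnd ℂ) c) * (u z - z) = - (c * (starRingEnd ℂ) d + d) := by
    intro z hz
    have h1 := hp z hz
    rw [hq z hz] at h1
    linear_combination h1
  have hc1 : c * (starRingEnd ℂ) c = 1 := by
    by_contra H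
    have H' : 1 - c * (starRingEnd ℂ) c ≠ 0 := sub_ne_zero.2 (Ne.symm H)
    have hI : (Complex.I).im ≠ 0 := by simp
    have h2 : u =ᶠ[𝓝 Complex.I] fun z => z + (- (c * (starRingEnd ℂ) d + d)) / (1 - c * (starRingEnd ℂ) c) := by
      filter_upwards [im_ne_nhds hI] with z hz
      have := hr z hz
      field_simp
      linear_combination this
    apply (hG _ hI).2.1
    rw [h2.deriv_eq]
    simp
  refine ⟨?_, ?_⟩
  · rw [hcc] at hc1
    have h2 : ‖c‖ ^ 2 = 1 := by exact_mod_cast hc1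
    nlinarith [norm_nonneg c]
  · have h3 := hr Complex.I (by simp)
    rw [hc1] at h3
    linear_combination h3

theorem Gd.translate {u : ℂ → ℂ} (hG : Gd u) (t : ℝ) : Gd (fun z => u (z + t)) := by
  intro z hz
  have hz' : (z + t).im ≠ 0 := by simpa using hz
  obtain ⟨h1, h2, h3⟩ := hG _ hz'
  rw [deriv_comp_add_const]
  exact ⟨DifferentiableAt.comp z h1 (by fun_prop), h2, h3⟩

theorem b1_main {X : ℂ → ℂ} (h : Nd X) (hG : Gd (uq X))
    (k0 : ∀ z : ℂ, 0 < meromorphicOrderAt X z → z.im = 0) {c d : ℂ}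
    (hrel : MeroEq (uq X) (fun z => c * mtilde (uq X) z + ((1 - c) * z - d))) (hc : c ≠ 1)
    (hio : ¬ FiniteOrder X ∨ {z : ℂ | meroOrder X z < 0}.Infinite) : False := by
  obtain ⟨hc1, hd⟩ := rel_unit hG hrel
  have hc' : 1 - c ≠ 0 := sub_ne_zero.2 (Ne.symm hc)
  have hcc : c * (starRingEnd ℂ) c = 1 := by
    rw [Complex.mul_conj, Complex.normSq_eq_norm_sq, hc1]; simp
  obtain ⟨t, ht⟩ : ∃ t : ℝ, (t:ℂ) = d / (1 - c) := by
    have h1 : (starRingEnd ℂ) (d / (1 - c)) = d / (1 - c) := by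
      have hc2 : 1 - (starRingEnd ℂ) c ≠ 0 := by
        intro H
        apply hc'
        have := congrArg (starRingEnd ℂ) H
        simpa using this
      simp only [map_div₀, map_sub, map_one]
      rw [div_eq_div_iff hc2 hc']
      have h5 : c ≠ 0 := by
        rintro rfl
        simp at hcc
      apply mul_left_cancel₀ h5
      linear_combination d * hcc + (1 - c) * hd
    exact ⟨_, (Complex.conj_eq_iff_real.1 h1).choose_spec.symm⟩
  have hd2 : d = (1 - c) * t := by rw [ht]; field_simp
  have hl : Continuous (fun z : ℂ => (1 - c) * z - d) := by fun_prop
  have hreal : ∀ x : ℝ, x ≠ 0 → meromorphicOrderAt X ((x:ℂ) + t) = 0 ∧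
      ‖(uq X ((x:ℂ) + t))⁻¹‖ ≤ 2 / ‖1 - c‖ / |x| := by
    intro x hx
    have e : (1 - c) * (((x + t : ℝ)) : ℂ) - d = (1 - c) * x := by rw [hd2]; push_cast; ring
    have := real_bd h hc1 hl hrel (x + t) (by
      rw [e]
      exact mul_ne_zero hc' (by exact_mod_cast hx))
    rw [e, norm_mul, Complex.norm_real, Real.norm_eq_abs] at this
    push_cast at this
    rwa [div_div]
  have hord : ∀ z : ℂ, z ≠ 0 → meromorphicOrderAt X (z + t) ≤ 0 := by
    intro z hz
    by_cases him : z.im = 0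
    · obtain ⟨x, rfl⟩ : ∃ x : ℝ, z = x := ⟨z.re, by apply Complex.ext <;> simp [him]⟩
      exact (hreal x (by exact_mod_cast hz)).1.le
    · refine not_lt.1 fun H => him ?_
      simpa using k0 _ H
  have hZan : ∀ z : ℂ, z ≠ 0 → AnalyticAt ℂ (fun z => Zq X (z + t)) z := by
    intro z hz
    exact (Zq_an h (hord z hz)).comp_of_eq (by fun_prop) rfl
  obtain ⟨N, hN⟩ : ∃ N : ℕ, meromorphicOrderAt X t ≤ ((N:ℤ) : WithTop ℤ) := by
    have := h.2 t
    lift meromorphicOrderAt X t to ℤ using this with n hn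
    exact ⟨n.toNat, by exact_mod_cast Int.self_le_toNat n⟩
  let W0 : ℂ → ℂ := fun z => z ^ N * Zq X (z + t)
  have hZm : ∀ z, MeromorphicAt (fun z => Zq X (z + t)) z := fun z =>
    (nf_mer _ (z + t)).comp_analyticAt (g := fun z => z + (t:ℂ)) (by fun_prop)
  have hWm : ∀ z, MeromorphicAt W0 z := fun z => by
    have := hZm z
    exact MeromorphicAt.mul (by fun_prop) this
  have hWa : ∀ z : ℂ, z ≠ 0 → AnalyticAt ℂ W0 z := fun z hz =>
    AnalyticAt.mul (by fun_prop) (hZan z hz)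
  have hW : Differentiable ℂ (nf W0) := by
    intro z
    refine (nf_an hWm ?_).differentiableAt
    by_cases hz : z = 0
    · subst hz
      have e1 : W0 = (fun z : ℂ => z ^ N) * (fun z => Zq X (z + t)) := rfl
      rw [e1, meromorphicOrderAt_mul (by fun_prop) (hZm 0)]
      have e2 : meromorphicOrderAt (fun z : ℂ => z ^ N) 0 = ((N:ℤ) : WithTop ℤ) := by
        rw [← meromorphicOrderAt_zpow_id_sub_const (𝕜 := ℂ) (x := 0) (n := (N:ℤ))]
        congr 1
        funext z
        simp
      have e3 : meromorphicOrderAt (fun z => Zq X (z + t)) 0 = - meromorphicOrderAt X t := by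
        have e4 : meromorphicOrderAt (fun z => Zq X (z + t)) 0 = meromorphicOrderAt (Zq X) (0 + t) :=
          meromorphicOrderAt_comp_add_const_eq_meromorphicOrderAt
        rw [e4, zero_add, (Zq_eq h.1).order]
        exact meromorphicOrderAt_inv
      rw [e2, e3]
      have := h.2 t
      lift meromorphicOrderAt X t to ℤ using this with n hn
      have h6 : n ≤ N := by exact_mod_cast hN
      have h7 : 0 ≤ (N:ℤ) + -n := by omega
      exact_mod_cast h7
    · exact (hWa z hz).meromorphicOrderAt_nonneg
  have hWZ : ∀ z ≠ 0, nf W0 z = z ^ N * Zq X (z + t) := fun z hz =>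
    ((nf_eq hWm).eq_at hW.continuous.continuousAt (hWa z hz).continuousAt).self_of_nhds
  obtain ⟨p, hp⟩ := b1_core (u := fun z => uq X (z + t)) (Z := fun z => Zq X (z + t)) (W := nf W0)
    (k := 2 / ‖1 - c‖) (N := N) (hG.translate t) (fun x hx => ⟨by
      have := (uinv_an h (hreal x hx).1).comp_of_eq (g := fun w => (uq X w)⁻¹) (f := fun z : ℂ => z + (t:ℂ)) (x := (x:ℂ)) (by fun_prop) rfl
      exact this.eventually_analyticAt.mono fun w hw => hw.differentiableAt, (hreal x hx).2⟩) hW hWZ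
    (fun z hz hzu => by
      have ho : meromorphicOrderAt X (z + t) = 0 := by
        by_cases him : z.im = 0
        · obtain ⟨x, rfl⟩ : ∃ x : ℝ, z = x := ⟨z.re, by apply Complex.ext <;> simp [him]⟩
          exact (hreal x (by exact_mod_cast hz)).1
        · exact ord_zero_of_u h (hzu him)
      exact (Zq_deriv h ho).comp_add_const z t)
  have hXp : MeroEq X (fun z => ((Polynomial.X - Polynomial.C (t:ℂ)) ^ N).eval z / (p.comp (Polynomial.X - Polynomial.C (t:ℂ))).eval z) := by
    intro z
    have hne : ∀ᶠ w in 𝓝[≠] z, w ≠ (t:ℂ) := by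
      by_cases hz : z = t
      · rw [hz]; exact self_mem_nhdsWithin
      · exact (continuousAt_id.eventually_ne hz).filter_mono nhdsWithin_le_nhds
    filter_upwards [hne, Zq_eq h.1 z, h.ev z] with w w1 w2 w3
    have w4 : w - t ≠ 0 := sub_ne_zero.2 w1
    have h5 := hWZ (w - t) w4
    rw [hp, sub_add_cancel, w2] at h5
    simp only [Polynomial.eval_pow, Polynomial.eval_sub, Polynomial.eval_X, Polynomial.eval_C, Polynomial.eval_comp, h5]
    field_simp
  refine rat_absurd _ _ ?_ hXp hio
  intro H
  rw [H] at hXp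
  obtain ⟨w, hw, hw2⟩ := ((hXp 0).and (h.ev 0)).exists
  simp at hw
  exact hw2 hw


theorem inv_third {w : ℂ → ℂ} (hw : Differentiable ℂ w) {z : ℂ} (hz : w z ≠ 0) :
    deriv (deriv (deriv (fun v => (w v)⁻¹))) =ᶠ[𝓝 z] fun v =>
      (-(deriv (deriv (deriv w)) v) * w v ^ 2 + 6 * (w v * deriv w v * deriv (deriv w) v) - 6 * deriv w v ^ 3) / w v ^ 4 := by
  have a1 : Differentiable ℂ (deriv w) := fun v => (hw.analyticAt v).deriv.differentiableAt
  have a2 : Differentiable ℂ (deriv (deriv w)) := fun v => (a1.analyticAt v).deriv.differentiableAt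
  have hev : ∀ z, w z ≠ 0 → ∀ᶠ v in 𝓝 z, w v ≠ 0 := fun z hz => hw.continuous.continuousAt.eventually_ne hz
  have b1 : ∀ z, w z ≠ 0 → deriv (fun v => (w v)⁻¹) =ᶠ[𝓝 z] fun v => -(deriv w v) / w v ^ 2 := by
    intro z hz
    filter_upwards [hev z hz] with v hv
    exact ((hw v).hasDerivAt.fun_inv hv).deriv
  have b2 : ∀ z, w z ≠ 0 → deriv (deriv (fun v => (w v)⁻¹)) =ᶠ[𝓝 z] fun v =>
      (2 * deriv w v ^ 2 - w v * deriv (deriv w) v) / w v ^ 3 := by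
    intro z hz
    filter_upwards [hev z hz] with v hv
    rw [(b1 v hv).deriv_eq]
    rw [((a1 v).hasDerivAt.fun_neg.fun_div ((hw v).hasDerivAt.fun_pow 2) (pow_ne_zero 2 hv)).deriv]
    field_simp
    ring
  filter_upwards [hev z hz] with v hv
  rw [(b2 v hv).deriv_eq]
  rw [((((a1 v).hasDerivAt.fun_pow 2).const_mul 2 |>.fun_sub ((hw v).hasDerivAt.fun_mul (a2 v).hasDerivAt)).fun_div
    ((hw v).hasDerivAt.fun_pow 3) (pow_ne_zero 3 hv)).deriv]
  field_simp
  ring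

theorem a_main {y : ℂ → ℂ} (h : Nd y) (h1 : Nd (deriv y))
    (k0 : ∀ z : ℂ, 0 < meromorphicOrderAt y z → z.im = 0)
    (k3 : ∀ z : ℂ, 0 < meromorphicOrderAt (deriv (deriv (deriv y))) z → z.im = 0)
    {l t : ℂ} (hl : ‖l‖ = 1) (ht : t ≠ 0)
    (hrel : MeroEq (mtilde y) (fun z => l * y z + t)) : False := by
  have hl0 : l ≠ 0 := norm_pos_iff.1 (by rw [hl]; exact one_pos)
  have hord : ∀ z, meromorphicOrderAt y z ≤ 0 := by
    intro z
    refine not_lt.1 fun H => ?_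
    have hz := k0 z H
    have hc : (starRingEnd ℂ) z = z := Complex.conj_eq_iff_im.2 hz
    have t1 := tendsto_zero_of_meromorphicOrderAt_pos H
    have t2 : Tendsto (mtilde y) (𝓝[≠] z) (𝓝 0) :=
      tendsto_zero_of_meromorphicOrderAt_pos (by rw [mtilde_ord h.1, hc]; exact H)
    have t3 : Tendsto (mtilde y) (𝓝[≠] z) (𝓝 (l * 0 + t)) :=
      ((t1.const_mul l).add_const t).congr' ((hrel z).mono fun _ => Eq.symm)
    have := tendsto_nhds_unique t2 t3
    apply ht
    simpa using this.symm
  obtain ⟨w, hwdef⟩ : ∃ w, w = Zq y := ⟨_, rfl⟩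
  have hwd : Differentiable ℂ w := fun z => by rw [hwdef]; exact (Zq_an h (hord z)).differentiableAt
  have hweq : MeroEq w (fun z => (y z)⁻¹) := by rw [hwdef]; exact Zq_eq h.1
  have hwo : ∀ z, w z ≠ 0 → meromorphicOrderAt y z = 0 := by
    intro z hz
    have e1 := (an_ne_of_ord (hwd.analyticAt z)).2 hz
    rw [hweq.order z] at e1
    have e2 : meromorphicOrderAt (fun z => (y z)⁻¹) z = - meromorphicOrderAt y z := meromorphicOrderAt_inv
    rw [e2] at e1
    have := h.2 z
    lift meromorphicOrderAt y z to ℤ using this with n hn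
    have e3 : -n = 0 := by exact_mod_cast e1
    have e4 : n = 0 := by omega
    exact_mod_cast e4
  obtain ⟨a, ha⟩ : ∃ a, a = t / l := ⟨_, rfl⟩
  have ha0 : a ≠ 0 := by rw [ha]; exact div_ne_zero ht hl0
  obtain ⟨K, hK⟩ : ∃ K : ℂ → ℂ, K = fun z => 1 + a * w z := ⟨_, rfl⟩
  have hKd : Differentiable ℂ K := by rw [hK]; fun_prop
  have hyK : MeroEq (mtilde y) (fun z => y z * (l * K z)) := by
    intro z
    filter_upwards [hrel z, hweq z, h.ev z] with v v1 v2 v3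
    rw [v1, hK, ha]
    simp only [v2]
    field_simp
  have hK1d : Differentiable ℂ (fun z => l * K z) := by fun_prop
  refine a_core hKd ?_ ?_ ?_ ?_
  · intro z hz
    have hw0 : w z ≠ 0 := by
      intro H
      rw [hK] at hz
      simp [H] at hz
    have e1 := hwo z hw0
    have e2 := hyK.order z
    have e3 : (fun z => y z * (l * K z)) = y * (fun z => l * K z) := rfl
    rw [e3, meromorphicOrderAt_mul (h.1 z) (hK1d.analyticAt z).meromorphicAt, e1, zero_add, mtilde_ord h.1] at e2
    have e4 := hord ((starRingEnd ℂ) z)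
    rw [e2] at e4
    have e5 := le_antisymm e4 (hK1d.analyticAt z).meromorphicOrderAt_nonneg
    exact (an_ne_of_ord (hK1d.analyticAt z)).1 e5 (by simp [hz])
  · by_contra H
    push Not at H
    have hc : ∀ z, K z = K 0 := fun z => is_const_of_deriv_eq_zero hKd H z 0
    have hyc : MeroEq y (fun _ => ((K 0 - 1) / a)⁻¹) := by
      intro z
      filter_upwards [hweq z] with v hv
      rw [← hc v, hK]
      simp only [hv, add_sub_cancel_left]
      rw [mul_div_cancel_left₀ _ ha0, inv_inv]
    apply h1.2 0
    rw [meromorphicOrderAt_eq_top_iff]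
    filter_upwards [hyc.deriv 0] with v hv
    rw [hv]; simp
  · intro x
    have hp : MeroEq (fun z => (l * K z) * mtilde (fun z => l * K z) z) (fun _ => 1) := by
      intro z
      have e1 : MeroEq y (fun z => mtilde y z * mtilde (fun z => l * K z) z) := by
        have := hyK.tilde
        rw [mtilde_mtilde] at this
        refine this.trans fun z => Eventually.of_forall fun v => ?_
        simp [mtilde]
      filter_upwards [e1 z, hyK z, h.ev z] with v v1 v2 v3
      rw [v2] at v1
      apply mul_left_cancel₀ v3
      linear_combination -v1
    have hta : AnalyticAt ℂ (mtilde (fun z => l * K z)) (x:ℂ) := mtilde_an (hK1d.analyticAt _)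
    have e := (hp.eq_at ((hK1d.analyticAt (x:ℂ)).mul hta).continuousAt continuousAt_const).self_of_nhds
    have e2 : mtilde (fun z => l * K z) (x:ℂ) = (starRingEnd ℂ) (l * K x) := by simp [mtilde]
    simp only [e2] at e
    rw [Complex.mul_conj, Complex.normSq_eq_norm_sq, norm_mul, hl, one_mul] at e
    have e3 : ‖K x‖ ^ 2 = 1 := by exact_mod_cast e
    nlinarith [norm_nonneg (K x)]
  · intro z hz hK1 hT
    have hw0 : w z ≠ 0 := by
      intro H
      apply hK1
      rw [hK]; simp [H]
    apply hz
    apply k3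
    have a1 : Differentiable ℂ (deriv w) := fun v => (hwd.analyticAt v).deriv.differentiableAt
    have a2 : Differentiable ℂ (deriv (deriv w)) := fun v => (a1.analyticAt v).deriv.differentiableAt
    have a3 : Differentiable ℂ (deriv (deriv (deriv w))) := fun v => (a2.analyticAt v).deriv.differentiableAt
    have m3 : MeromorphicAt (deriv (deriv (deriv y))) z := (h.1 z).deriv.deriv.deriv
    rw [← tendsto_zero_iff_meromorphicOrderAt_pos m3]
    have e0 : MeroEq y (fun z => (w z)⁻¹) := fun z => (hweq z).mono fun v hv => by simp only [hv, inv_inv]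
    have e1 := e0.deriv.deriv.deriv z
    have e2 := (inv_third hwd hw0).filter_mono (nhdsWithin_le_nhds (s := {z}ᶜ))
    have d1 : deriv K = fun z => a * deriv w z := by
      funext v; rw [hK]
      exact ((hwd v).hasDerivAt.const_mul a |>.const_add 1).deriv
    have d2 : deriv (deriv K) = fun z => a * deriv (deriv w) z := by
      funext v; rw [d1]
      exact ((a1 v).hasDerivAt.const_mul a).deriv
    have d3 : deriv (deriv (deriv K)) = fun z => a * deriv (deriv (deriv w)) z := by
      funext v; rw [d2]
      exact ((a2 v).hasDerivAt.const_mul a).deriv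
    have hnum : -(deriv (deriv (deriv w)) z) * w z ^ 2 + 6 * (w z * deriv w z * deriv (deriv w) z) - 6 * deriv w z ^ 3 = 0 := by
      unfold Tq at hT
      rw [d3, d2, d1, hK] at hT
      apply mul_left_cancel₀ (pow_ne_zero 3 ha0)
      linear_combination -hT
    refine Tendsto.congr' ((EventuallyEq.trans e1 e2).symm) ?_
    refine Tendsto.mono_left ?_ nhdsWithin_le_nhds
    have hcont : ContinuousAt (fun v =>
      (-(deriv (deriv (deriv w)) v) * w v ^ 2 + 6 * (w v * deriv w v * deriv (deriv w) v) - 6 * deriv w v ^ 3) / w v ^ 4) z := by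
      have c0 := hwd.continuous
      have c1 := a1.continuous
      have c2 := a2.continuous
      have c3 := a3.continuous
      refine ContinuousAt.div (by fun_prop) (by fun_prop) (pow_ne_zero 4 hw0)
    have := hcont.tendsto
    rwa [hnum, zero_div] at this


theorem lin_case {X : ℂ → ℂ} (h : Nd X) (h1 : Nd (deriv X)) {a b : ℂ}
    (hrel : MeroEq (uq X) (fun z => a * z + b))
    (hio : ¬ FiniteOrder X ∨ {z : ℂ | meroOrder X z < 0}.Infinite) : False := by
  have key : ∀ z, ∀ᶠ w in 𝓝[≠] z, AnalyticAt ℂ X w ∧ X w ≠ 0 ∧ a * w + b ≠ 0 ∧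
      deriv X w = X w / (a * w + b) := by
    intro z
    filter_upwards [analytic_ne h.1 z, h.ev z, h1.ev z, hrel z, uq_eq h.1 z] with w e1 e2 e3 e4 e5
    have e6 : a * w + b = X w / deriv X w := by rw [← e4, e5]
    refine ⟨e1, e2, ?_, ?_⟩
    · rw [e6]; exact div_ne_zero e2 e3
    · rw [e6]; field_simp
  by_cases ha : a = 0
  · subst ha
    have hb : b ≠ 0 := by
      obtain ⟨w, -, -, hw, -⟩ := (key 0).exists
      simpa using hw
    have hVm : ∀ z, MeromorphicAt (fun z => X z * exp (-(b⁻¹ * z))) z := fun z =>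
      (h.1 z).mul (by fun_prop : AnalyticAt ℂ (fun z : ℂ => exp (-(b⁻¹ * z))) z).meromorphicAt
    obtain ⟨C, hC⟩ := mero_const hVm (by
      intro z
      filter_upwards [key z] with w ⟨e1, e2, e3, e4⟩
      have d1 : HasDerivAt (fun z : ℂ => exp (-(b⁻¹ * z))) (exp (-(b⁻¹ * w)) * (-(b⁻¹ * 1))) w :=
        (((hasDerivAt_id w).const_mul b⁻¹).neg).cexp
      rw [(e1.differentiableAt.hasDerivAt.fun_mul d1).deriv, e4]
      field_simp
      ring)
    refine exp_absurd C b⁻¹ ?_ hio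
    intro z
    filter_upwards [hC z] with w hw
    rw [← hw, mul_assoc, ← Complex.exp_add]
    simp
  · obtain ⟨z0, hz0⟩ : ∃ z0, z0 = -b / a := ⟨_, rfl⟩
    have hlin : ∀ z, a * z + b = a * (z - z0) := by
      intro z; rw [hz0]; field_simp; ring
    obtain ⟨n, hn⟩ := WithTop.ne_top_iff_exists.1 (h.2 z0)
    have hn := hn.symm
    have hn0 : n ≠ 0 := by
      rintro rfl
      have hA := (uinv_an h (z := z0) (by simpa using hn)).continuousAt
      have t1 : Tendsto (fun w => (uq X w)⁻¹ * (a * w + b)) (𝓝[≠] z0) (𝓝 ((uq X z0)⁻¹ * (a * z0 + b))) :=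
        (hA.mul (by fun_prop : ContinuousAt (fun w : ℂ => a * w + b) z0)).tendsto.mono_left nhdsWithin_le_nhds
      rw [hlin z0, sub_self, mul_zero, mul_zero] at t1
      have t2 : Tendsto (fun w => (uq X w)⁻¹ * (a * w + b)) (𝓝[≠] z0) (𝓝 1) := by
        refine tendsto_const_nhds.congr' ?_
        filter_upwards [hrel z0, key z0] with w e1 ⟨_, _, e2, _⟩
        rw [e1, inv_mul_cancel₀ e2]
      exact zero_ne_one (tendsto_nhds_unique t1 t2)
    obtain ⟨-, hd⟩ := uq_pole h hn hn0
    have hnC : (n:ℂ) ≠ 0 := by exact_mod_cast hn0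
    have hda : a = 1 / (n:ℂ) := by
      rw [← hd]
      have hdf : DifferentiableAt ℂ (uq X) z0 := by
        refine differentiableAt_of_deriv_ne_zero ?_
        rw [hd]; exact one_div_ne_zero hnC
      rw [(hrel.eq_at hdf.continuousAt (by fun_prop)).deriv_eq]
      simp
    have hVm : ∀ z, MeromorphicAt (fun z => X z * (z - z0) ^ (-n)) z := fun z =>
      (h.1 z).mul ((by fun_prop : MeromorphicAt (fun z : ℂ => z - z0) z).zpow _)
    obtain ⟨C, hC⟩ := mero_const hVm (by
      intro z
      filter_upwards [key z] with w ⟨e1, e2, e3, e4⟩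
      rw [hlin] at e3 e4
      have e5 : w - z0 ≠ 0 := fun H => e3 (by rw [H, mul_zero])
      have d1 : HasDerivAt (fun z : ℂ => (z - z0) ^ (-n)) (((-n : ℤ):ℂ) * (w - z0) ^ (-n - 1)) w := by
        have := (hasDerivAt_zpow (-n) (w - z0) (Or.inl e5)).comp w ((hasDerivAt_id w).sub_const z0)
        simpa [Function.comp_def] using this
      rw [(e1.differentiableAt.hasDerivAt.fun_mul d1).deriv, e4, zpow_sub_one₀ e5, hda]
      push_cast
      field_simp
      ring)
    have hX : ∀ z, ∀ᶠ w in 𝓝[≠] z, w - z0 ≠ 0 ∧ X w = C * (w - z0) ^ n := by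
      intro z
      filter_upwards [hC z, key z] with w hw ⟨_, _, e3, _⟩
      rw [hlin] at e3
      have e5 : w - z0 ≠ 0 := fun H => e3 (by rw [H, mul_zero])
      refine ⟨e5, ?_⟩
      rw [← hw, mul_assoc, ← zpow_add₀ e5]
      simp
    rcases le_or_gt 0 n with hn | hn
    · lift n to ℕ using hn
      refine rat_absurd (Polynomial.C C * (Polynomial.X - Polynomial.C z0) ^ n) 1 one_ne_zero ?_ hio
      intro z
      filter_upwards [hX z] with w ⟨_, hw⟩
      rw [hw]; simp
    · obtain ⟨k, hk⟩ : ∃ k : ℕ, n = -(k:ℤ) := ⟨(-n).toNat, by omega⟩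
      refine rat_absurd (Polynomial.C C) ((Polynomial.X - Polynomial.C z0) ^ k)
        (pow_ne_zero _ (Polynomial.X_sub_C_ne_zero z0)) ?_ hio
      intro z
      filter_upwards [hX z] with w ⟨_, hw⟩
      rw [hw, hk]; simp [div_eq_mul_inv]

theorem Gd.an {u : ℂ → ℂ} (hG : Gd u) {z : ℂ} (hz : z.im ≠ 0) : AnalyticAt ℂ u z := by
  rw [Complex.analyticAt_iff_eventually_differentiableAt]
  exact (im_ne_nhds hz).mono fun w hw => (hG w hw).1

theorem K_entire {u : ℂ → ℂ} (hm : ∀ z, MeromorphicAt u z) (hG : Gd u) :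
    ∃ q : ℂ → ℂ, Differentiable ℂ q ∧
      MeroEq (fun z => exp (q z)) (fun z => (1 - deriv u z) / (1 - deriv (mtilde u) z)) ∧
      ∀ z : ℂ, z.im ≠ 0 → exp (q z) = (1 - deriv u z) / (1 - deriv (mtilde u) z) := by
  obtain ⟨A, hA⟩ : ∃ A : ℂ → ℂ, A = fun z => 1 - deriv u z := ⟨_, rfl⟩
  have hAm : ∀ z, MeromorphicAt A z := fun z => by
    rw [hA]; exact (MeromorphicAt.const 1 z).fun_sub (hm z).deriv
  have hB : (fun z => 1 - deriv (mtilde u) z) = mtilde A := by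
    funext z; rw [mtilde_deriv, hA]; simp [mtilde]
  have hoff : ∀ z : ℂ, z.im ≠ 0 → meromorphicOrderAt A z = 0 := by
    intro z hz
    have : AnalyticAt ℂ A z := by rw [hA]; exact analyticAt_const.sub (hG.an hz).deriv
    rw [an_ne_of_ord this, hA]
    exact sub_ne_zero.2 (hG z hz).2.1.symm
  have htop : ∀ z, meromorphicOrderAt A z ≠ ⊤ := by
    apply ne_top_all hAm (z := I)
    rw [hoff I (by simp)]; simp
  have hsym : ∀ z, meromorphicOrderAt A ((starRingEnd ℂ) z) = meromorphicOrderAt A z := by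
    intro z
    by_cases hz : z.im = 0
    · rw [Complex.conj_eq_iff_im.2 hz]
    · rw [hoff z hz, hoff]; simpa using hz
  have hE : ∀ z, MeromorphicAt (A * (mtilde A)⁻¹) z := fun z => (hAm z).mul (mtilde_mer hAm z).inv
  have hord : ∀ z, meromorphicOrderAt (A * (mtilde A)⁻¹) z = 0 := by
    intro z
    rw [meromorphicOrderAt_mul (hAm z) (mtilde_mer hAm z).inv, meromorphicOrderAt_inv, mtilde_ord hAm, hsym]
    obtain ⟨n, hn⟩ := WithTop.ne_top_iff_exists.1 (htop z)
    rw [← hn]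
    exact_mod_cast add_neg_cancel n
  have han : ∀ z, AnalyticAt ℂ (nf (A * (mtilde A)⁻¹)) z := fun z => nf_an hE (hord z).ge
  obtain ⟨q, hq, hq2, -⟩ := exists_log_entire (fun z => (han z).differentiableAt)
    (fun z => (an_ne_of_ord (han z)).1 ((nf_order hE z).trans (hord z)))
  have hfun : (fun z => (1 - deriv u z) / (1 - deriv (mtilde u) z)) = A * (mtilde A)⁻¹ := by
    funext z; simp only [Pi.mul_apply, Pi.inv_apply, ← hB]; rw [hA, div_eq_mul_inv]
  have hM : MeroEq (fun z => exp (q z)) (fun z => (1 - deriv u z) / (1 - deriv (mtilde u) z)) := by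
    rw [hfun, funext hq2]; exact nf_eq hE
  refine ⟨q, hq, hM, ?_⟩
  intro z hz
  refine (hM.eq_at (hq z).continuousAt.cexp ?_).eq_of_nhds
  refine ContinuousAt.div ?_ ?_ (sub_ne_zero.2 (hG.tilde z hz).2.1.symm)
  · exact continuousAt_const.sub (hG.an hz).deriv.continuousAt
  · exact continuousAt_const.sub (hG.tilde.an hz).deriv.continuousAt


theorem rel_of_const {u : ℂ → ℂ} (hm : ∀ z, MeromorphicAt u z) {c : ℂ}
    (hc : MeroEq (fun z => 1 - deriv u z) (fun z => c * (1 - deriv (mtilde u) z))) :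
    ∃ d : ℂ, MeroEq u (fun z => c * mtilde u z + ((1 - c) * z - d)) := by
  have hm' := mtilde_mer hm
  have hVm : ∀ z, MeromorphicAt (fun z => (z - u z) - c * (z - mtilde u z)) z := fun z =>
    ((MeromorphicAt.id z).fun_sub (hm z)).fun_sub
      ((MeromorphicAt.const c z).fun_mul ((MeromorphicAt.id z).fun_sub (hm' z)))
  obtain ⟨d, hd⟩ := mero_const hVm (by
    intro z
    filter_upwards [analytic_ne hm z, analytic_ne hm' z, hc z] with w e1 e2 e3
    have d1 := ((hasDerivAt_id w).fun_sub e1.differentiableAt.hasDerivAt).fun_sub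
      (((hasDerivAt_id w).fun_sub e2.differentiableAt.hasDerivAt).const_mul c)
    have d2 := d1.deriv
    simp only [id] at d2
    rw [d2, e3, sub_self])
  refine ⟨d, fun z => ?_⟩
  filter_upwards [hd z] with w hw
  rw [← hw]; ring

theorem b2_main {X : ℂ → ℂ} (h : Nd X) (h1 : Nd (deriv X)) (h2 : Nd (deriv (deriv X)))
    (h3 : Nd (deriv (deriv (deriv X))))
    (k0 : ∀ z : ℂ, 0 < meromorphicOrderAt X z → z.im = 0)
    (k1 : ∀ z : ℂ, 0 < meromorphicOrderAt (deriv X) z → z.im = 0)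
    (k2 : ∀ z : ℂ, 0 < meromorphicOrderAt (deriv (deriv X)) z → z.im = 0)
    (k3 : ∀ z : ℂ, 0 < meromorphicOrderAt (deriv (deriv (deriv X))) z → z.im = 0)
    {d : ℂ} (hd : d ≠ 0) (hrel : MeroEq (uq X) (fun z => mtilde (uq X) z - d))
    (hio : ¬ FiniteOrder X ∨ {z : ℂ | meroOrder X z < 0}.Infinite)
    (hio1 : ¬ FiniteOrder (deriv X) ∨ {z : ℂ | meroOrder (deriv X) z < 0}.Infinite) : False := by
  have hG : Gd (uq X) := gd_uq h h1 h2 k0 k1 k2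
  have hG1 : Gd (uq (deriv X)) := gd_uq h1 h2 h3 k1 k2 k3
  have hum : ∀ z, MeromorphicAt (uq X) z := fun z => nf_mer _ z
  have hu1m : ∀ z, MeromorphicAt (uq (deriv X)) z := fun z => nf_mer _ z
  -- u1 in terms of u
  have hU1 : MeroEq (uq (deriv X)) (fun z => uq X z / (1 - deriv (uq X) z)) := by
    intro z
    filter_upwards [uq_eq h.1 z, uq_eq h1.1 z, uq_P h h1 z, h.ev z, h1.ev z, h2.ev z] with w e1 e2 e3 e4 e5 e6
    rw [e2, e3, e1]; field_simp
  have hU1off : ∀ z : ℂ, z.im ≠ 0 → uq (deriv X) z = uq X z / (1 - deriv (uq X) z) := by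
    intro z hz
    refine (hU1.eq_at (hG1.an hz).continuousAt ?_).eq_of_nhds
    exact (hG.an hz).continuousAt.div (continuousAt_const.sub (hG.an hz).deriv.continuousAt)
      (sub_ne_zero.2 (hG z hz).2.1.symm)
  have hvoff : ∀ z : ℂ, z.im ≠ 0 → mtilde (uq X) =ᶠ[𝓝 z] fun w => uq X w + d := by
    intro z hz
    have := hrel.eq_at (hG.an hz).continuousAt ((hG.tilde.an hz).continuousAt.sub continuousAt_const)
    filter_upwards [this] with w hw
    rw [hw]; ring
  have hV1off : ∀ z : ℂ, z.im ≠ 0 → mtilde (uq (deriv X)) z = (uq X z + d) / (1 - deriv (uq X) z) := by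
    intro z hz
    have e1 : mtilde (uq (deriv X)) z = mtilde (uq X) z / (1 - deriv (mtilde (uq X)) z) := by
      rw [mtilde_deriv]
      unfold mtilde
      rw [hU1off _ (by simpa using hz)]
      simp
    rw [e1, (hvoff z hz).eq_of_nhds, (hvoff z hz).deriv_eq]
    simp
  have hGa : Gd (fun z => uq X z / (1 - deriv (uq X) z)) := hG1.congr hU1off
  have hGb : Gd (fun z => (uq X z + d) / (1 - deriv (uq X) z)) := hG1.tilde.congr hV1off
  obtain ⟨q, hq, hqM, hqoff⟩ := K_entire hu1m hG1
  by_cases hqn : ∃ z, deriv q z ≠ 0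
  · have hdn : 0 < ‖d‖ := norm_pos_iff.2 hd
    have hreal : ∀ x : ℝ, meromorphicOrderAt X x = 0 ∧ ‖(uq X x)⁻¹‖ ≤ 2 / ‖(-d)‖ := by
      intro x
      refine real_bd (ℓ := fun _ => -d) (c := 1) h (by simp) continuous_const ?_ x (neg_ne_zero.2 hd)
      intro z; filter_upwards [hrel z] with w hw
      rw [hw]; ring
    obtain ⟨p, hp⟩ := b2_core (u := uq X) (q := q) (Z := Zq X) (d := d) (κ := ‖d‖ / 2) (by positivity)
      hG hGa hGb hq (by
        intro z hz
        rw [hqoff z hz]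
        have a1 : (fun z => uq X z / (1 - deriv (uq X) z)) =ᶠ[𝓝 z] uq (deriv X) :=
          (im_ne_nhds hz).mono fun w hw => (hU1off w hw).symm
        have a2 : (fun z => (uq X z + d) / (1 - deriv (uq X) z)) =ᶠ[𝓝 z] mtilde (uq (deriv X)) :=
          (im_ne_nhds hz).mono fun w hw => (hV1off w hw).symm
        rw [a1.deriv_eq, a2.deriv_eq]) hqn (by
        intro x
        refine ⟨?_, ?_⟩
        · have := uinv_an h (hreal x).1
          exact this.eventually_analyticAt.mono fun w hw => hw.differentiableAt
        · refine (hreal x).2.trans (le_of_eq ?_)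
          rw [norm_neg]; field_simp) (by
        intro z
        refine (Zq_an h ?_).differentiableAt
        by_cases hz : z.im = 0
        · have : ((z.re : ℝ) : ℂ) = z := by apply Complex.ext <;> simp [hz]
          rw [← this]; exact (hreal z.re).1.le
        · exact not_lt.1 fun H => hz (k0 z H)) (by
        intro z hz
        refine Zq_deriv h ?_
        by_cases hz' : z.im = 0
        · have : ((z.re : ℝ) : ℂ) = z := by apply Complex.ext <;> simp [hz']
          rw [← this]; exact (hreal z.re).1
        · exact ord_zero_of_u h (hz hz'))
    have hp0 : p ≠ 0 := by
      rintro rfl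
      obtain ⟨w, e1, e2⟩ := ((Zq_eq h.1 0).and (h.ev 0)).exists
      rw [hp] at e1
      simp at e1
      exact e2 e1.symm
    refine rat_absurd 1 p hp0 ?_ hio
    intro z
    filter_upwards [Zq_eq h.1 z] with w e1
    rw [← hp, e1]; simp
  · push Not at hqn
    have hqc : ∀ z, q z = q 0 := fun z => is_const_of_deriv_eq_zero hq hqn z 0
    obtain ⟨c, hc⟩ : ∃ c, c = exp (q 0) := ⟨_, rfl⟩
    have hcM : MeroEq (fun z => 1 - deriv (uq (deriv X)) z)
        (fun z => c * (1 - deriv (mtilde (uq (deriv X))) z)) := by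
      intro z
      filter_upwards [hqM z] with w hw
      have hne : (1 - deriv (mtilde (uq (deriv X))) w) ≠ 0 := by
        intro H
        rw [H, div_zero] at hw
        exact Complex.exp_ne_zero _ hw
      rw [hqc w, ← hc] at hw
      rw [hw]; field_simp
    obtain ⟨d1, hd1⟩ := rel_of_const hu1m hcM
    by_cases hc1 : c = 1
    · -- u affine
      rw [hc1] at hd1
      have hA : MeroEq (fun z => d / (1 - deriv (uq X) z)) (fun _ => d1) := by
        have hv : MeroEq (mtilde (uq X)) (fun z => uq X z + d) := fun z => by
          filter_upwards [hrel z] with w hw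
          rw [hw]; ring
        have hv1 : MeroEq (mtilde (uq (deriv X))) (fun z => mtilde (uq X) z / (1 - deriv (mtilde (uq X)) z)) := by
          refine (MeroEq.tilde hU1).trans ?_
          intro z
          refine Eventually.of_forall fun w => ?_
          rw [mtilde_deriv]; simp [mtilde]
        intro z
        filter_upwards [hd1 z, hv1 z, hv z, hv.deriv z, hU1 z] with w e1 e2 e3 e4 e5
        have e6 : deriv (fun z => uq X z + d) w = deriv (uq X) w := by simp
        rw [e2, e3, e4, e6, e5] at e1
        have : d / (1 - deriv (uq X) w) = (uq X w + d) / (1 - deriv (uq X) w) - uq X w / (1 - deriv (uq X) w) := by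
          ring
        rw [this]
        linear_combination -e1
      have hd1 : d1 ≠ 0 := by
        obtain ⟨w, e1, e2, e3, e4, e5⟩ := ((hA 0).and ((uq_P h h1 0).and ((h.ev 0).and ((h1.ev 0).and (h2.ev 0))))).exists
        have e1 : d / (1 - deriv (uq X) w) = d1 := e1
        simp only [] at e2
        rw [← e1, e2]
        exact div_ne_zero hd (div_ne_zero (mul_ne_zero e3 e5) (pow_ne_zero _ e4))
      obtain ⟨a, ha⟩ : ∃ a, a = 1 - d / d1 := ⟨_, rfl⟩
      have hua : MeroEq (deriv (uq X)) (fun _ => a) := by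
        intro z
        filter_upwards [hA z] with w hw
        have : (1 - deriv (uq X) w) ≠ 0 := by
          intro H; rw [H, div_zero] at hw; exact hd1 hw.symm
        rw [ha, ← hw]; field_simp; ring
      have hVm : ∀ z, MeromorphicAt (fun z => uq X z - a * z) z := fun z =>
        (hum z).fun_sub ((MeromorphicAt.const a z).fun_mul (MeromorphicAt.id z))
      obtain ⟨b, hb⟩ := mero_const hVm (by
        intro z
        filter_upwards [analytic_ne hum z, hua z] with w e1 e2
        have := (e1.differentiableAt.hasDerivAt.fun_sub ((hasDerivAt_id w).const_mul a)).deriv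
        simp only [id] at this
        rw [this, e2]; ring)
      refine lin_case h h1 (a := a) (b := b) ?_ hio
      intro z
      filter_upwards [hb z] with w hw
      rw [← hw]; ring
    · exact b1_main h1 hG1 k1 hd1 hc1 hio1


theorem Fm_deriv {f : ℂ → ℂ} (hf : ∀ z, MeromorphicAt f z) (m : ℕ)
    (hX : ∀ z, MeromorphicAt (iteratedDeriv m f) z) :
    MeroEq (deriv (Fm f m)) (fun z => 1 - deriv (uq (iteratedDeriv m f)) z) := by
  have e : MeroEq (Fm f m) (fun z => z - uq (iteratedDeriv m f) z) := by
    intro z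
    filter_upwards [uq_eq hX z] with w hw
    rw [hw, Fm, iteratedDeriv_succ]
  refine e.deriv.trans ?_
  intro z
  filter_upwards [analytic_ne (fun z => nf_mer _ z : ∀ z, MeromorphicAt (uq (iteratedDeriv m f)) z) z] with w hw
  exact ((hasDerivAt_id w).fun_sub hw.differentiableAt.hasDerivAt).deriv

theorem uq_tilde {X : ℂ → ℂ} (h : ∀ z, MeromorphicAt X z) : MeroEq (uq (mtilde X)) (mtilde (uq X)) := by
  refine (uq_eq (mtilde_mer h)).trans (MeroEq.trans ?_ (uq_eq h).tilde.symm)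
  intro z
  refine Eventually.of_forall fun w => ?_
  rw [mtilde_deriv]; simp [mtilde]

theorem prop_of_uq {X : ℂ → ℂ} (h : Nd X) (h1 : Nd (deriv X))
    (hrel : MeroEq (uq X) (mtilde (uq X))) : ∃ c : ℂ, MeroEq (mtilde X) (fun z => c * X z) := by
  have hY := mtilde_mer h.1
  have hYt : Nd (mtilde X) := ⟨hY, fun z => by rw [mtilde_ord h.1]; exact h.2 _⟩
  have hYt1 : Nd (deriv (mtilde X)) := by
    rw [mtilde_deriv]
    exact ⟨mtilde_mer h1.1, fun z => by rw [mtilde_ord h1.1]; exact h1.2 _⟩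
  have hVm : ∀ z, MeromorphicAt (fun z => mtilde X z / X z) z := fun z => (hY z).fun_div (h.1 z)
  obtain ⟨c, hc⟩ := mero_const hVm (by
    intro z
    filter_upwards [analytic_ne h.1 z, analytic_ne hY z, h.ev z, h1.ev z, hYt1.ev z, uq_eq h.1 z, uq_eq hY z,
      hrel z, uq_tilde h.1 z] with w e1 e2 e3 e4 e5 e6 e7 e8 e9
    rw [(e2.differentiableAt.hasDerivAt.fun_div e1.differentiableAt.hasDerivAt e3).deriv]
    have : X w / deriv X w = mtilde X w / deriv (mtilde X) w := by rw [← e6, ← e7, e8, e9]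
    rw [div_eq_div_iff e4 e5] at this
    rw [div_eq_zero_iff]; left
    linear_combination this)
  refine ⟨c, fun z => ?_⟩
  filter_upwards [hc z, h.ev z] with w e1 e2
  rw [← e1]; field_simp

theorem main_one (f : ℂ → ℂ) (hmero : ∀ z, MeromorphicAt f z)
    (hsnr : StrictlyNonReal f)
    (hreal : ∀ m, m ≤ 10 → ∀ z : ℂ, 0 < meroOrder (iteratedDeriv m f) z → z.im = 0)
    (hio : ∀ m : ℕ, ¬ FiniteOrder (iteratedDeriv m f) ∨
      {z : ℂ | meroOrder (iteratedDeriv m f) z < 0}.Infinite) (m : ℕ) (hm : m ≤ 7)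
    (K : ℂ → ℂ) (hK : IsKm f m K) (c : ℂ) (hc : MeroEq K (fun _ => c)) : False := by
  have hX : ∀ i z, MeromorphicAt (iteratedDeriv i f) z := by
    intro i
    induction i with
    | zero => simpa using hmero
    | succ n ih => rw [iteratedDeriv_succ]; exact mer_deriv ih
  have hN : ∀ i, Nd (iteratedDeriv i f) := by
    intro i
    refine ⟨hX i, fun z hz => ?_⟩
    refine rat_absurd 0 1 one_ne_zero ?_ (hio i)
    simpa using mero_zero (hX i) hz
  have hz : ∀ i, i ≤ 10 → ∀ z : ℂ, 0 < meromorphicOrderAt (iteratedDeriv i f) z → z.im = 0 := by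
    intro i hi z h; exact hreal i hi z (by rwa [meroOrder_eq])
  have s1 : ∀ i, deriv (iteratedDeriv i f) = iteratedDeriv (i + 1) f := fun i => iteratedDeriv_succ.symm
  have hm' := mtilde_mer hmero
  have hum : ∀ z, MeromorphicAt (uq (iteratedDeriv m f)) z := fun z => nf_mer _ z
  have hG : Gd (uq (iteratedDeriv m f)) := by
    refine gd_uq (hN m) ?_ ?_ (hz m (by omega)) ?_ ?_
    · rw [s1]; exact hN _
    · rw [s1, s1]; exact hN _
    · rw [s1]; exact hz _ (by omega)
    · rw [s1, s1]; exact hz _ (by omega)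
  obtain ⟨d, hd⟩ := rel_of_const hum (c := c) (by
    intro z
    have hY : ∀ z, MeromorphicAt (iteratedDeriv m (mtilde f)) z := by
      rw [mtilde_iter]; exact mtilde_mer (hX m)
    have a := uq_tilde (hX m)
    rw [← mtilde_iter] at a
    filter_upwards [Fm_deriv hmero m (hX m) z, Fm_deriv hm' m hY z, hK.2.2.2 z, hc z, a.deriv z] with w e1 e2 e3 e4 e5
    rw [← e1, e3, e2, e4, e5])
  by_cases hc1 : c = 1
  · subst hc1
    by_cases hd0 : d = 0
    · subst hd0
      have hPm : ∃ c : ℂ, MeroEq (mtilde (iteratedDeriv m f)) (fun z => c * iteratedDeriv m f z) := by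
        refine prop_of_uq (hN m) (by rw [s1]; exact hN _) ?_
        intro z
        filter_upwards [hd z] with w hw
        rw [hw]; ring
      have hP0 : ¬ ∃ c : ℂ, MeroEq (mtilde (iteratedDeriv 0 f)) (fun z => c * iteratedDeriv 0 f z) := by
        rw [iteratedDeriv_zero]; exact hsnr
      obtain ⟨j, hj, hj0, l, hl⟩ : ∃ j, j < m ∧
          (¬ ∃ c : ℂ, MeroEq (mtilde (iteratedDeriv j f)) (fun z => c * iteratedDeriv j f z)) ∧
          ∃ c : ℂ, MeroEq (mtilde (iteratedDeriv (j+1) f)) (fun z => c * iteratedDeriv (j+1) f z) := by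
        by_contra hcon
        push Not at hcon
        have : ∀ i, i ≤ m → ¬ ∃ c : ℂ, MeroEq (mtilde (iteratedDeriv i f)) (fun z => c * iteratedDeriv i f z) := by
          intro i
          induction i with
          | zero => intro _; exact hP0
          | succ n ih =>
            intro hn
            rintro ⟨c, hcc⟩
            exact hcon n (by omega) (by simpa using ih (by omega)) c hcc
        exact this m le_rfl hPm
      have hYj := mtilde_mer (hX j)
      have hVm : ∀ z, MeromorphicAt (fun z => mtilde (iteratedDeriv j f) z - l * iteratedDeriv j f z) z := fun z =>
        (hYj z).fun_sub ((MeromorphicAt.const l z).fun_mul (hX j z))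
      obtain ⟨t, ht⟩ := mero_const hVm (by
        intro z
        filter_upwards [analytic_ne (hX j) z, analytic_ne hYj z, hl z] with w e1 e2 e3
        rw [(e2.differentiableAt.hasDerivAt.fun_sub (e1.differentiableAt.hasDerivAt.const_mul l)).deriv,
          mtilde_deriv, s1, e3, sub_self])
      have hrel : MeroEq (mtilde (iteratedDeriv j f)) (fun z => l * iteratedDeriv j f z + t) := by
        intro z
        filter_upwards [ht z] with w hw
        rw [← hw]; ring
      have ht0 : t ≠ 0 := by
        rintro rfl
        exact hj0 ⟨l, by simpa using hrel⟩
      have hln : ‖l‖ = 1 := by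
        have b := hl.tilde
        rw [mtilde_mtilde] at b
        obtain ⟨w, e1, e2, e3⟩ := ((b 0).and ((hl 0).and ((hN (j+1)).ev 0))).exists
        have e4 : mtilde (fun z => l * iteratedDeriv (j+1) f z) w
            = (starRingEnd ℂ) l * mtilde (iteratedDeriv (j+1) f) w := by simp [mtilde]
        rw [e4, e2, ← mul_assoc, Complex.conj_mul'] at e1
        have e5 : ((‖l‖:ℂ)) ^ 2 = 1 := by
          apply mul_right_cancel₀ e3
          rw [← e1, one_mul]
        have e6 : ‖l‖ ^ 2 = 1 := by exact_mod_cast e5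
        nlinarith [norm_nonneg l]
      refine a_main (hN j) (by rw [s1]; exact hN _) (hz j (by omega)) ?_ hln ht0 hrel
      rw [s1, s1, s1]; exact hz _ (by omega)
    · refine b2_main (hN m) ?_ ?_ ?_ (hz m (by omega)) ?_ ?_ ?_ hd0 ?_ (hio m) ?_
      · rw [s1]; exact hN _
      · rw [s1, s1]; exact hN _
      · rw [s1, s1, s1]; exact hN _
      · rw [s1]; exact hz _ (by omega)
      · rw [s1, s1]; exact hz _ (by omega)
      · rw [s1, s1, s1]; exact hz _ (by omega)
      · intro z
        filter_upwards [hd z] with w hw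
        rw [hw]; ring
      · rw [s1]; exact hio _
  · exact b1_main (hN m) hG (hz m (by omega)) hd hc1 (hio m)


/-- Lemma 5.1 of the paper: for a strictly non-real meromorphic `f` with all
zeros of `f^(m)` real for `m ≤ 10`, such that every `f^(m)` has infinite order or infinitely
many poles, there are no `2 ≤ m < m' ≤ 7` with `K_m` and `K_{m'}` both constant. -/
theorem statement_18 (f : ℂ → ℂ) (hmero : ∀ z, MeromorphicAt f z)
    (hsnr : StrictlyNonReal f)
    (hreal : ∀ m, m ≤ 10 → ∀ z : ℂ, 0 < meroOrder (iteratedDeriv m f) z → z.im = 0)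
    (hio : ∀ m : ℕ, ¬ FiniteOrder (iteratedDeriv m f) ∨
      {z : ℂ | meroOrder (iteratedDeriv m f) z < 0}.Infinite) :
    ¬ ∃ (m m' : ℕ) (Km Km' : ℂ → ℂ), 2 ≤ m ∧ m < m' ∧ m' ≤ 7 ∧
      IsKm f m Km ∧ IsKm f m' Km' ∧
      (∃ c : ℂ, MeroEq Km (fun _ => c)) ∧ (∃ c : ℂ, MeroEq Km' (fun _ => c)) := by
  rintro ⟨m, m', Km, Km', -, hlt, hle, hK, -, ⟨c, hc⟩, -⟩
  exact main_one f hmero hsnr hreal hio m (by omega) Km hK c hc
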